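/- Let n ≥ 7 and let u : ℝⁿ \ {0} → (0,∞) be a six-times continuously differentiable positive solution of (−Δ)³u = c_n·u^((n+6)/(n−6)) on ℝⁿ \ {0} which is unbounded near the origin (i.e. the origin is a non-removable singularity). Then u is radially symmetric about the origin: u(x) = u(y) whenever |x| = |y|. Moreover, its Emden–Fowler transform v(t) := e^(−((n−6)/2)t)·u(e^(−t)ω) (which is independent of the unit vector ω) is a positive, bounded, periodic solution on ℝ of the ODE −v⁽⁶⁾ + K₄v⁽⁴⁾ − K₂v″ + K₀v = c_n·v^((n+6)/(n−6)). -/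

import Mathlib

noncomputable section

def K4 (n : ℕ) : ℝ := (3*(n:ℝ)^2 - 12*(n:ℝ) + 44)/4
def K2 (n : ℕ) : ℝ := (3*(n:ℝ)^4 - 24*(n:ℝ)^3 + 72*(n:ℝ)^2 - 96*(n:ℝ) + 304)/16
def K0 (n : ℕ) : ℝ := ((n:ℝ)-6)^2*((n:ℝ)-2)^2*((n:ℝ)+2)^2/64
def cst (n : ℕ) : ℝ := ((n:ℝ)-6)*((n:ℝ)-4)*((n:ℝ)-2)*(n:ℝ)*((n:ℝ)+2)*((n:ℝ)+4)/64

/-- The Euclidean Laplacian Δu(x) = Σᵢ ∂²u/∂xᵢ²(x) on ℝⁿ. -/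
def lap {n : ℕ} (u : EuclideanSpace ℝ (Fin n) → ℝ) (x : EuclideanSpace ℝ (Fin n)) : ℝ :=
  ∑ i : Fin n, fderiv ℝ (fun y => fderiv ℝ u y (EuclideanSpace.single i 1)) x
    (EuclideanSpace.single i 1)


section
/-- weighted monotonicity for `g' = h + r g`. -/
lemma wmono {g h : ℝ → ℝ} {r s t : ℝ} (hg : ∀ t, HasDerivAt g (h t + r * g t) t)
    (hst : s ≤ t) (hh : ∀ q, s < q → q < t → 0 ≤ h q) :
    Real.exp (-r * s) * g s ≤ Real.exp (-r * t) * g t := by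
  have hd : ∀ t, HasDerivAt (fun t => Real.exp (-r * t) * g t) (Real.exp (-r * t) * h t) t := by
    intro t
    have h1 : HasDerivAt (fun t => Real.exp (-r * t)) (Real.exp (-r * t) * (-r)) t := by
      simpa using ((hasDerivAt_id t).const_mul (-r)).exp
    exact (h1.mul (hg t)).congr_deriv (by ring)
  have := monotoneOn_of_deriv_nonneg (D := Set.Icc s t) (convex_Icc s t)
    (f := fun t => Real.exp (-r * t) * g t)
    (fun x _ => (hd x).continuousAt.continuousWithinAt)
    (fun x _ => (hd x).differentiableAt.differentiableWithinAt)
    (by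
      intro x hx
      rw [interior_Icc] at hx
      rw [(hd x).deriv]
      exact mul_nonneg (Real.exp_pos _).le (hh x hx.1 hx.2))
  exact this (Set.left_mem_Icc.2 hst) (Set.right_mem_Icc.2 hst) hst

lemma wanti {g h : ℝ → ℝ} {r s t : ℝ} (hg : ∀ t, HasDerivAt g (h t + r * g t) t)
    (hst : s ≤ t) (hh : ∀ q, s < q → q < t → h q ≤ 0) :
    Real.exp (-r * t) * g t ≤ Real.exp (-r * s) * g s := by
  have := wmono (g := fun t => - g t) (h := fun t => - h t) (r := r) (s := s) (t := t)
    (fun t => (hg t).neg.congr_deriv (by ring)) hst (fun q h1 h2 => by have := hh q h1 h2; linarith)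
  simp only [mul_neg] at this
  linarith

lemma negpt {g h : ℝ → ℝ} {r s t : ℝ} (hg : ∀ t, HasDerivAt g (h t + r * g t) t)
    (hst : s ≤ t) (h0 : 0 ≤ g s) (h1 : g t < 0) : ∃ q, s < q ∧ q < t ∧ h q < 0 := by
  by_contra hc
  push Not at hc
  have := wmono hg hst hc
  have h2 := mul_nonneg (Real.exp_pos (-r * s)).le h0
  have h3 := mul_neg_of_pos_of_neg (Real.exp_pos (-r * t)) h1
  linarith

lemma negpt' {g h : ℝ → ℝ} {r s t : ℝ} (hg : ∀ t, HasDerivAt g (h t + r * g t) t)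
    (hst : s ≤ t) (h0 : 0 < g s) (h1 : g t ≤ 0) : ∃ q, s < q ∧ q < t ∧ h q < 0 := by
  by_contra hc
  push Not at hc
  have := wmono hg hst hc
  have h2 := mul_pos (Real.exp_pos (-r * s)) h0
  have h3 := mul_nonpos_of_nonneg_of_nonpos (Real.exp_pos (-r * t)).le h1
  linarith

/-- once negative, stays nonpositive -/
def PM (h : ℝ → ℝ) (s t : ℝ) : Prop := ∀ p q, s ≤ p → p ≤ q → q ≤ t → h p < 0 → h q ≤ 0

lemma PM.step' {g h : ℝ → ℝ} {r s t : ℝ} (hg : ∀ t, HasDerivAt g (h t + r * g t) t)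
    (hh : PM h s t) (h0 : 0 ≤ g s) {p q : ℝ} (hp : s ≤ p) (hpq : p ≤ q) (hq : q ≤ t)
    (hgp : g p < 0) : g q < 0 := by
  obtain ⟨o, ho1, ho2, ho3⟩ := negpt hg hp h0 hgp
  have := wanti hg hpq (fun y h1 h2 => hh o y ho1.le (by linarith) (by linarith) ho3)
  have h3 := mul_neg_of_pos_of_neg (Real.exp_pos (-r * p)) hgp
  by_contra hc
  push Not at hc
  have h4 := mul_nonneg (Real.exp_pos (-r * q)).le hc
  linarith

lemma PM.step {g h : ℝ → ℝ} {r s t : ℝ} (hg : ∀ t, HasDerivAt g (h t + r * g t) t)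
    (hh : PM h s t) (h0 : 0 ≤ g s) : PM g s t :=
  fun _ _ hp hpq hq hgp => (hh.step' hg h0 hp hpq hq hgp).le

structure Chain (a b c M : ℝ) (x1 x2 x3 x4 x5 x6 x7 : ℝ → ℝ) : Prop where
  ha : 0 < a
  hab : a ≤ b
  hac : a ≤ c
  h1 : ∀ t, HasDerivAt x1 (x2 t + (-a) * x1 t) t
  h2 : ∀ t, HasDerivAt x2 (x3 t + (-b) * x2 t) t
  h3 : ∀ t, HasDerivAt x3 (x4 t + (-c) * x3 t) t
  h4 : ∀ t, HasDerivAt x4 (x5 t + b * x4 t) t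
  h5 : ∀ t, HasDerivAt x5 (x6 t + a * x5 t) t
  h6 : ∀ t, HasDerivAt x6 (x7 t + c * x6 t) t
  h7p : ∀ t, 0 ≤ x1 t → x7 t ≤ 0
  h7n : ∀ t, x1 t ≤ 0 → 0 ≤ x7 t
  b4 : ∀ t, |x4 t| ≤ M
  b5 : ∀ t, |x5 t| ≤ M

structure CState (x1 x2 x3 x4 x5 x6 : ℝ → ℝ) (s : ℝ) : Prop where
  h1 : x1 s ≤ 0
  h2 : x2 s ≤ 0
  h3 : x3 s ≤ 0
  h4 : x4 s = 0
  h5 : 0 < x5 s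
  h6 : 0 ≤ x6 s

section
variable {a b c M : ℝ} {x1 x2 x3 x4 x5 x6 x7 : ℝ → ℝ}

lemma Chain.neg (C : Chain a b c M x1 x2 x3 x4 x5 x6 x7) :
    Chain a b c M (-x1) (-x2) (-x3) (-x4) (-x5) (-x6) (-x7) where
  ha := C.ha
  hab := C.hab
  hac := C.hac
  h1 t := (C.h1 t).neg.congr_deriv (by simp only [Pi.neg_apply]; ring)
  h2 t := (C.h2 t).neg.congr_deriv (by simp only [Pi.neg_apply]; ring)
  h3 t := (C.h3 t).neg.congr_deriv (by simp only [Pi.neg_apply]; ring)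
  h4 t := (C.h4 t).neg.congr_deriv (by simp only [Pi.neg_apply]; ring)
  h5 t := (C.h5 t).neg.congr_deriv (by simp only [Pi.neg_apply]; ring)
  h6 t := (C.h6 t).neg.congr_deriv (by simp only [Pi.neg_apply]; ring)
  h7p t h := by have := C.h7n t (by simpa using h); simpa using this
  h7n t h := by have := C.h7p t (by simpa using h); simpa using this
  b4 t := by simpa using C.b4 t
  b5 t := by simpa using C.b5 t

lemma exp_unbdd {g : ℝ → ℝ} {r M ε s : ℝ} (hr : 0 < r) (hε : 0 < ε)
    (h : ∀ t, s ≤ t → ε ≤ Real.exp (-r * t) * g t) (hM : ∀ t, |g t| ≤ M) : False := by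
  have h1 : Filter.Tendsto (fun t => Real.exp (-r * t) * M) Filter.atTop (nhds (0 * M)) := by
    apply Filter.Tendsto.mul_const
    apply Real.tendsto_exp_atBot.comp
    exact Filter.tendsto_id.const_mul_atTop_of_neg (by linarith)
  rw [zero_mul] at h1
  have h2 := ((h1.eventually (gt_mem_nhds hε)).and (Filter.eventually_ge_atTop s)).exists
  obtain ⟨t, ht1, ht2⟩ := h2
  have h3 := h t ht2
  have h4 := mul_le_mul_of_nonneg_left ((le_abs_self _).trans (hM t)) (Real.exp_pos (-r * t)).le
  linarith

/-- existence of the next zero of `x4`, with signs of `x5`, `x6` there -/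
lemma Chain.core (C : Chain a b c M x1 x2 x3 x4 x5 x6 x7) {s : ℝ}
    (h4 : ∃ e, s < e ∧ ∀ t, s < t → t < e → 0 < x4 t) (h5 : 0 ≤ x5 s)
    (h6 : ∀ t, s < t → (∀ q, s < q → q < t → 0 < x4 q) → PM x6 s t) :
    ∃ t, s < t ∧ (∀ q, s < q → q < t → 0 < x4 q) ∧ x4 t = 0 ∧ x5 t < 0 ∧ x6 t ≤ 0 := by
  have hc4 : Continuous x4 := continuous_iff_continuousAt.2 fun t => (C.h4 t).continuousAt
  obtain ⟨e, hse, he⟩ := h4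
  set m := (s + e) / 2 with hm
  have hm1 : s < m := by rw [hm]; linarith
  have hm2 : m < e := by rw [hm]; linarith
  have hx4m : 0 < x4 m := he m hm1 hm2
  by_cases hz : ∃ t, m ≤ t ∧ x4 t ≤ 0
  · -- first zero
    set S := {t | m ≤ t ∧ x4 t ≤ 0} with hS
    have hSc : IsClosed S := (isClosed_le continuous_const continuous_id).inter
      (isClosed_le hc4 continuous_const)
    have hSb : BddBelow S := ⟨m, fun t ht => ht.1⟩
    have hmem : sInf S ∈ S := hSc.csInf_mem hz hSb
    set t := sInf S with ht
    have hmt : m < t := lt_of_le_of_ne hmem.1 (by intro h; rw [← h] at hmem; linarith [hmem.2])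
    have hpos : ∀ q, s < q → q < t → 0 < x4 q := by
      intro q hq1 hq2
      by_cases hqm : q < m
      · exact he q hq1 (by linarith)
      · push Not at hqm
        by_contra hcq
        push Not at hcq
        exact absurd (csInf_le hSb (show q ∈ S from ⟨hqm, hcq⟩)) (by rw [← ht]; linarith)
    have hzero : x4 t = 0 := by
      apply le_antisymm hmem.2
      have hcl : t ∈ closure (Set.Ioo m t) := by
        rw [closure_Ioo hmt.ne]; exact Set.right_mem_Icc.2 hmt.le
      have : closure (Set.Ioo m t) ⊆ {t | 0 ≤ x4 t} :=
        closure_minimal (fun q hq => (hpos q (by linarith [hq.1]) hq.2).le)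
          (isClosed_le continuous_const hc4)
      exact this hcl
    have hst : s < t := by linarith
    have P6 := h6 t hst hpos
    have P5 : ∀ p q, s ≤ p → p ≤ q → q ≤ t → x5 p < 0 → x5 q < 0 :=
      fun p q h1 h2 h3 h4 => P6.step' C.h5 h5 h1 h2 h3 h4
    obtain ⟨q, hq1, hq2, hq3⟩ := negpt' C.h4 hmt.le hx4m hzero.le
    have h5t := P5 q t (by linarith) hq2.le le_rfl hq3
    obtain ⟨q', hq1', hq2', hq3'⟩ := negpt C.h5 hst.le h5 h5t
    exact ⟨t, hst, hpos, hzero, h5t, P6 q' t hq1'.le hq2'.le le_rfl hq3'⟩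
  · exfalso
    push Not at hz
    have hpos : ∀ q, s < q → 0 < x4 q := by
      intro q hq
      by_cases hqm : q < m
      · exact he q hq (by linarith)
      · exact hz q (by linarith)
    by_cases hn : ∃ p, s ≤ p ∧ x5 p < 0
    · obtain ⟨p, hp, hp5⟩ := hn
      obtain ⟨q, hq1, hq2, hq3⟩ := negpt C.h5 hp h5 hp5
      refine exp_unbdd (g := -x5) C.ha (ε := Real.exp (-a * p) * (-x5 p)) (s := p) (M := M)
        (mul_pos (Real.exp_pos _) (by linarith)) ?_ (by simpa using C.b5)
      intro t ht
      have P6 := h6 (t+1) (by linarith) (fun q hq _ => hpos q hq)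
      have := wanti C.h5 ht (fun y hy1 hy2 => P6 q y hq1.le (by linarith) (by linarith) hq3)
      simp only [Pi.neg_apply]
      linarith
    · push Not at hn
      refine exp_unbdd (g := x4) (r := b) (by linarith [C.ha, C.hab]) (ε := Real.exp (-b * m) * (x4 m)) (s := m)
        (M := M) (mul_pos (Real.exp_pos _) hx4m) ?_ C.b4
      intro t ht
      exact wmono C.h4 ht (fun y hy1 hy2 => hn y (by linarith))

/-- `x4 > 0` just after `s` if `x4 s ≥ 0`, `x5 > 0` just after `s`. -/
lemma pos_right {g h : ℝ → ℝ} {r s : ℝ} (hg : ∀ t, HasDerivAt g (h t + r * g t) t)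
    (h0 : 0 ≤ g s) (hh : ∃ e, s < e ∧ ∀ t, s < t → t < e → 0 < h t) :
    ∃ e, s < e ∧ ∀ t, s < t → t < e → 0 < g t := by
  obtain ⟨e, he, hp⟩ := hh
  refine ⟨e, he, fun t h1 h2 => ?_⟩
  by_contra hc
  push Not at hc
  have h3 : 0 ≤ g ((s+t)/2) := by
    by_contra hc'
    push Not at hc'
    obtain ⟨q, hq1, hq2, hq3⟩ := negpt hg (by linarith) h0 hc'
    linarith [hp q hq1 (by linarith)]
  rcases h3.lt_or_eq with h3 | h3
  · obtain ⟨q, hq1, hq2, hq3⟩ := negpt' hg (by linarith) h3 hc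
    linarith [hp q (by linarith) (by linarith)]
  · -- g vanishes at the midpoint: then it vanishes on the left with derivative h > 0
    have hz : ∀ y, s < y → y < (s+t)/2 → g y ≤ 0 := by
      intro y hy1 hy2
      by_contra hcy
      push Not at hcy
      obtain ⟨q, hq1, hq2, hq3⟩ := negpt' hg hy2.le hcy h3.symm.le
      linarith [hp q (by linarith) (by linarith)]
    have hz' : ∀ y, s < y → y < (s+t)/2 → g y = 0 := by
      intro y hy1 hy2
      apply le_antisymm (hz y hy1 hy2)
      by_contra hcy
      push Not at hcy
      obtain ⟨q, hq1, hq2, hq3⟩ := negpt hg hy1.le h0 hcy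
      linarith [hp q (by linarith) (by linarith)]
    have hy1 : s < s + (t - s)/4 := by linarith
    have hy2 : s + (t - s)/4 < (s+t)/2 := by linarith
    have hd := hg (s + (t-s)/4)
    have hd0 : HasDerivAt g 0 (s + (t-s)/4) := by
      apply (hasDerivAt_const _ (0:ℝ)).congr_of_eventuallyEq
      filter_upwards [Ioo_mem_nhds hy1 hy2] with y hy
      exact hz' y hy.1 hy.2
    have := hd.unique hd0
    rw [hz' _ hy1 hy2] at this
    linarith [hp (s + (t-s)/4) (by linarith) (by linarith)]

lemma pos_right_of_pos {g : ℝ → ℝ} {s : ℝ} (hg : ContinuousAt g s) (h : 0 < g s) :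
    ∃ e, s < e ∧ ∀ t, s < t → t < e → 0 < g t := by
  have := hg.eventually (lt_mem_nhds h)
  obtain ⟨δ, hδ, hd⟩ := Metric.eventually_nhds_iff.1 this
  refine ⟨s + δ, by linarith, fun t h1 h2 => hd ?_⟩
  rw [Real.dist_eq, abs_of_pos (by linarith)]
  linarith

lemma Chain.pm1 (C : Chain a b c M x1 x2 x3 x4 x5 x6 x7) {s t : ℝ} (h1 : x1 s ≤ 0) (h2 : x2 s ≤ 0)
    (h3 : x3 s ≤ 0) (h4 : ∀ q, s < q → q < t → 0 < x4 q) (h4s : 0 ≤ x4 s) (h4t : 0 ≤ x4 t) :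
    (∀ p q, s ≤ p → p ≤ q → q ≤ t → 0 < x3 p → 0 < x3 q) ∧
    (∀ p q, s ≤ p → p ≤ q → q ≤ t → 0 < x2 p → 0 < x2 q) ∧
    (∀ p q, s ≤ p → p ≤ q → q ≤ t → 0 < x1 p → 0 < x1 q) ∧ PM x7 s t := by
  have D := C.neg
  have P4 : PM (-x4) s t := by
    intro p q hp hpq hq _
    simp only [Pi.neg_apply]
    rcases eq_or_lt_of_le (hp.trans hpq) with h | h
    · rw [← h]; linarith
    · rcases eq_or_lt_of_le hq with h' | h'
      · rw [h']; linarith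
      · linarith [h4 q h h']
  have P3 := P4.step D.h3 (by simpa using h3)
  have P3' := fun p q hp hpq hq hgp => P4.step' D.h3 (by simpa using h3) (p := p) (q := q) hp hpq hq hgp
  have P2 := P3.step D.h2 (by simpa using h2)
  have P2' := fun p q hp hpq hq hgp => P3.step' D.h2 (by simpa using h2) (p := p) (q := q) hp hpq hq hgp
  have P1' := fun p q hp hpq hq hgp => P2.step' D.h1 (by simpa using h1) (p := p) (q := q) hp hpq hq hgp
  simp only [Pi.neg_apply, neg_lt_zero] at P3' P2' P1'
  refine ⟨P3', P2', P1', ?_⟩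
  intro p q hp hpq hq h7
  have : 0 < x1 p := by
    by_contra hc
    push Not at hc
    linarith [C.h7n p hc]
  exact C.h7p q (P1' p q hp hpq hq this).le

lemma Chain.stage (C : Chain a b c M x1 x2 x3 x4 x5 x6 x7) {s : ℝ}
    (S : CState x1 x2 x3 x4 x5 x6 s) :
    ∃ t, s < t ∧ CState (-x1) (-x2) (-x3) (-x4) (-x5) (-x6) t ∧
      Real.exp (a * (t - s)) * x5 s ≤ - x5 t := by
  have hPM6 : ∀ t, s < t → (∀ q, s < q → q < t → 0 < x4 q) → PM x6 s t := by
    intro t hst hpos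
    have h4t : 0 ≤ x4 t := by
      by_contra hc
      push Not at hc
      have hc4 : ContinuousAt x4 t := (C.h4 t).continuousAt
      have := hc4.eventually (gt_mem_nhds hc)
      obtain ⟨δ, hδ, hd⟩ := Metric.eventually_nhds_iff.1 this
      have h1 := hd (y := max (t - δ/2) ((s+t)/2)) (by
        rw [Real.dist_eq, abs_of_nonpos (by simp; constructor <;> linarith)]
        have := le_max_left (t - δ/2) ((s+t)/2)
        linarith)
      have h2 := hpos (max (t - δ/2) ((s+t)/2)) (lt_max_of_lt_right (by linarith))
        (max_lt (by linarith) (by linarith))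
      linarith
    exact (C.pm1 S.h1 S.h2 S.h3 hpos S.h4.ge h4t).2.2.2.step C.h6 S.h6
  obtain ⟨t, hst, hpos, h4t, h5t, h6t⟩ := C.core (s := s)
    (pos_right C.h4 S.h4.ge (pos_right_of_pos (C.h5 s).continuousAt S.h5)) S.h5.le hPM6
  have hp := C.pm1 S.h1 S.h2 S.h3 hpos S.h4.ge h4t.ge
  obtain ⟨p3, p2, p1, p7⟩ := hp
  have p6 := fun p q hp hpq hq hgp => p7.step' C.h6 S.h6 (p := p) (q := q) hp hpq hq hgp
  -- strict negativity of x6 at t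
  obtain ⟨q6, h61, h62, h63⟩ := negpt C.h5 hst.le S.h5.le h5t
  have h6t' : x6 t < 0 := p6 q6 t h61.le h62.le le_rfl h63
  obtain ⟨q7, h71, h72, h73⟩ := negpt C.h6 hst.le S.h6 h6t'
  have hx1q : 0 < x1 q7 := by
    by_contra hc
    push Not at hc
    linarith [C.h7n q7 hc]
  have hx1t : 0 < x1 t := p1 q7 t h71.le h72.le le_rfl hx1q
  have D := C.neg
  obtain ⟨q2, h21, h22, h23⟩ := negpt D.h1 hst.le (by simpa using S.h1) (by simpa using hx1t)
  have hx2t : 0 < x2 t := p2 q2 t h21.le h22.le le_rfl (by simpa using h23)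
  obtain ⟨q3, h31, h32, h33⟩ := negpt D.h2 hst.le (by simpa using S.h2) (by simpa using hx2t)
  have hx3t : 0 < x3 t := p3 q3 t h31.le h32.le le_rfl (by simpa using h33)
  refine ⟨t, hst, ⟨by simpa using hx1t.le, by simpa using hx2t.le, by simpa using hx3t.le,
    by simpa using h4t, by simpa using h5t, by simpa using h6t⟩, ?_⟩
  -- growth
  set Y := fun y => Real.exp (-a * y) * x5 y with hY
  set Y1 := fun y => Real.exp (-a * y) * x6 y with hY1
  have hexp : ∀ r y : ℝ, HasDerivAt (fun y => Real.exp (-r * y)) (Real.exp (-r * y) * (-r)) y := by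
    intro r y
    simpa using ((hasDerivAt_id y).const_mul (-r)).exp
  have hYd : ∀ y, HasDerivAt Y (Y1 y) y := by
    intro y
    exact ((hexp a y).mul (C.h5 y)).congr_deriv (by simp only [hY1]; ring)
  have hYs : 0 < Y s := mul_pos (Real.exp_pos _) S.h5
  have hYt : Y t < 0 := mul_neg_of_pos_of_neg (Real.exp_pos _) h5t
  suffices hgoal : Y s ≤ - Y t by
    simp only [hY] at hgoal
    have := mul_le_mul_of_nonneg_left hgoal (Real.exp_pos (a * t)).le
    have e1 : Real.exp (a * (t - s)) = Real.exp (a * t) * Real.exp (-a * s) := by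
      rw [← Real.exp_add]; ring_nf
    have e2 : Real.exp (a * t) * Real.exp (-a * t) = 1 := by
      rw [← Real.exp_add]; ring_nf; simp
    rw [e1]
    calc _ = Real.exp (a * t) * (Real.exp (-a * s) * x5 s) := by ring
      _ ≤ _ := this
      _ = -(Real.exp (a * t) * Real.exp (-a * t)) * x5 t := by ring
      _ = _ := by rw [e2]; ring
  by_contra hcon
  push Not at hcon
  set m := (Y t - Y s) / (t - s) with hm
  have hts : 0 < t - s := by linarith
  have hm0 : m < 0 := div_neg_of_neg_of_pos (by linarith) hts
  have hmt : m * (t - s) = Y t - Y s := by rw [hm]; field_simp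
  have hchord : ∀ p, s ≤ p → p ≤ t → Y s + m * (p - s) ≤ Y p := by
    intro p hp1 hp2
    by_contra hc
    push Not at hc
    have hsp : s < p := by
      rcases eq_or_lt_of_le hp1 with h | h
      · rw [← h] at hc; simp at hc
      · exact h
    have hpt : p < t := by
      rcases eq_or_lt_of_le hp2 with h | h
      · rw [h, hmt] at hc; linarith
      · exact h
    obtain ⟨ξ, hξ, hξe⟩ := exists_hasDerivAt_eq_slope Y Y1 hsp
      (fun x _ => (hYd x).continuousAt.continuousWithinAt) (fun x _ => hYd x)
    obtain ⟨ξ', hξ', hξe'⟩ := exists_hasDerivAt_eq_slope Y Y1 hpt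
      (fun x _ => (hYd x).continuousAt.continuousWithinAt) (fun x _ => hYd x)
    have hps : 0 < p - s := by linarith
    have htp : 0 < t - p := by linarith
    have a1 : Y1 ξ < m := by rw [hξe, div_lt_iff₀ hps]; linarith
    have a2 : m < Y1 ξ' := by rw [hξe', lt_div_iff₀ htp]; nlinarith
    have b1 : x6 ξ < 0 := by
      by_contra hc6
      push Not at hc6
      have := mul_nonneg (Real.exp_pos (-a * ξ)).le hc6
      simp only [hY1] at a1
      linarith
    obtain ⟨o, ho1, ho2, ho3⟩ := negpt C.h6 hξ.1.le S.h6 b1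
    have hξξ : ξ ≤ ξ' := by linarith [hξ.2, hξ'.1]
    have b2 := wanti C.h6 hξξ (fun y hy1 hy2 => p7 o y ho1.le (by linarith)
      (by linarith [hξ'.2]) ho3)
    have b3 : Y1 ξ' ≤ Y1 ξ := by
      have e1 : ∀ y, Y1 y = Real.exp ((c - a) * y) * (Real.exp (-c * y) * x6 y) := by
        intro y
        simp only [hY1]
        rw [← mul_assoc, ← Real.exp_add]; ring_nf
      rw [e1, e1]
      have e2 : Real.exp ((c - a) * ξ) ≤ Real.exp ((c - a) * ξ') := by
        apply Real.exp_le_exp.2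
        exact mul_le_mul_of_nonneg_left hξξ (by linarith [C.hac])
      have e3 : Real.exp (-c * ξ) * x6 ξ < 0 := mul_neg_of_pos_of_neg (Real.exp_pos _) b1
      have e4 : Real.exp (-c * ξ') * x6 ξ' < 0 := by linarith
      calc _ ≤ Real.exp ((c - a) * ξ') * (Real.exp (-c * ξ) * x6 ξ) :=
            mul_le_mul_of_nonneg_left b2 (Real.exp_pos _).le
        _ ≤ _ := mul_le_mul_of_nonpos_right e2 e3.le
    linarith
  -- the weighted integral
  set w := fun y => Real.exp (-(b - a) * y) with hw
  set ts := s - Y s / m with hts'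
  have hwanti : ∀ y z, y ≤ z → w z ≤ w y := by
    intro y z hyz
    apply Real.exp_le_exp.2
    nlinarith [C.hab]
  set Φ := fun y => Real.exp (-b * y) * x4 y - w ts * (Y s * (y - s) + m * (y - s)^2 / 2) with hΦ
  have hΦd : ∀ y, HasDerivAt Φ (w y * Y y - w ts * (Y s + m * (y - s))) y := by
    intro y
    have d1 := (hexp b y).mul (C.h4 y)
    have d2 : HasDerivAt (fun y => Y s * (y - s) + m * (y - s)^2 / 2) (Y s + m * (y - s)) y := by
      have e1 : HasDerivAt (fun y : ℝ => y - s) 1 y := (hasDerivAt_id y).sub_const s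
      exact ((e1.const_mul (Y s)).add (((e1.pow 2).const_mul m).div_const 2)).congr_deriv (by simp; ring)
    have : w y * Y y = Real.exp (-b * y) * x5 y := by
      simp only [hw, hY]
      rw [← mul_assoc, ← Real.exp_add]; ring_nf
    exact (d1.sub (d2.const_mul (w ts))).congr_deriv (by rw [this]; ring)
  have hΦm := monotoneOn_of_deriv_nonneg (D := Set.Icc s t) (convex_Icc s t) (f := Φ)
    (fun x _ => (hΦd x).continuousAt.continuousWithinAt)
    (fun x _ => (hΦd x).differentiableAt.differentiableWithinAt)
    (by
      intro y hy
      rw [interior_Icc] at hy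
      rw [(hΦd y).deriv]
      have c1 := hchord y hy.1.le hy.2.le
      have c2 : w y * (Y s + m * (y - s)) ≤ w y * Y y :=
        mul_le_mul_of_nonneg_left c1 (Real.exp_pos _).le
      have c3 : Y s + m * (y - s) = m * (y - ts) := by
        have hm0' := hm0.ne
        rw [hts']; field_simp; ring
      have c4 : 0 ≤ (w y - w ts) * (m * (y - ts)) := by
        rcases le_total y ts with h | h
        · exact mul_nonneg (by linarith [hwanti y ts h]) (mul_nonneg_of_nonpos_of_nonpos hm0.le (by linarith))
        · exact mul_nonneg_of_nonpos_of_nonpos (by linarith [hwanti ts y h])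
            (mul_nonpos_of_nonpos_of_nonneg hm0.le (by linarith))
      rw [c3] at c2 ⊢
      linarith)
  have := hΦm (Set.left_mem_Icc.2 hst.le) (Set.right_mem_Icc.2 hst.le) hst.le
  simp only [hΦ, S.h4, h4t, mul_zero, sub_self, zero_sub] at this
  have hw0 : 0 < w ts := Real.exp_pos _
  have e5 : Y s * (t - s) + m * (t - s)^2 / 2 = (t - s) * (Y s + Y t) / 2 := by
    have : m * (t - s)^2 = (Y t - Y s) * (t - s) := by rw [← hmt]; ring
    rw [this]; ring
  rw [e5] at this
  have e6 : 0 < w ts * ((t - s) * (Y s + Y t) / 2) :=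
    mul_pos hw0 (by have := mul_pos hts (show 0 < Y s + Y t by linarith); linarith)
  norm_num at this
  linarith

lemma Chain.no_state (C : Chain a b c M x1 x2 x3 x4 x5 x6 x7) {s : ℝ}
    (S : CState x1 x2 x3 x4 x5 x6 s) : False := by
  have c1 : Continuous x1 := continuous_iff_continuousAt.2 fun t => (C.h1 t).continuousAt
  have c2 : Continuous x2 := continuous_iff_continuousAt.2 fun t => (C.h2 t).continuousAt
  have c3 : Continuous x3 := continuous_iff_continuousAt.2 fun t => (C.h3 t).continuousAt
  have c4 : Continuous x4 := continuous_iff_continuousAt.2 fun t => (C.h4 t).continuousAt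
  have c5 : Continuous x5 := continuous_iff_continuousAt.2 fun t => (C.h5 t).continuousAt
  have c6 : Continuous x6 := continuous_iff_continuousAt.2 fun t => (C.h6 t).continuousAt
  have ha := C.ha
  set G := fun t => Real.exp (a * (t - s)) * x5 s with hG
  have cG : Continuous G := by fun_prop
  have hGpos : ∀ t, 0 < G t := fun t => mul_pos (Real.exp_pos _) S.h5
  set Q := ({t | s ≤ t} ∩ {t | G t ≤ x5 t} ∩ {t | x1 t ≤ 0} ∩ {t | x2 t ≤ 0} ∩ {t | x3 t ≤ 0} ∩
    {t | x4 t = 0} ∩ {t | 0 ≤ x6 t}) ∪ ({t | s ≤ t} ∩ {t | G t ≤ -x5 t} ∩ {t | 0 ≤ x1 t} ∩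
    {t | 0 ≤ x2 t} ∩ {t | 0 ≤ x3 t} ∩ {t | x4 t = 0} ∩ {t | x6 t ≤ 0}) with hQ
  have z : Continuous (fun _ : ℝ => (0:ℝ)) := continuous_const
  have hcl : IsClosed Q := by
    refine IsClosed.union ?_ ?_
    · exact ((((((isClosed_le continuous_const continuous_id).inter (isClosed_le cG c5)).inter
        (isClosed_le c1 z)).inter (isClosed_le c2 z)).inter (isClosed_le c3 z)).inter
        (isClosed_eq c4 z)).inter (isClosed_le z c6)
    · exact ((((((isClosed_le continuous_const continuous_id).inter (isClosed_le cG c5.neg)).inter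
        (isClosed_le z c1)).inter (isClosed_le z c2)).inter (isClosed_le z c3)).inter
        (isClosed_eq c4 z)).inter (isClosed_le c6 z)
  have hsQ : s ∈ Q := Or.inl ⟨⟨⟨⟨⟨⟨le_refl s, by simp [hG]⟩, S.h1⟩, S.h2⟩, S.h3⟩, S.h4⟩, S.h6⟩
  have hbd : BddAbove Q := by
    refine ⟨s + M / x5 s / a, fun t ht => ?_⟩
    have hh : G t ≤ M := by
      rcases ht with h | h
      · exact h.1.1.1.1.1.2.trans ((le_abs_self _).trans (C.b5 t))
      · exact h.1.1.1.1.1.2.trans ((neg_le_abs _).trans (C.b5 t))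
    have h1 := Real.add_one_le_exp (a * (t - s))
    have h2 : Real.exp (a * (t - s)) ≤ M / x5 s := by
      rw [le_div_iff₀ S.h5]; exact hh
    have : t - s ≤ M / x5 s / a := by
      rw [le_div_iff₀ ha]; nlinarith
    linarith
  have hmem : sSup Q ∈ Q := hcl.csSup_mem ⟨s, hsQ⟩ hbd
  set q := sSup Q with hq
  have hexp : ∀ t, Real.exp (a * (t - q)) * G q = G t := by
    intro t
    simp only [hG]
    rw [← mul_assoc, ← Real.exp_add]; ring_nf
  rcases hmem with h | h
  · obtain ⟨⟨⟨⟨⟨⟨h0, hg⟩, h1⟩, h2⟩, h3⟩, h4⟩, h6⟩ := h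
    obtain ⟨t, ht, S', hgr⟩ := C.stage (s := q) ⟨h1, h2, h3, h4, (hGpos q).trans_le hg, h6⟩
    have : t ∈ Q := by
      refine Or.inr ⟨⟨⟨⟨⟨⟨h0.trans ht.le, ?_⟩, by simpa using S'.h1⟩, by simpa using S'.h2⟩,
        by simpa using S'.h3⟩, by simpa using S'.h4⟩, by simpa using S'.h6⟩
      refine le_trans ?_ hgr
      rw [← hexp]
      exact mul_le_mul_of_nonneg_left hg (Real.exp_pos _).le
    exact absurd (le_csSup hbd this) (by rw [← hq]; linarith)
  · obtain ⟨⟨⟨⟨⟨⟨h0, hg⟩, h1⟩, h2⟩, h3⟩, h4⟩, h6⟩ := h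
    obtain ⟨t, ht, S', hgr⟩ := C.neg.stage (s := q) ⟨by simpa using h1, by simpa using h2,
      by simpa using h3, by simpa using h4, (hGpos q).trans_le hg, by simpa using h6⟩
    simp only [neg_neg, Pi.neg_apply] at S' hgr
    have : t ∈ Q := by
      refine Or.inl ⟨⟨⟨⟨⟨⟨h0.trans ht.le, ?_⟩, by simpa using S'.h1⟩, by simpa using S'.h2⟩,
        by simpa using S'.h3⟩, by simpa using S'.h4⟩, by simpa using S'.h6⟩
      refine le_trans ?_ hgr
      rw [← hexp]
      exact mul_le_mul_of_nonneg_left hg (Real.exp_pos _).le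
    exact absurd (le_csSup hbd this) (by rw [← hq]; linarith)

lemma Chain.no_start (C : Chain a b c M x1 x2 x3 x4 x5 x6 x7) {s : ℝ}
    (h1 : x1 s = 0) (h2 : x2 s = 0) (h3 : x3 s = 0) (h5 : 0 ≤ x5 s)
    (h4 : ∃ e, s < e ∧ ∀ t, s < t → t < e → 0 < x4 t) : False := by
  have nn : ∀ {g h : ℝ → ℝ} {r t : ℝ}, (∀ t, HasDerivAt g (h t + r * g t) t) → g s = 0 →
      s ≤ t → (∀ q, s < q → q < t → 0 ≤ h q) → 0 ≤ g t := by
    intro g h r t hg h0 hst hh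
    by_contra hc
    push Not at hc
    obtain ⟨q, hq1, hq2, hq3⟩ := negpt hg hst h0.ge hc
    linarith [hh q hq1 hq2]
  have key : ∀ t, s < t → (∀ q, s < q → q < t → 0 < x4 q) → ∀ q, s < q → q ≤ t →
      0 ≤ x1 q ∧ 0 ≤ x2 q ∧ 0 ≤ x3 q := by
    intro t hst hpos
    have k3 : ∀ q, s < q → q ≤ t → 0 ≤ x3 q := fun q hq1 hq2 =>
      nn C.h3 h3 hq1.le (fun y hy1 hy2 => (hpos y hy1 (by linarith)).le)
    have k2 : ∀ q, s < q → q ≤ t → 0 ≤ x2 q := fun q hq1 hq2 =>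
      nn C.h2 h2 hq1.le (fun y hy1 hy2 => k3 y hy1 (by linarith))
    have k1 : ∀ q, s < q → q ≤ t → 0 ≤ x1 q := fun q hq1 hq2 =>
      nn C.h1 h1 hq1.le (fun y hy1 hy2 => k2 y hy1 (by linarith))
    exact fun q hq1 hq2 => ⟨k1 q hq1 hq2, k2 q hq1 hq2, k3 q hq1 hq2⟩
  obtain ⟨t, hst, hpos, h4t, h5t, h6t⟩ := C.core (s := s) h4 h5 (by
    intro t hst hpos p q hp hpq hq hneg
    have := wanti C.h6 hpq (fun y hy1 hy2 =>
      C.h7p y (key t hst hpos y (by linarith) (by linarith)).1)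
    have h3 := mul_neg_of_pos_of_neg (Real.exp_pos (-c * p)) hneg
    by_contra hc
    push Not at hc
    have h4 := mul_pos (Real.exp_pos (-c * q)) hc
    linarith)
  obtain ⟨k1, k2, k3⟩ := key t hst hpos t hst le_rfl
  exact C.neg.no_state (s := t) ⟨by simpa using k1, by simpa using k2, by simpa using k3,
    by simpa using h4t, by simpa using h5t, by simpa using h6t⟩

/-- the final conclusion: vanishing initial data -/
lemma Chain.start_zero (C : Chain a b c M x1 x2 x3 x4 x5 x6 x7) {s : ℝ}
    (h1 : x1 s = 0) (h2 : x2 s = 0) (h3 : x3 s = 0) (h5 : x5 s = (a + c) * x4 s) :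
    x4 s = 0 ∧ x6 s = 0 := by
  have hac : 0 < a + c := by linarith [C.ha, C.hac]
  have aux : ∀ {x1 x2 x3 x4 x5 x6 x7 : ℝ → ℝ}, Chain a b c M x1 x2 x3 x4 x5 x6 x7 →
      x1 s = 0 → x2 s = 0 → x3 s = 0 → x5 s = (a + c) * x4 s → ¬ 0 < x4 s ∧
      (x4 s = 0 → ¬ 0 < x6 s) := by
    intro x1 x2 x3 x4 x5 x6 x7 C h1 h2 h3 h5
    constructor
    · intro h
      exact C.no_start h1 h2 h3 (by rw [h5]; positivity)
        (pos_right_of_pos (C.h4 s).continuousAt h)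
    · intro h h6
      refine C.no_start h1 h2 h3 (by rw [h5, h]; simp) ?_
      refine pos_right C.h4 h.ge (pos_right C.h5 (by rw [h5, h]; simp)
        (pos_right_of_pos (C.h6 s).continuousAt h6))
  obtain ⟨A1, A2⟩ := aux C h1 h2 h3 h5
  obtain ⟨B1, B2⟩ := aux C.neg (by simpa using h1) (by simpa using h2) (by simpa using h3)
    (by simp [h5])
  simp only [Pi.neg_apply, neg_eq_zero, Left.neg_pos_iff] at B1 B2
  have h4 : x4 s = 0 := le_antisymm (not_lt.1 A1) (not_lt.1 B1)
  exact ⟨h4, le_antisymm (not_lt.1 (A2 h4)) (not_lt.1 (B2 h4))⟩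

end

end

section
structure SolV (a b c m p M : ℝ) (V : ℕ → ℝ → ℝ) : Prop where
  ha : 0 < a
  hab : a < b
  hbc : b < c
  hm : 0 < m
  hp : 1 < p
  hd : ∀ k, k < 6 → ∀ t, HasDerivAt (V k) (V (k+1) t) t
  pos : ∀ t, 0 < V 0 t
  bdd : ∀ t, V 0 t ≤ M
  ode : ∀ t, V 6 t = (a^2+b^2+c^2) * V 4 t - (a^2*b^2+a^2*c^2+b^2*c^2) * V 2 t
    + a^2*b^2*c^2 * V 0 t - m * (V 0 t) ^ p

lemma SolV.cont {a b c m p M : ℝ} {V : ℕ → ℝ → ℝ} (S : SolV a b c m p M V) {k : ℕ} (hk : k < 6) :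
    Continuous (V k) :=
  continuous_iff_continuousAt.2 fun t => (S.hd k hk t).continuousAt

lemma SolV.cont6 {a b c m p M : ℝ} {V : ℕ → ℝ → ℝ} (S : SolV a b c m p M V) :
    Continuous (V 6) := by
  have h : V 6 = fun t => (a^2+b^2+c^2) * V 4 t - (a^2*b^2+a^2*c^2+b^2*c^2) * V 2 t
    + a^2*b^2*c^2 * V 0 t - m * (V 0 t) ^ p := funext S.ode
  rw [h]
  have h0 := S.cont (k := 0) (by norm_num)
  have h2 := S.cont (k := 2) (by norm_num)
  have h4 := S.cont (k := 4) (by norm_num)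
  have : Continuous fun t => (V 0 t) ^ p := h0.rpow_const (fun t => Or.inl (S.pos t).ne')
  fun_prop

/-- interpolation hypothesis -/
def Interp (A : ℕ → ℝ) : Prop := (∀ k, 0 ≤ A k) ∧ ∀ k, k < 5 → ∀ h : ℝ, 0 < h → h ≤ 1 →
  A (k+1) ≤ 2 / h * A k + h * A (k+2)

lemma interp1 (k : ℕ) (hk : k ≤ 5) : ∀ ε : ℝ, 0 < ε → ∃ C : ℝ, 0 ≤ C ∧ ∀ A : ℕ → ℝ, Interp A →
    A k ≤ C * A 0 + ε * A (k+1) := by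
  induction k with
  | zero =>
    intro ε hε
    exact ⟨1, by norm_num, fun A hA => by nlinarith [hA.1 0, hA.1 1]⟩
  | succ k ih =>
    intro ε hε
    set h := min (ε/2) 1 with hh
    have h0 : 0 < h := lt_min (by linarith) one_pos
    obtain ⟨C, hC, H⟩ := ih (by omega) (h/4) (by linarith)
    refine ⟨4 / h * C, by positivity, fun A hA => ?_⟩
    have e1 := hA.2 k (by omega) h h0 (min_le_right _ _)
    have e2 := H A hA
    have e3 : 2 / h * A k ≤ 2 / h * (C * A 0 + h/4 * A (k+1)) :=
      mul_le_mul_of_nonneg_left e2 (by positivity)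
    have e4 : 2 / h * (C * A 0 + h/4 * A (k+1)) = 2 / h * C * A 0 + A (k+1) / 2 := by
      field_simp; ring
    have e5 : h * A (k+2) ≤ ε/2 * A (k+2) :=
      mul_le_mul_of_nonneg_right (min_le_left _ _) (hA.1 _)
    have e6 : 4 / h * C * A 0 = 2 * (2 / h * C * A 0) := by ring
    show A (k+1) ≤ 4 / h * C * A 0 + ε * A (k+2)
    rw [e6]
    linarith

lemma interp2 (j : ℕ) (hj : j ≤ 5) : ∀ ε : ℝ, 0 < ε → ∃ C : ℝ, 0 ≤ C ∧ ∀ A : ℕ → ℝ, Interp A →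
    A (5 - j) ≤ C * A 0 + ε * A 6 := by
  induction j with
  | zero => exact interp1 5 le_rfl
  | succ j ih =>
    intro ε hε
    obtain ⟨C, hC, H⟩ := ih (by omega) ε hε
    obtain ⟨C', hC', H'⟩ := interp1 (5 - (j+1)) (by omega) 1 one_pos
    refine ⟨C' + C, by positivity, fun A hA => ?_⟩
    have e1 := H A hA
    have e2 := H' A hA
    rw [show 5 - (j+1) + 1 = 5 - j by omega] at e2
    linarith

lemma interp3 (D σ : ℝ) (hD : 0 ≤ D) (hσ : 0 ≤ σ) : ∃ B : ℝ, ∀ A : ℕ → ℝ, Interp A →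
    A 0 ≤ D → A 6 ≤ D + σ * (A 4 + A 2) → ∀ k, k ≤ 6 → A k ≤ B := by
  obtain ⟨C4, hC4, H4⟩ := interp2 1 (by norm_num) (1/(4*(σ+1))) (by positivity)
  obtain ⟨C2, hC2, H2⟩ := interp2 3 (by norm_num) (1/(4*(σ+1))) (by positivity)
  have hC : ∀ k : Fin 6, ∃ C : ℝ, 0 ≤ C ∧ ∀ A : ℕ → ℝ, Interp A → A k ≤ C * A 0 + 1 * A 6 := by
    intro k
    obtain ⟨C, hC, H⟩ := interp2 (5 - k) (by omega) 1 one_pos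
    rw [show 5 - (5 - (k:ℕ)) = k by omega] at H
    exact ⟨C, hC, H⟩
  choose C hC H using hC
  set B6 := 2 * (D + σ * (C4 * D + C2 * D)) with hB6
  have hB60 : 0 ≤ B6 := by positivity
  have hS0 : 0 ≤ ∑ k, C k * D := Finset.sum_nonneg fun k _ => mul_nonneg (hC k) hD
  refine ⟨B6 + ∑ k, C k * D, fun A hA h0 h6 k hk => ?_⟩
  have a4 := H4 A hA
  have a2 := H2 A hA
  norm_num at a4 a2
  have b4 : C4 * A 0 ≤ C4 * D := mul_le_mul_of_nonneg_left h0 hC4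
  have b2 : C2 * A 0 ≤ C2 * D := mul_le_mul_of_nonneg_left h0 hC2
  have a6 : A 6 ≤ B6 := by
    have e1 : σ * (A 4 + A 2) ≤ σ * (C4 * D + C2 * D + 2 * ((σ+1)⁻¹ * (1/4) * A 6)) :=
      mul_le_mul_of_nonneg_left (by linarith) hσ
    have e2 : σ * (2 * ((σ+1)⁻¹ * (1/4) * A 6)) ≤ A 6 / 2 := by
      have : σ * (σ+1)⁻¹ ≤ 1 := by
        rw [← div_eq_mul_inv, div_le_one (by linarith)]; linarith
      have := mul_le_mul_of_nonneg_right this (hA.1 6)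
      linarith
    have : σ * (C4 * D + C2 * D + 2 * ((σ+1)⁻¹ * (1/4) * A 6)) = σ * (C4 * D + C2 * D) +
      σ * (2 * ((σ+1)⁻¹ * (1/4) * A 6)) := by ring
    linarith
  rcases Nat.lt_or_ge k 6 with hk6 | hk6
  · have e1 := H ⟨k, hk6⟩ A hA
    have e2 : C ⟨k, hk6⟩ * D ≤ ∑ k, C k * D :=
      Finset.single_le_sum (f := fun k => C k * D) (fun k _ => mul_nonneg (hC k) hD) (Finset.mem_univ _)
    have e3 : C ⟨k, hk6⟩ * A 0 ≤ C ⟨k, hk6⟩ * D := mul_le_mul_of_nonneg_left h0 (hC _)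
    simp only at e1
    linarith
  · have : k = 6 := by omega
    subst this
    linarith

lemma SolV.bounds {a b c m p M : ℝ} {V : ℕ → ℝ → ℝ} (S : SolV a b c m p M V) :
    ∃ B : ℝ, ∀ k, k ≤ 6 → ∀ t, |V k t| ≤ B := by
  have hM : 0 < M := (S.pos 0).trans_le (S.bdd 0)
  have hc : ∀ k, k ≤ 6 → Continuous (V k) := by
    intro k hk
    rcases Nat.lt_or_ge k 6 with h | h
    · exact S.cont h
    · have : k = 6 := by omega
      rw [this]; exact S.cont6
  set σ := (a^2+b^2+c^2) + (a^2*b^2+a^2*c^2+b^2*c^2) with hσ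
  set D := M + a^2*b^2*c^2 * M + m * M ^ p with hD
  have hMp : 0 ≤ M ^ p := Real.rpow_nonneg hM.le _
  have hm := S.hm
  have hD0 : 0 ≤ D := by positivity
  obtain ⟨B, hB⟩ := interp3 D σ hD0 (by positivity)
  refine ⟨B, fun k hk t => ?_⟩
  set R := max |t| 1 with hR
  have hR1 : 1 ≤ R := le_max_right _ _
  set J := Set.Icc (-R) R with hJ
  have hJne : J.Nonempty := ⟨0, by constructor <;> linarith⟩
  set A : ℕ → ℝ := fun k => if k ≤ 6 then sSup ((fun t => |V k t|) '' J) else 0 with hA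
  have hbdd : ∀ k, k ≤ 6 → BddAbove ((fun t => |V k t|) '' J) := fun k hk =>
    (isCompact_Icc.image (hc k hk).abs).bddAbove
  have hle : ∀ k, k ≤ 6 → ∀ t ∈ J, |V k t| ≤ A k := by
    intro k hk t ht
    simp only [hA, if_pos hk]
    exact le_csSup (hbdd k hk) ⟨t, ht, rfl⟩
  have hub : ∀ k, k ≤ 6 → ∀ N, (∀ t ∈ J, |V k t| ≤ N) → A k ≤ N := by
    intro k hk N hN
    simp only [hA, if_pos hk]
    apply csSup_le (hJne.image _)
    rintro _ ⟨t, ht, rfl⟩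
    exact hN t ht
  have hAnn : ∀ k, 0 ≤ A k := by
    intro k
    by_cases hk : k ≤ 6
    · exact (abs_nonneg _).trans (hle k hk _ hJne.some_mem)
    · simp [hA, hk]
  have key : ∀ k, k < 5 → ∀ y z, y ∈ J → z ∈ J → y < z → ∀ q, y ≤ q → q ≤ z → z - y ≤ 1 →
      |V (k+1) q| ≤ 2 / (z - y) * A k + (z - y) * A (k+2) := by
    intro k hk y z hy hz hyz q hq1 hq2 _
    obtain ⟨ξ, hξ, hξe⟩ := exists_hasDerivAt_eq_slope (V k) (V (k+1)) hyz
      (hc k (by omega)).continuousOn (fun x _ => S.hd k (by omega) x)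
    have hzy : 0 < z - y := by linarith
    have e1 : |V (k+1) ξ| ≤ 2 / (z - y) * A k := by
      rw [hξe, abs_div, abs_of_pos hzy, div_le_iff₀ hzy]
      have : 2 / (z - y) * A k * (z - y) = 2 * A k := by field_simp
      rw [this]
      have := abs_sub (V k z) (V k y)
      linarith [hle k (by omega) y hy, hle k (by omega) z hz]
    have hq : q ∈ J := ⟨hy.1.trans hq1, hq2.trans hz.2⟩
    have hξJ : ξ ∈ J := ⟨hy.1.trans hξ.1.le, hξ.2.le.trans hz.2⟩
    have e2 : |V (k+1) q - V (k+1) ξ| ≤ A (k+2) * |q - ξ| := by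
      have := (convex_Icc (-R) R).norm_image_sub_le_of_norm_hasDerivWithin_le (f := V (k+1))
        (f' := V (k+2)) (C := A (k+2)) (fun x _ => (S.hd (k+1) (by omega) x).hasDerivWithinAt)
        (fun x hx => by rw [Real.norm_eq_abs]; exact hle (k+2) (by omega) x hx) hξJ hq
      simpa [Real.norm_eq_abs] using this
    have e3 : |q - ξ| ≤ z - y := by
      rw [abs_le]; constructor <;> linarith [hξ.1, hξ.2]
    have e4 := mul_le_mul_of_nonneg_left e3 (hAnn (k+2))
    have e5 : |V (k+1) q| ≤ |V (k+1) ξ| + |V (k+1) q - V (k+1) ξ| := by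
      have := abs_add_le (V (k+1) ξ) (V (k+1) q - V (k+1) ξ)
      simpa using this
    linarith
  have hInt0 : Interp A := by
    refine ⟨hAnn, fun k hk h h0 h1 => hub (k+1) (by omega) _ fun q hq => ?_⟩
    rcases le_total q 0 with hq0 | hq0
    · have := key k hk q (q+h) hq ⟨by linarith [hq.1], by linarith⟩ (by linarith) q le_rfl
        (by linarith) (by linarith)
      simpa using this
    · have := key k hk (q-h) q ⟨by linarith [hq.1], by linarith [hq.2]⟩ hq (by linarith) q (by linarith)
        le_rfl (by linarith)
      simpa using this
  have hV0 : ∀ t, |V 0 t| ≤ M := fun t => by rw [abs_of_pos (S.pos t)]; exact S.bdd t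
  have h6 : A 6 ≤ D + σ * (A 4 + A 2) := by
    refine hub 6 le_rfl _ fun t ht => ?_
    have e4 := hle 4 (by norm_num) t ht
    have e2 := hle 2 (by norm_num) t ht
    have e0 := hV0 t
    have ep : (V 0 t) ^ p ≤ M ^ p := Real.rpow_le_rpow (S.pos t).le (S.bdd t) (by linarith [S.hp])
    have ep0 : 0 ≤ (V 0 t) ^ p := Real.rpow_nonneg (S.pos t).le _
    rw [S.ode t]
    have f4 : |(a^2+b^2+c^2) * V 4 t| ≤ σ * A 4 := by
      rw [abs_mul, abs_of_nonneg (by positivity)]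
      exact mul_le_mul (by rw [hσ]; have : 0 ≤ (a^2*b^2+a^2*c^2+b^2*c^2) := by positivity
                           linarith) e4 (abs_nonneg _) (by positivity)
    have f2 : |(a^2*b^2+a^2*c^2+b^2*c^2) * V 2 t| ≤ σ * A 2 := by
      rw [abs_mul, abs_of_nonneg (by positivity)]
      exact mul_le_mul (by rw [hσ]; have : 0 ≤ (a^2+b^2+c^2) := by positivity
                           linarith) e2 (abs_nonneg _) (by positivity)
    have f0 : |a^2*b^2*c^2 * V 0 t| ≤ a^2*b^2*c^2 * M := by
      rw [abs_mul, abs_of_nonneg (by positivity)]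
      exact mul_le_mul_of_nonneg_left e0 (by positivity)
    have fp : |m * (V 0 t)^p| ≤ m * M ^ p := by
      rw [abs_of_nonneg (by positivity)]
      exact mul_le_mul_of_nonneg_left ep hm.le
    rw [abs_le] at *
    constructor <;> linarith
  have h0 : A 0 ≤ D := by
    refine hub 0 (by norm_num) _ fun t _ => (hV0 t).trans ?_
    have : 0 ≤ a^2*b^2*c^2 * M + m * M ^ p := by positivity
    linarith
  refine (hle k hk t ⟨?_, ?_⟩).trans (hB A hInt0 h0 h6 k hk)
  · have := neg_abs_le t; have := le_max_left |t| 1; linarith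
  · exact (le_abs_self t).trans (le_max_left _ _)

lemma rpow_lip {p M x y : ℝ} (hp : 1 < p) (hx : 0 < x) (hy : 0 < y) (hxM : x ≤ M) (hyM : y ≤ M) :
    |x ^ p - y ^ p| ≤ p * M ^ (p - 1) * |x - y| := by
  have := (convex_Ioc 0 M).norm_image_sub_le_of_norm_hasDerivWithin_le (f := fun z : ℝ => z ^ p)
        (f' := fun z => p * z ^ (p-1)) (C := p * M ^ (p-1))
        (fun z hz => (Real.hasDerivAt_rpow_const (Or.inr hp.le)).hasDerivWithinAt)
        (fun z hz => by
          have : 0 ≤ z ^ (p-1) := Real.rpow_nonneg hz.1.le _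
          rw [Real.norm_eq_abs, abs_of_nonneg (by positivity)]
          exact mul_le_mul_of_nonneg_left (Real.rpow_le_rpow hz.1.le hz.2 (by linarith)) (by linarith))
        (show y ∈ Set.Ioc 0 M from ⟨hy, hyM⟩) (show x ∈ Set.Ioc 0 M from ⟨hx, hxM⟩)
  simpa [Real.norm_eq_abs] using this

set_option maxHeartbeats 2000000 in
/-- critical points are symmetry centers -/
lemma SolV.symm {a b c m p M : ℝ} {V : ℕ → ℝ → ℝ} (S : SolV a b c m p M V) {T : ℝ}
    (hT : V 1 T = 0) : ∀ t, V 0 (T + t) = V 0 (T - t) := by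
  obtain ⟨B, hB⟩ := S.bounds
  have hB0 : 0 ≤ B := (abs_nonneg _).trans (hB 0 (by norm_num) 0)
  set Z : ℕ → ℝ → ℝ := fun k t => V k (T + t) - (-1)^k * V k (T - t) with hZ
  have hZd : ∀ k, k < 6 → ∀ t, HasDerivAt (Z k) (Z (k+1) t) t := by
    intro k hk t
    have e1 : HasDerivAt (fun t => V k (T + t)) (V (k+1) (T + t)) t :=
      HasDerivAt.comp_const_add T t (S.hd k hk (T + t))
    have e2 : HasDerivAt (fun t => V k (T - t)) (-(V (k+1) (T - t))) t :=
      HasDerivAt.comp_const_sub T t (S.hd k hk (T - t))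
    exact (e1.sub (e2.const_mul ((-1)^k))).congr_deriv (by simp only [hZ]; ring)
  have hZB : ∀ k, k ≤ 6 → ∀ t, |Z k t| ≤ 2 * B := by
    intro k hk t
    simp only [hZ]
    refine (abs_sub _ _).trans ?_
    rw [abs_mul, abs_pow, abs_neg, abs_one, one_pow, one_mul]
    linarith [hB k hk (T+t), hB k hk (T-t)]
  have hZ6 : ∀ t, Z 6 t = (a^2+b^2+c^2) * Z 4 t - (a^2*b^2+a^2*c^2+b^2*c^2) * Z 2 t
    + a^2*b^2*c^2 * Z 0 t - m * ((V 0 (T+t)) ^ p - (V 0 (T-t)) ^ p) := by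
    intro t
    simp only [hZ]
    rw [S.ode, S.ode]; ring
  have D0 := hZd 0 (by norm_num)
  have D1 := hZd 1 (by norm_num)
  have D2 := hZd 2 (by norm_num)
  have D3 := hZd 3 (by norm_num)
  have D4 := hZd 4 (by norm_num)
  have D5 := hZd 5 (by norm_num)
  norm_num at D0 D1 D2 D3 D4 D5
  have z0 : Z 0 0 = 0 := by simp [hZ]
  have z1 : Z 1 0 = 0 := by simp [hZ, hT]
  have z2 : Z 2 0 = 0 := by simp [hZ]
  have z4 : Z 4 0 = 0 := by simp [hZ]; ring
  have ha := S.ha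
  have hab := S.hab
  have hbc := S.hbc
  have hb0 : 0 < b := by linarith
  have hc0 : 0 < c := by linarith
  have C : Chain a b c ((1 + (a+b+c) + (a*b+a*c+b*c) + a*b*c) * (2*B)
      + (1 + (a+c) + (a*c + b^2) + b^2*(a+c) + a*b^2*c) * (2*B))
      (Z 0) (fun t => Z 1 t + a * Z 0 t) (fun t => Z 2 t + (a+b) * Z 1 t + a*b * Z 0 t)
      (fun t => Z 3 t + (a+b+c) * Z 2 t + (a*b+a*c+b*c) * Z 1 t + a*b*c * Z 0 t)
      (fun t => Z 4 t + (a+c) * Z 3 t + (a*c - b^2) * Z 2 t - b^2*(a+c) * Z 1 t - a*b^2*c * Z 0 t)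
      (fun t => Z 5 t + c * Z 4 t - (a^2+b^2) * Z 3 t - c*(a^2+b^2) * Z 2 t + a^2*b^2 * Z 1 t
        + a^2*b^2*c * Z 0 t)
      (fun t => - (m * ((V 0 (T+t)) ^ p - (V 0 (T-t)) ^ p))) := by
    refine ⟨ha, hab.le, by linarith, ?_, ?_, ?_, ?_, ?_, ?_, ?_, ?_, ?_, ?_⟩
    · intro t
      exact (D0 t).congr_deriv (by ring)
    · intro t
      exact ((D1 t).add ((D0 t).const_mul a)).congr_deriv (by ring)
    · intro t
      exact (((D2 t).add ((D1 t).const_mul (a+b))).add ((D0 t).const_mul (a*b))).congr_deriv (by ring)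
    · intro t
      exact ((((D3 t).add ((D2 t).const_mul (a+b+c))).add ((D1 t).const_mul (a*b+a*c+b*c))).add
        ((D0 t).const_mul (a*b*c))).congr_deriv (by ring)
    · intro t
      exact (((((D4 t).add ((D3 t).const_mul (a+c))).add ((D2 t).const_mul (a*c-b^2))).sub
        ((D1 t).const_mul (b^2*(a+c)))).sub ((D0 t).const_mul (a*b^2*c))).congr_deriv (by ring)
    · intro t
      exact ((((((D5 t).add ((D4 t).const_mul c)).sub ((D3 t).const_mul (a^2+b^2))).sub
        ((D2 t).const_mul (c*(a^2+b^2)))).add ((D1 t).const_mul (a^2*b^2))).add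
        ((D0 t).const_mul (a^2*b^2*c))).congr_deriv (by rw [hZ6]; ring)
    · intro t ht
      have : V 0 (T - t) ≤ V 0 (T + t) := by simpa [hZ] using ht
      have := Real.rpow_le_rpow (S.pos _).le this (by linarith [S.hp] : 0 ≤ p)
      have := mul_nonneg S.hm.le (sub_nonneg.2 this)
      linarith
    · intro t ht
      have : V 0 (T + t) ≤ V 0 (T - t) := by simpa [hZ] using ht
      have := Real.rpow_le_rpow (S.pos _).le this (by linarith [S.hp] : 0 ≤ p)
      have := mul_nonneg S.hm.le (sub_nonneg.2 this)
      linarith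
    · intro t
      have q : ∀ k, k ≤ 6 → ∀ r : ℝ, 0 ≤ r → |r * Z k t| ≤ r * (2*B) := by
        intro k hk r hr
        rw [abs_mul, abs_of_nonneg hr]
        exact mul_le_mul_of_nonneg_left (hZB k hk t) hr
      have q3 := hZB 3 (by norm_num) t
      have q2 := q 2 (by norm_num) (a+b+c) (by positivity)
      have q1 := q 1 (by norm_num) (a*b+a*c+b*c) (by positivity)
      have q0 := q 0 (by norm_num) (a*b*c) (by positivity)
      have : 0 ≤ (1 + (a+c) + (a*c + b^2) + b^2*(a+c) + a*b^2*c) * (2*B) := by positivity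
      rw [abs_le] at *
      constructor <;> linarith
    · intro t
      have q : ∀ k, k ≤ 6 → ∀ r : ℝ, 0 ≤ r → |r * Z k t| ≤ r * (2*B) := by
        intro k hk r hr
        rw [abs_mul, abs_of_nonneg hr]
        exact mul_le_mul_of_nonneg_left (hZB k hk t) hr
      have q4 := hZB 4 (by norm_num) t
      have q3 := q 3 (by norm_num) (a+c) (by positivity)
      have q2 := q 2 (by norm_num) (a*c) (by positivity)
      have q2' := q 2 (by norm_num) (b^2) (by positivity)
      have q1 := q 1 (by norm_num) (b^2*(a+c)) (by positivity)
      have q0 := q 0 (by norm_num) (a*b^2*c) (by positivity)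
      have : 0 ≤ (1 + (a+b+c) + (a*b+a*c+b*c) + a*b*c) * (2*B) := by positivity
      rw [abs_le] at *
      constructor <;> linarith
  obtain ⟨i4, i6⟩ := C.start_zero (s := 0) z0 (by simp [z0, z1]) (by simp [z0, z1, z2])
    (by simp only [z0, z1, z2, z4]; ring)
  have z3 : Z 3 0 = 0 := by simpa [z0, z1, z2] using i4
  have z5 : Z 5 0 = 0 := by simpa [z0, z1, z2, z3, z4] using i6
  -- uniqueness
  set N := fun t => (Z 0 t)^2 + (Z 1 t)^2 + (Z 2 t)^2 + (Z 3 t)^2 + (Z 4 t)^2 + (Z 5 t)^2 with hN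
  set N' := fun t => 2 * (Z 0 t * Z 1 t + Z 1 t * Z 2 t + Z 2 t * Z 3 t + Z 3 t * Z 4 t + Z 4 t * Z 5 t
    + Z 5 t * Z 6 t) with hN'
  have hNd : ∀ t, HasDerivAt N (N' t) t := by
    intro t
    exact (((((((D0 t).pow 2).add ((D1 t).pow 2)).add ((D2 t).pow 2)).add ((D3 t).pow 2)).add
      ((D4 t).pow 2)).add ((D5 t).pow 2)).congr_deriv (by simp [hN']; ring)
  set Lp := p * M ^ (p - 1) with hLp
  have hM : 0 < M := (S.pos 0).trans_le (S.bdd 0)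
  have hLp0 : 0 ≤ Lp := mul_nonneg (by linarith [S.hp]) (Real.rpow_nonneg hM.le _)
  set K := 10 + (a^2+b^2+c^2) + (a^2*b^2+a^2*c^2+b^2*c^2) + a^2*b^2*c^2 + m * Lp with hK
  have hm := S.hm
  have hNK : ∀ t, N' t ≤ K * N t := by
    intro t
    have am : ∀ r x y : ℝ, 0 ≤ r → 2 * (y * (r * x)) ≤ r * (x^2 + y^2) := by
      intro r x y hr; nlinarith [sq_nonneg (x - y)]
    have am' : ∀ r x y : ℝ, 0 ≤ r → -(2 * (y * (r * x))) ≤ r * (x^2 + y^2) := by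
      intro r x y hr; nlinarith [sq_nonneg (x + y)]
    have f4 := am (a^2+b^2+c^2) (Z 4 t) (Z 5 t) (by positivity)
    have f2 := am' (a^2*b^2+a^2*c^2+b^2*c^2) (Z 2 t) (Z 5 t) (by positivity)
    have f0 := am (a^2*b^2*c^2) (Z 0 t) (Z 5 t) (by positivity)
    have g := rpow_lip S.hp (S.pos (T+t)) (S.pos (T-t)) (S.bdd _) (S.bdd _)
    have z0t : V 0 (T+t) - V 0 (T-t) = Z 0 t := by simp [hZ]
    rw [z0t] at g
    have fp : -(2 * (Z 5 t * (m * ((V 0 (T+t)) ^ p - (V 0 (T-t)) ^ p)))) ≤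
        m * Lp * ((Z 0 t)^2 + (Z 5 t)^2) := by
      set W := (V 0 (T+t)) ^ p - (V 0 (T-t)) ^ p with hW
      have h1 : -(Z 5 t * W) ≤ |Z 5 t| * (Lp * |Z 0 t|) := by
        refine (neg_le_abs _).trans ?_
        rw [abs_mul]
        exact mul_le_mul_of_nonneg_left g (abs_nonneg _)
      have h2 := am Lp |Z 0 t| |Z 5 t| hLp0
      rw [sq_abs, sq_abs] at h2
      have h3 : -(2 * (Z 5 t * W)) ≤ Lp * ((Z 0 t)^2 + (Z 5 t)^2) := by linarith
      have := mul_le_mul_of_nonneg_left h3 hm.le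
      linarith
    have hZn : ∀ k, 0 ≤ (Z k t)^2 := fun k => sq_nonneg _
    have r1 : 0 ≤ (a^2+b^2+c^2) := by positivity
    have r2 : 0 ≤ (a^2*b^2+a^2*c^2+b^2*c^2) := by positivity
    have r3 : 0 ≤ a^2*b^2*c^2 := by positivity
    have r4 : 0 ≤ m * Lp := by positivity
    have e1 : (a^2+b^2+c^2) * ((Z 4 t)^2 + (Z 5 t)^2) ≤ (a^2+b^2+c^2) * N t :=
      mul_le_mul_of_nonneg_left (by simp only [hN]; linarith [hZn 0, hZn 1, hZn 2, hZn 3]) r1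
    have e2 : (a^2*b^2+a^2*c^2+b^2*c^2) * ((Z 2 t)^2 + (Z 5 t)^2) ≤ (a^2*b^2+a^2*c^2+b^2*c^2) * N t :=
      mul_le_mul_of_nonneg_left (by simp only [hN]; linarith [hZn 0, hZn 1, hZn 4, hZn 3]) r2
    have e3 : a^2*b^2*c^2 * ((Z 0 t)^2 + (Z 5 t)^2) ≤ a^2*b^2*c^2 * N t :=
      mul_le_mul_of_nonneg_left (by simp only [hN]; linarith [hZn 2, hZn 1, hZn 4, hZn 3]) r3
    have e4 : m * Lp * ((Z 0 t)^2 + (Z 5 t)^2) ≤ m * Lp * N t :=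
      mul_le_mul_of_nonneg_left (by simp only [hN]; linarith [hZn 2, hZn 1, hZn 4, hZn 3]) r4
    have e5 : 2 * (Z 0 t * Z 1 t + Z 1 t * Z 2 t + Z 2 t * Z 3 t + Z 3 t * Z 4 t + Z 4 t * Z 5 t) ≤
        10 * N t := by
      simp only [hN]
      have t0 := two_mul_le_add_sq (Z 0 t) (Z 1 t)
      have t1 := two_mul_le_add_sq (Z 1 t) (Z 2 t)
      have t2 := two_mul_le_add_sq (Z 2 t) (Z 3 t)
      have t3 := two_mul_le_add_sq (Z 3 t) (Z 4 t)
      have t4 := two_mul_le_add_sq (Z 4 t) (Z 5 t)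
      linarith [hZn 0, hZn 1, hZn 2, hZn 3, hZn 4, hZn 5]
    simp only [hN', hZ6 t]
    rw [hK]
    linarith
  have hpos : ∀ t, 0 ≤ t → Z 0 t = 0 := by
    intro t ht
    have := wanti (g := N) (h := fun t => N' t - K * N t) (r := K) (s := 0) (t := t)
      (fun t => (hNd t).congr_deriv (by ring)) ht (fun q _ _ => by have := hNK q; linarith)
    have n0 : N 0 = 0 := by simp [hN, z0, z1, z2, z3, z4, z5]
    rw [n0, mul_zero] at this
    have hNt : N t ≤ 0 := by
      by_contra hc
      push Not at hc
      have := mul_pos (Real.exp_pos (-K * t)) hc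
      linarith
    simp only [hN] at hNt
    have : (Z 0 t)^2 ≤ 0 := by
      linarith [sq_nonneg (Z 1 t), sq_nonneg (Z 2 t), sq_nonneg (Z 3 t), sq_nonneg (Z 4 t),
        sq_nonneg (Z 5 t)]
    nlinarith
  intro t
  rcases le_total 0 t with h | h
  · have := hpos t h
    simp [hZ] at this
    linarith
  · have := hpos (-t) (by linarith)
    simp [hZ] at this
    rw [← sub_eq_add_neg] at this
    linarith

end

section
open Filter Topology

lemma exp_unbdd' {g : ℝ → ℝ} {r M ε s : ℝ} (hr : 0 < r) (hε : 0 < ε)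
    (h : ∀ t, s ≤ t → ε ≤ Real.exp (-r * t) * g t) (hM : ∀ t, s ≤ t → |g t| ≤ M) : False := by
  have h1 : Filter.Tendsto (fun t => Real.exp (-r * t) * M) Filter.atTop (nhds (0 * M)) := by
    apply Filter.Tendsto.mul_const
    apply Real.tendsto_exp_atBot.comp
    exact Filter.tendsto_id.const_mul_atTop_of_neg (by linarith)
  rw [zero_mul] at h1
  have h2 := ((h1.eventually (gt_mem_nhds hε)).and (Filter.eventually_ge_atTop s)).exists
  obtain ⟨t, ht1, ht2⟩ := h2
  have h3 := h t ht2
  have h4 := mul_le_mul_of_nonneg_left ((le_abs_self _).trans (hM t ht2)) (Real.exp_pos (-r * t)).le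
  linarith

/-- `W' ≥ β W` on a half line, `W` bounded there: `W ≤ 0`. -/
lemma growth_nonpos {W H : ℝ → ℝ} {β M s : ℝ} (hβ : 0 < β)
    (hW : ∀ t, HasDerivAt W (H t + β * W t) t) (hH : ∀ t, s < t → 0 ≤ H t)
    (hM : ∀ t, s ≤ t → |W t| ≤ M) : ∀ t, s ≤ t → W t ≤ 0 := by
  intro t ht
  by_contra hc
  push Not at hc
  exact exp_unbdd' (g := W) (s := t) hβ (mul_pos (Real.exp_pos (-β * t)) hc)
    (fun q hq => wmono hW hq (fun y hy _ => hH y (by linarith))) (fun q hq => hM q (by linarith))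

lemma bdd_nonneg {d d1 d2 : ℝ → ℝ} {β M : ℝ} (hβ : 0 < β) (h0 : ∀ t, HasDerivAt d (d1 t) t)
    (h1 : ∀ t, HasDerivAt d1 (d2 t) t) (hd : ∀ t, d2 t ≤ β^2 * d t) (b0 : ∀ t, |d t| ≤ M)
    (b1 : ∀ t, |d1 t| ≤ M) : ∀ t, 0 ≤ d t := by
  have hW : ∀ t, 0 ≤ d1 t + β * d t := by
    intro t
    have := growth_nonpos (W := fun t => -(d1 t + β * d t)) (H := fun t => -(d2 t - β^2 * d t))
      (β := β) (M := M + β * M) (s := t) hβ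
      (fun t => ((h1 t).add ((h0 t).const_mul β)).neg.congr_deriv (by ring))
      (fun t _ => by linarith [hd t])
      (fun t _ => by
        rw [abs_neg]
        refine (abs_add_le _ _).trans ?_
        rw [abs_mul, abs_of_pos hβ]
        have := mul_le_mul_of_nonneg_left (b0 t) hβ.le
        linarith [b1 t]) t le_rfl
    linarith
  intro t
  by_contra hc
  push Not at hc
  refine exp_unbdd (g := fun s => - d (-s)) (s := -t) (M := M) hβ
    (mul_pos (Real.exp_pos (β * t)) (neg_pos.2 hc)) ?_ (fun s => by simpa using b0 (-s))
  intro s hs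
  have := wmono (g := d) (h := fun t => d1 t + β * d t) (r := -β) (s := -s) (t := t)
    (fun t => (h0 t).congr_deriv (by ring)) (by linarith) (fun q _ _ => hW q)
  have e1 : - -β * -s = -β * s := by ring
  have e2 : - -β * t = β * t := by ring
  rw [e1, e2] at this
  linarith

lemma SolV.decay {a b c m p M : ℝ} {V : ℕ → ℝ → ℝ} (S : SolV a b c m p M V)
    (h0 : Tendsto (V 0) atTop (𝓝 0)) : ∃ N t0 : ℝ, ∀ t, t0 ≤ t → Real.exp (a * t) * V 0 t ≤ N := by
  obtain ⟨B, hB⟩ := S.bounds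
  have hB0 : 0 ≤ B := (abs_nonneg _).trans (hB 0 (by norm_num) 0)
  have ha := S.ha
  have hab := S.hab
  have hbc := S.hbc
  have hb0 : 0 < b := by linarith
  have hc0 : 0 < c := by linarith
  have hm := S.hm
  have hp := S.hp
  have D0 := S.hd 0 (by norm_num)
  have D1 := S.hd 1 (by norm_num)
  have D2 := S.hd 2 (by norm_num)
  have D3 := S.hd 3 (by norm_num)
  have D4 := S.hd 4 (by norm_num)
  have D5 := S.hd 5 (by norm_num)
  norm_num at D0 D1 D2 D3 D4 D5
  set E := fun t => V 4 t - (b^2+c^2) * V 2 t + b^2*c^2 * V 0 t with hE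
  set E1 := fun t => V 5 t - (b^2+c^2) * V 3 t + b^2*c^2 * V 1 t with hE1
  set f := fun t => m * (V 0 t)^p with hf
  have hEd : ∀ t, HasDerivAt E (E1 t) t := fun t =>
    (((D4 t).sub ((D2 t).const_mul (b^2+c^2))).add ((D0 t).const_mul (b^2*c^2))).congr_deriv rfl
  have hE1d : ∀ t, HasDerivAt E1 (a^2 * E t - f t) t := fun t =>
    (((D5 t).sub ((D3 t).const_mul (b^2+c^2))).add ((D1 t).const_mul (b^2*c^2))).congr_deriv
      (by simp only [hE, hf]; rw [S.ode t]; ring)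
  have hf0 : ∀ t, 0 ≤ f t := fun t => mul_nonneg hm.le (Real.rpow_nonneg (S.pos t).le _)
  have q : ∀ k, k ≤ 6 → ∀ t, ∀ r : ℝ, 0 ≤ r → |r * V k t| ≤ r * B := by
    intro k hk t r hr
    rw [abs_mul, abs_of_nonneg hr]
    exact mul_le_mul_of_nonneg_left (hB k hk t) hr
  set BE := (1 + (b^2+c^2) + b^2*c^2) * B with hBE
  have bE : ∀ t, |E t| ≤ BE := by
    intro t
    have q3 := hB 4 (by norm_num) t
    have q2 := q 2 (by norm_num) t (b^2+c^2) (by positivity)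
    have q1 := q 0 (by norm_num) t (b^2*c^2) (by positivity)
    simp only [hE]
    rw [abs_le] at *
    constructor <;> linarith
  have bE1 : ∀ t, |E1 t| ≤ BE := by
    intro t
    have q3 := hB 5 (by norm_num) t
    have q2 := q 3 (by norm_num) t (b^2+c^2) (by positivity)
    have q1 := q 1 (by norm_num) t (b^2*c^2) (by positivity)
    simp only [hE1]
    rw [abs_le] at *
    constructor <;> linarith
  have hBE0 : 0 ≤ BE := (abs_nonneg _).trans (bE 0)
  have E0 : ∀ t, 0 ≤ E t := bdd_nonneg (β := a) ha hEd hE1d (fun t => by linarith [hf0 t]) bE bE1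
  have hba : 0 < b^2 - a^2 := by nlinarith
  have hca : 0 < c^2 - a^2 := by nlinarith
  set C1 := 1/(b^2-a^2) with hC1
  have hC1p : 0 < C1 := by positivity
  have hC1e : C1 * b^2 = C1 * a^2 + 1 := by rw [hC1]; field_simp; ring
  set C2 := C1/(c^2-a^2) with hC2
  have hC2p : 0 < C2 := by positivity
  have hC2e : C2 * c^2 = C2 * a^2 + C1 := by rw [hC2]; field_simp; ring
  have bnd : ∀ (k r : ℝ) (x y z : ℝ), 0 ≤ k → 0 ≤ r → |x| ≤ BE → |y| ≤ B → |z| ≤ B →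
      |k * x - (r * y - z)| ≤ k * BE + (r * B + B) := by
    intro k r x y z hk hr hx hy hz
    refine (abs_sub _ _).trans ?_
    refine add_le_add ?_ ((abs_sub _ _).trans (add_le_add ?_ hz))
    · rw [abs_mul, abs_of_nonneg hk]; exact mul_le_mul_of_nonneg_left hx hk
    · rw [abs_mul, abs_of_nonneg hr]; exact mul_le_mul_of_nonneg_left hy hr
  have hw2 : ∀ t, 0 ≤ C1 * E t - (c^2 * V 0 t - V 2 t) := by
    refine bdd_nonneg (d := fun t => C1 * E t - (c^2 * V 0 t - V 2 t))
      (d1 := fun t => C1 * E1 t - (c^2 * V 1 t - V 3 t))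
      (d2 := fun t => C1 * (a^2 * E t - f t) - (c^2 * V 2 t - V 4 t)) (β := b)
      (M := C1 * BE + (c^2 * B + B)) hb0 ?_ ?_ ?_ ?_ ?_
    · exact fun t => ((hEd t).const_mul C1).sub (((D0 t).const_mul (c^2)).sub (D2 t))
    · exact fun t => ((hE1d t).const_mul C1).sub (((D1 t).const_mul (c^2)).sub (D3 t))
    · intro t
      have := mul_nonneg hC1p.le (hf0 t)
      have e : b^2 * (C1 * E t - (c^2 * V 0 t - V 2 t)) = (C1 * b^2) * E t - (b^2*c^2 * V 0 t - b^2*V 2 t) := by ring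
      rw [e, hC1e]
      have : E t = V 4 t - (b^2+c^2) * V 2 t + b^2*c^2 * V 0 t := rfl
      nlinarith
    · exact fun t => bnd _ _ _ _ _ hC1p.le (by positivity) (bE t) (hB 0 (by norm_num) t) (hB 2 (by norm_num) t)
    · exact fun t => bnd _ _ _ _ _ hC1p.le (by positivity) (bE1 t) (hB 1 (by norm_num) t) (hB 3 (by norm_num) t)
  have hv : ∀ t, V 0 t ≤ C2 * E t := by
    have := bdd_nonneg (d := fun t => C2 * E t - V 0 t)
      (d1 := fun t => C2 * E1 t - V 1 t)
      (d2 := fun t => C2 * (a^2 * E t - f t) - V 2 t) (β := c)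
      (M := C2 * BE + B) hc0 ?_ ?_ ?_ ?_ ?_
    · intro t; linarith [this t]
    · exact fun t => ((hEd t).const_mul C2).sub (D0 t)
    · exact fun t => ((hE1d t).const_mul C2).sub (D1 t)
    · intro t
      have e1 := mul_nonneg hC2p.le (hf0 t)
      have e : c^2 * (C2 * E t - V 0 t) = (C2 * c^2) * E t - c^2 * V 0 t := by ring
      rw [e, hC2e]
      linarith [hw2 t]
    · intro t
      have := bnd C2 0 _ 0 _ hC2p.le le_rfl (bE t) (by simpa using hB0) (hB 0 (by norm_num) t)
      refine (abs_sub _ _).trans (add_le_add ?_ (hB 0 (by norm_num) t))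
      rw [abs_mul, abs_of_nonneg hC2p.le]; exact mul_le_mul_of_nonneg_left (bE t) hC2p.le
    · intro t
      refine (abs_sub _ _).trans (add_le_add ?_ (hB 1 (by norm_num) t))
      rw [abs_mul, abs_of_nonneg hC2p.le]; exact mul_le_mul_of_nonneg_left (bE1 t) hC2p.le
  -- choose κ
  set κ := a * (1 + p) / (2 * p) with hκ
  have hκ0 : 0 < κ := by positivity
  have hpκ : p * κ = a * (1 + p) / 2 := by rw [hκ]; field_simp
  have hκa : κ < a := by rw [hκ, div_lt_iff₀ (by positivity)]; nlinarith
  have hpκa : a < p * κ := by rw [hpκ]; nlinarith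
  have hak : 0 < a^2 - κ^2 := by nlinarith
  -- eventually f small
  have hev : ∀ᶠ t in atTop, m * (V 0 t)^(p-1) * C2 < a^2 - κ^2 := by
    have h1 : Tendsto (fun t => m * (V 0 t)^(p-1) * C2) atTop (𝓝 (m * (0:ℝ)^(p-1) * C2)) :=
      ((h0.rpow_const (Or.inr (by linarith))).const_mul m).mul_const C2
    rw [Real.zero_rpow (by linarith), mul_zero, zero_mul] at h1
    exact h1.eventually (gt_mem_nhds hak)
  obtain ⟨t1, ht1⟩ := eventually_atTop.1 hev
  have hfE : ∀ t, t1 ≤ t → f t ≤ (a^2 - κ^2) * E t := by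
    intro t ht
    have e1 : (V 0 t)^p = (V 0 t)^(p-1) * V 0 t := by
      rw [← Real.rpow_add_one (S.pos t).ne']; ring_nf
    have e2 : 0 ≤ m * (V 0 t)^(p-1) := mul_nonneg hm.le (Real.rpow_nonneg (S.pos t).le _)
    calc f t = m * (V 0 t)^(p-1) * V 0 t := by simp only [hf]; rw [e1]; ring
      _ ≤ m * (V 0 t)^(p-1) * (C2 * E t) := mul_le_mul_of_nonneg_left (hv t) e2
      _ = m * (V 0 t)^(p-1) * C2 * E t := by ring
      _ ≤ _ := mul_le_mul_of_nonneg_right (ht1 t ht).le (E0 t)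
  have hWb : ∀ r, 0 ≤ r → ∀ t, |E1 t + r * E t| ≤ BE + r * BE := by
    intro r hr t
    refine (abs_add_le _ _).trans (add_le_add (bE1 t) ?_)
    rw [abs_mul, abs_of_nonneg hr]; exact mul_le_mul_of_nonneg_left (bE t) hr
  have hW : ∀ t, t1 ≤ t → E1 t + κ * E t ≤ 0 :=
    growth_nonpos (W := fun t => E1 t + κ * E t) (H := fun t => (a^2 - κ^2) * E t - f t) (β := κ)
      (M := BE + κ * BE) hκ0
      (fun t => ((hE1d t).add ((hEd t).const_mul κ)).congr_deriv (by ring))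
      (fun t ht => by linarith [hfE t ht.le]) (fun t _ => hWb κ hκ0.le t)
  -- exponential decay of E
  set C3 := Real.exp (κ * t1) * E t1 with hC3
  have hC30 : 0 ≤ C3 := mul_nonneg (Real.exp_pos _).le (E0 _)
  have hEdec : ∀ t, t1 ≤ t → Real.exp (κ * t) * E t ≤ C3 := by
    intro t ht
    have := wanti (g := E) (h := fun t => E1 t + κ * E t) (r := -κ)
      (fun t => (hEd t).congr_deriv (by ring)) ht (fun q hq _ => hW q hq.le)
    simpa using this
  have hfdec : ∀ t, t1 ≤ t → f t ≤ m * (C2 * C3)^p * Real.exp (-(p*κ) * t) := by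
    intro t ht
    have e1 : V 0 t ≤ C2 * C3 * Real.exp (-κ * t) := by
      have h1 := hEdec t ht
      have h2 : E t ≤ C3 * Real.exp (-κ * t) := by
        have := mul_le_mul_of_nonneg_right h1 (Real.exp_pos (-κ * t)).le
        have e : Real.exp (κ * t) * Real.exp (-κ * t) = 1 := by rw [← Real.exp_add]; simp
        calc E t = Real.exp (κ * t) * Real.exp (-κ * t) * E t := by rw [e]; ring
          _ = Real.exp (κ * t) * E t * Real.exp (-κ * t) := by ring
          _ ≤ _ := this
      calc _ ≤ C2 * E t := hv t
        _ ≤ C2 * (C3 * Real.exp (-κ * t)) := mul_le_mul_of_nonneg_left h2 hC2p.le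
        _ = _ := by ring
    have e2 := Real.rpow_le_rpow (S.pos t).le e1 (by linarith : 0 ≤ p)
    rw [Real.mul_rpow (by positivity) (Real.exp_pos _).le, ← Real.exp_mul] at e2
    have e3 := mul_le_mul_of_nonneg_left e2 hm.le
    have : -κ * t * p = -(p*κ) * t := by ring
    rw [this] at e3
    simp only [hf]
    linarith
  set C4 := m * (C2 * C3)^p / (a + p*κ) with hC4
  have hpk0 : 0 < p * κ := by positivity
  have hC40 : 0 ≤ C4 := by positivity
  have hC4e : (a + p*κ) * C4 = m * (C2 * C3)^p := by rw [hC4]; field_simp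
  have hexpd : ∀ r t : ℝ, HasDerivAt (fun y => Real.exp (r * y)) (Real.exp (r * t) * r) t := by
    intro r t
    simpa using ((hasDerivAt_id t).const_mul r).exp
  have hX : ∀ t, t1 ≤ t → E1 t + a * E t - C4 * Real.exp (-(p*κ) * t) ≤ 0 :=
    growth_nonpos (W := fun t => E1 t + a * E t - C4 * Real.exp (-(p*κ) * t))
      (H := fun t => (a + p*κ) * C4 * Real.exp (-(p*κ) * t) - f t) (β := a)
      (M := BE + a * BE + C4 * Real.exp (-(p*κ) * t1)) ha
      (fun t => (((hE1d t).add ((hEd t).const_mul a)).sub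
        ((hexpd (-(p*κ)) t).const_mul C4)).congr_deriv (by ring))
      (fun t ht => by rw [hC4e]; linarith [hfdec t ht.le])
      (fun t ht => by
        refine (abs_sub _ _).trans (add_le_add (hWb a ha.le t) ?_)
        rw [abs_of_nonneg (by positivity)]
        refine mul_le_mul_of_nonneg_left (Real.exp_le_exp.2 ?_) hC40
        nlinarith)
  set Y := fun t => Real.exp (a * t) * E t + C4 / (p*κ - a) * Real.exp ((a - p*κ) * t) with hY
  have hpka : 0 < p * κ - a := by linarith
  have hYd : ∀ t, HasDerivAt Y (Real.exp (a * t) * (E1 t + a * E t - C4 * Real.exp (-(p*κ) * t))) t := by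
    intro t
    refine (((hexpd a t).mul (hEd t)).add ((hexpd (a - p*κ) t).const_mul (C4/(p*κ-a)))).congr_deriv ?_
    have : Real.exp ((a - p*κ) * t) = Real.exp (a * t) * Real.exp (-(p*κ) * t) := by
      rw [← Real.exp_add]; ring_nf
    rw [this]
    field_simp
    ring
  have hYa : AntitoneOn Y (Set.Ici t1) :=
    antitoneOn_of_deriv_nonpos (convex_Ici t1)
      (fun x _ => (hYd x).continuousAt.continuousWithinAt)
      (fun x _ => (hYd x).differentiableAt.differentiableWithinAt)
      (by
        intro x hx
        rw [interior_Ici] at hx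
        rw [(hYd x).deriv]
        exact mul_nonpos_of_nonneg_of_nonpos (Real.exp_pos _).le (hX x (le_of_lt hx)))
  refine ⟨C2 * Y t1, t1, fun t ht => ?_⟩
  have e1 := hYa (Set.self_mem_Ici) (Set.mem_Ici.2 ht) ht
  have e2 : Real.exp (a * t) * E t ≤ Y t := by
    have : 0 ≤ C4 / (p*κ - a) * Real.exp ((a - p*κ) * t) := by positivity
    simp only [hY]; linarith
  calc _ ≤ Real.exp (a * t) * (C2 * E t) := mul_le_mul_of_nonneg_left (hv t) (Real.exp_pos _).le
    _ = C2 * (Real.exp (a * t) * E t) := by ring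
    _ ≤ _ := mul_le_mul_of_nonneg_left (e2.trans e1) hC2p.le

lemma barbalat {g g1 g2 : ℝ → ℝ} {B l : ℝ} (h0 : ∀ t, HasDerivAt g (g1 t) t)
    (h1 : ∀ t, HasDerivAt g1 (g2 t) t) (hB : ∀ t, |g2 t| ≤ B) (hl : Tendsto g atTop (𝓝 l)) :
    Tendsto g1 atTop (𝓝 0) := by
  have hB0 : 0 ≤ B := (abs_nonneg _).trans (hB 0)
  rw [Metric.tendsto_atTop]
  intro ε hε
  set h := ε / (2 * (B + 1)) with hh
  have hh0 : 0 < h := by positivity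
  obtain ⟨N, hN⟩ := Metric.tendsto_atTop.1 hl (ε * h / 4) (by positivity)
  refine ⟨N, fun t ht => ?_⟩
  obtain ⟨ξ, hξ, hξe⟩ := exists_hasDerivAt_eq_slope g g1 (show t < t + h by linarith)
    (fun x _ => (h0 x).continuousAt.continuousWithinAt) (fun x _ => h0 x)
  have e1 := hN t ht
  have e2 := hN (t+h) (by linarith)
  rw [Real.dist_eq] at e1 e2
  have e3 : |g1 ξ| < ε / 2 := by
    rw [hξe, abs_div, show t + h - t = h by ring, abs_of_pos hh0, div_lt_iff₀ hh0]
    rw [abs_lt] at *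
    constructor <;> linarith
  have e4 : |g1 t - g1 ξ| ≤ B * |t - ξ| := by
    have := (convex_univ).norm_image_sub_le_of_norm_hasDerivWithin_le (f := g1)
      (f' := g2) (C := B) (fun x _ => (h1 x).hasDerivWithinAt)
      (fun x hx => by rw [Real.norm_eq_abs]; exact hB x) (Set.mem_univ ξ) (Set.mem_univ t)
    simpa [Real.norm_eq_abs] using this
  have e5 : |t - ξ| ≤ h := by rw [abs_le]; constructor <;> linarith [hξ.1, hξ.2]
  have e6 : B * h ≤ ε / 2 := by
    have : (B + 1) * h = ε / 2 := by rw [hh]; field_simp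
    nlinarith
  have e7 := mul_le_mul_of_nonneg_left e5 hB0
  rw [Real.dist_eq, sub_zero]
  have e8 : |g1 t| ≤ |g1 ξ| + |g1 t - g1 ξ| := by
    have := abs_add_le (g1 ξ) (g1 t - g1 ξ)
    simpa using this
  linarith

lemma lim_deriv_zero {g g1 : ℝ → ℝ} {l L : ℝ} (h0 : ∀ t, HasDerivAt g (g1 t) t)
    (hl : Tendsto g atTop (𝓝 l)) (hL : Tendsto g1 atTop (𝓝 L)) : L = 0 := by
  by_contra hne
  have hpos : 0 < |L| := abs_pos.2 hne
  obtain ⟨N, hN⟩ := Metric.tendsto_atTop.1 hl (|L|/8) (by positivity)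
  obtain ⟨N', hN'⟩ := Metric.tendsto_atTop.1 hL (|L|/8) (by positivity)
  set t := max N N'
  obtain ⟨ξ, hξ, hξe⟩ := exists_hasDerivAt_eq_slope g g1 (show t < t + 1 by linarith)
    (fun x _ => (h0 x).continuousAt.continuousWithinAt) (fun x _ => h0 x)
  have e1 := hN t (le_max_left _ _)
  have e2 := hN (t+1) (by have := le_max_left N N'; linarith)
  have e3 := hN' ξ (by have := le_max_right N N'; linarith [hξ.1])
  rw [Real.dist_eq] at e1 e2 e3
  rw [hξe, show t + 1 - t = 1 by ring, div_one] at e3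
  have e4 : |L| ≤ |g (t+1) - g t - L| + |g (t+1) - l| + |g t - l| := by
    have : L = -(g (t+1) - g t - L) + (g (t+1) - l) + -(g t - l) := by ring
    calc |L| = |-(g (t+1) - g t - L) + (g (t+1) - l) + -(g t - l)| := by rw [← this]
      _ ≤ _ := by
        refine (abs_add_le _ _).trans (add_le_add ((abs_add_le _ _).trans ?_) ?_)
        · rw [abs_neg]
        · rw [abs_neg]
  linarith

lemma SolV.limit {a b c m p M : ℝ} {V : ℕ → ℝ → ℝ} (S : SolV a b c m p M V) {l : ℝ}
    (hl : Tendsto (V 0) atTop (𝓝 l)) : (∀ k, 1 ≤ k → k ≤ 5 → Tendsto (V k) atTop (𝓝 0)) ∧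
    a^2*b^2*c^2 * l = m * l ^ p := by
  obtain ⟨B, hB⟩ := S.bounds
  have h1 := barbalat (S.hd 0 (by norm_num)) (S.hd 1 (by norm_num)) (hB 2 (by norm_num)) hl
  have h2 := barbalat (S.hd 1 (by norm_num)) (S.hd 2 (by norm_num)) (hB 3 (by norm_num)) h1
  have h3 := barbalat (S.hd 2 (by norm_num)) (S.hd 3 (by norm_num)) (hB 4 (by norm_num)) h2
  have h4 := barbalat (S.hd 3 (by norm_num)) (S.hd 4 (by norm_num)) (hB 5 (by norm_num)) h3
  have h5 := barbalat (S.hd 4 (by norm_num)) (S.hd 5 (by norm_num)) (hB 6 (by norm_num)) h4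
  norm_num at h1 h2 h3 h4 h5
  refine ⟨fun k hk1 hk2 => ?_, ?_⟩
  · interval_cases k <;> assumption
  · have hl0 : Tendsto (fun t => (V 0 t)^p) atTop (𝓝 (l^p)) :=
      hl.rpow_const (Or.inr (by linarith [S.hp]))
    have h6 : Tendsto (V 6) atTop (𝓝 ((a^2+b^2+c^2) * 0 - (a^2*b^2+a^2*c^2+b^2*c^2) * 0
        + a^2*b^2*c^2 * l - m * l ^ p)) := by
      rw [show V 6 = _ from funext S.ode]
      exact (((h4.const_mul _).sub (h2.const_mul _)).add (hl.const_mul _)).sub (hl0.const_mul _)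
    have := lim_deriv_zero (S.hd 5 (by norm_num)) h5 h6
    linarith

lemma SolV.reflect {a b c m p M : ℝ} {V : ℕ → ℝ → ℝ} (S : SolV a b c m p M V) :
    SolV a b c m p M (fun k t => (-1)^k * V k (-t)) where
  ha := S.ha
  hab := S.hab
  hbc := S.hbc
  hm := S.hm
  hp := S.hp
  hd k hk t := by
    have e2 : HasDerivAt (fun t => V k (-t)) (-(V (k+1) (-t))) t := by
      have := HasDerivAt.comp_const_sub 0 t (S.hd k hk (0 - t))
      simpa using this
    exact (e2.const_mul ((-1)^k)).congr_deriv (by ring)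
  pos t := by simpa using S.pos (-t)
  bdd t := by simpa using S.bdd (-t)
  ode t := by
    have := S.ode (-t)
    norm_num
    linarith

lemma SolV.exists_limit {a b c m p M : ℝ} {V : ℕ → ℝ → ℝ} (S : SolV a b c m p M V) {T : ℝ}
    (hT : (∀ t, T < t → 0 < V 1 t) ∨ (∀ t, T < t → V 1 t < 0)) :
    ∃ l, 0 ≤ l ∧ Tendsto (V 0) atTop (𝓝 l) ∧
      ((∀ t, T < t → V 0 t < l) ∨ (∀ t, T < t → l < V 0 t)) := by
  have D := S.hd 0 (by norm_num)
  rcases hT with h | h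
  · have hm : StrictMonoOn (V 0) (Set.Ici T) :=
      strictMonoOn_of_deriv_pos (convex_Ici T) (S.cont (by norm_num)).continuousOn
        (fun x hx => by rw [interior_Ici] at hx; rw [(D x).deriv]; exact h x hx)
    have hm' : Monotone (fun t => V 0 (max t T)) := fun x y hxy =>
      hm.monotoneOn (Set.mem_Ici.2 (le_max_right x T)) (Set.mem_Ici.2 (le_max_right y T)) (max_le_max_right T hxy)
    have hb : BddAbove (Set.range (fun t => V 0 (max t T))) := ⟨M, by rintro _ ⟨t, rfl⟩; exact S.bdd _⟩
    have hl := tendsto_atTop_ciSup hm' hb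
    set l := ⨆ t, V 0 (max t T)
    refine ⟨l, ?_, ?_, Or.inl ?_⟩
    · exact ge_of_tendsto' hl (fun t => (S.pos _).le)
    · refine hl.congr' ?_
      filter_upwards [eventually_ge_atTop T] with t ht
      rw [max_eq_left ht]
    · intro t ht
      have e1 := le_ciSup hb (t+1)
      rw [max_eq_left (by linarith)] at e1
      exact (hm ht.le (show T ≤ t + 1 by linarith) (by linarith)).trans_le e1
  · have hm : StrictAntiOn (V 0) (Set.Ici T) :=
      strictAntiOn_of_deriv_neg (convex_Ici T) (S.cont (by norm_num)).continuousOn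
        (fun x hx => by rw [interior_Ici] at hx; rw [(D x).deriv]; exact h x hx)
    have hm' : Antitone (fun t => V 0 (max t T)) := fun x y hxy =>
      hm.antitoneOn (Set.mem_Ici.2 (le_max_right x T)) (Set.mem_Ici.2 (le_max_right y T)) (max_le_max_right T hxy)
    have hb : BddBelow (Set.range (fun t => V 0 (max t T))) := ⟨0, by rintro _ ⟨t, rfl⟩; exact (S.pos _).le⟩
    have hl := tendsto_atTop_ciInf hm' hb
    set l := ⨅ t, V 0 (max t T)
    refine ⟨l, ?_, ?_, Or.inr ?_⟩
    · exact ge_of_tendsto' hl (fun t => (S.pos _).le)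
    · refine hl.congr' ?_
      filter_upwards [eventually_ge_atTop T] with t ht
      rw [max_eq_left ht]
    · intro t ht
      have e1 := ciInf_le hb (t+1)
      rw [max_eq_left (by linarith)] at e1
      exact e1.trans_lt (hm ht.le (show T ≤ t + 1 by linarith) (by linarith))

lemma sign_force {p m K l x : ℝ} (hp : 1 < p) (hm : 0 < m) (hl : 0 < l) (hK : K * l = m * l^p)
    (hx : 0 < x) : (x < l → 0 < K * x - m * x^p) ∧ (l < x → K * x - m * x^p < 0) := by
  have e : ∀ y : ℝ, 0 < y → y^p = y^(p-1) * y := fun y hy => by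
    rw [← Real.rpow_add_one hy.ne']; ring_nf
  have hK' : K = m * l^(p-1) := by
    rw [e l hl] at hK
    have : (K - m * l^(p-1)) * l = 0 := by linarith
    rcases mul_eq_zero.1 this with h | h
    · linarith
    · exact absurd h hl.ne'
  rw [hK', e x hx]
  constructor
  · intro h
    have := Real.rpow_lt_rpow hx.le h (by linarith : 0 < p - 1)
    have := mul_pos (mul_pos hm (sub_pos.2 this)) hx
    linarith
  · intro h
    have := Real.rpow_lt_rpow hl.le h (by linarith : 0 < p - 1)
    have := mul_pos (mul_pos hm (sub_pos.2 this)) hx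
    linarith

lemma const_sign {g : ℝ → ℝ} {s : Set ℝ} (hs : IsPreconnected s) (hg : Continuous g)
    (h : ∀ t ∈ s, g t ≠ 0) : (∀ t ∈ s, 0 < g t) ∨ (∀ t ∈ s, g t < 0) := by
  by_contra hc
  push Not at hc
  obtain ⟨⟨x, hx, hx0⟩, ⟨y, hy, hy0⟩⟩ := hc
  obtain ⟨z, hz, hz0⟩ := hs.intermediate_value hx hy hg.continuousOn ⟨hx0, hy0⟩
  exact h z hz hz0

lemma SolV.periodic {a b c m p M : ℝ} {V : ℕ → ℝ → ℝ} (S : SolV a b c m p M V)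
    (hunb : ∀ N t0 : ℝ, ∃ t, t0 ≤ t ∧ N < Real.exp (a * t) * V 0 t) :
    ∃ P : ℝ, 0 < P ∧ ∀ t, V 0 (t + P) = V 0 t := by
  by_cases hcrit : ∃ T1 T2, T1 < T2 ∧ V 1 T1 = 0 ∧ V 1 T2 = 0
  · obtain ⟨T1, T2, h12, h1, h2⟩ := hcrit
    refine ⟨2 * (T2 - T1), by linarith, fun t => ?_⟩
    have e1 := S.symm h1 (t - T1)
    have e2 := S.symm h2 (t + T2 - 2 * T1)
    rw [show T1 + (t - T1) = t by ring] at e1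
    rw [show t + 2 * (T2 - T1) = T2 + (t + T2 - 2 * T1) by ring, e2, e1]
    congr 1; ring
  · exfalso
    push Not at hcrit
    have c1 : Continuous (V 1) := S.cont (by norm_num)
    set K := a^2*b^2*c^2 with hK
    set G := fun t => V 5 t - (a^2+b^2+c^2) * V 3 t + (a^2*b^2+a^2*c^2+b^2*c^2) * V 1 t with hG
    have hGd : ∀ t, HasDerivAt G (K * V 0 t - m * (V 0 t)^p) t := fun t =>
      (((S.hd 5 (by norm_num) t).sub ((S.hd 3 (by norm_num) t).const_mul (a^2+b^2+c^2))).add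
        ((S.hd 1 (by norm_num) t).const_mul (a^2*b^2+a^2*c^2+b^2*c^2))).congr_deriv (by
          norm_num; rw [S.ode t]; ring)
    have hGc : Continuous G := continuous_iff_continuousAt.2 fun t => (hGd t).continuousAt
    -- the main step
    have main : ∀ T, ((∀ t, T < t → 0 < V 1 t) ∨ (∀ t, T < t → V 1 t < 0)) →
        Tendsto G atTop (𝓝 0) ∧ (StrictMonoOn G (Set.Ici T) ∨ StrictAntiOn G (Set.Ici T)) := by
      intro T hT
      obtain ⟨l, hl0, hl, hs⟩ := S.exists_limit hT
      obtain ⟨hk, hl'⟩ := S.limit hl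
      have hlpos : 0 < l := by
        rcases hl0.lt_or_eq with h | h
        · exact h
        · exfalso
          rw [← h] at hl
          obtain ⟨N, t0, hN⟩ := S.decay hl
          obtain ⟨t, ht, hNt⟩ := hunb N t0
          linarith [hN t ht]
      refine ⟨?_, ?_⟩
      · have := (((hk 5 (by norm_num) (by norm_num)).sub ((hk 3 (by norm_num) (by norm_num)).const_mul
          (a^2+b^2+c^2))).add ((hk 1 (by norm_num) (by norm_num)).const_mul (a^2*b^2+a^2*c^2+b^2*c^2)))
        simpa using this
      · rcases hs with hs | hs
        · left
          refine strictMonoOn_of_deriv_pos (convex_Ici T) hGc.continuousOn (fun x hx => ?_)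
          rw [interior_Ici] at hx
          rw [(hGd x).deriv]
          exact (sign_force S.hp S.hm hlpos hl' (S.pos x)).1 (hs x hx)
        · right
          refine strictAntiOn_of_deriv_neg (convex_Ici T) hGc.continuousOn (fun x hx => ?_)
          rw [interior_Ici] at hx
          rw [(hGd x).deriv]
          exact (sign_force S.hp S.hm hlpos hl' (S.pos x)).2 (hs x hx)
    by_cases h1 : ∃ T, V 1 T = 0
    · obtain ⟨T, hT⟩ := h1
      have hne : ∀ t ∈ Set.Ioi T, V 1 t ≠ 0 := fun t ht h => hcrit T t ht hT h
      obtain ⟨hlim, hmon⟩ := main T (const_sign isPreconnected_Ioi c1 hne)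
      -- odd derivatives vanish at T
      have hsym := S.symm hT
      have hodd : ∀ k, k ≤ 5 → ∀ t, V k (T + t) = (-1)^k * V k (T - t) := by
        intro k
        induction k with
        | zero => intro _ t; simpa using hsym t
        | succ k ih =>
          intro hk t
          have e1 : HasDerivAt (fun t => V k (T + t)) (V (k+1) (T + t)) t :=
            HasDerivAt.comp_const_add T t (S.hd k (by omega) (T + t))
          have e2 : HasDerivAt (fun t => V k (T - t)) (-(V (k+1) (T - t))) t :=
            HasDerivAt.comp_const_sub T t (S.hd k (by omega) (T - t))
          have e3 : (fun t => V k (T + t)) = fun t => (-1)^k * V k (T - t) :=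
            funext (ih (by omega))
          rw [e3] at e1
          rw [e1.unique (e2.const_mul ((-1)^k))]
          ring
      have o : ∀ k, k ≤ 5 → Odd k → V k T = 0 := by
        intro k hk ho
        have := hodd k hk 0
        rw [ho.neg_one_pow] at this
        simp at this
        linarith
      have hGT : G T = 0 := by
        simp only [hG]
        rw [o 5 (by norm_num) (by decide), o 3 (by norm_num) (by decide), o 1 (by norm_num) (by decide)]
        ring
      rcases hmon with hmon | hmon
      · have h2 : 0 < G (T+1) := by
          rw [← hGT]; exact hmon Set.self_mem_Ici (show T ≤ T+1 by linarith) (by linarith)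
        have : G (T+1) ≤ 0 := ge_of_tendsto hlim (by
          filter_upwards [eventually_ge_atTop (T+1)] with t ht
          exact hmon.monotoneOn (show T ≤ T+1 by linarith) (show T ≤ t by linarith) ht)
        linarith
      · have h2 : G (T+1) < 0 := by
          rw [← hGT]; exact hmon Set.self_mem_Ici (show T ≤ T+1 by linarith) (by linarith)
        have : 0 ≤ G (T+1) := le_of_tendsto hlim (by
          filter_upwards [eventually_ge_atTop (T+1)] with t ht
          exact hmon.antitoneOn (show T ≤ T+1 by linarith) (show T ≤ t by linarith) ht)
        linarith
    · push Not at h1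
      have hsg := const_sign (g := V 1) isPreconnected_univ c1 (fun t _ => h1 t)
      have hmon : ∀ T, Tendsto G atTop (𝓝 0) ∧ (StrictMonoOn G (Set.Ici T) ∨ StrictAntiOn G (Set.Ici T)) :=
        fun T => main T (hsg.imp (fun h t _ => h t trivial) (fun h t _ => h t trivial))
      -- limit at -∞
      have R := S.reflect
      obtain ⟨l, hl0, hl, -⟩ := R.exists_limit (T := 0) (hsg.symm.imp
        (fun h t _ => by have := h (-t) trivial; simp; linarith)
        (fun h t _ => by have := h (-t) trivial; simp; linarith))
      obtain ⟨hk, -⟩ := R.limit hl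
      have hbot : Tendsto (fun t => G (-t)) atTop (𝓝 0) := by
        have := (((hk 5 (by norm_num) (by norm_num)).neg.sub ((hk 3 (by norm_num) (by norm_num)).neg.const_mul
          (a^2+b^2+c^2))).add ((hk 1 (by norm_num) (by norm_num)).neg.const_mul (a^2*b^2+a^2*c^2+b^2*c^2)))
        norm_num at this
        simpa [hG] using this
      have hup : Tendsto G atTop (𝓝 0) := (hmon 0).1
      -- strictness
      have key : ∀ H : ℝ → ℝ, (∀ T, StrictMonoOn H (Set.Ici T)) → Tendsto H atTop (𝓝 0) →
          Tendsto (fun t => H (-t)) atTop (𝓝 0) → False := by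
        intro H hH hu hd
        have hS : StrictMono H := fun x y hxy => hH x Set.self_mem_Ici (Set.mem_Ici.2 hxy.le) hxy
        have a1 : H 1 ≤ 0 := ge_of_tendsto hu (by
          filter_upwards [eventually_ge_atTop 1] with t ht using hS.monotone ht)
        have a2 : 0 ≤ H 0 := le_of_tendsto hd (by
          filter_upwards [eventually_ge_atTop 0] with t ht using hS.monotone (by linarith))
        linarith [hS (zero_lt_one)]
      have mono_or : (∀ T, StrictMonoOn G (Set.Ici T)) ∨ (∀ T, StrictAntiOn G (Set.Ici T)) := by
        by_contra hc
        push Not at hc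
        obtain ⟨⟨T1, hT1⟩, T2, hT2⟩ := hc
        have k1 := (hmon T1).2.resolve_left hT1
        have k2 := (hmon T2).2.resolve_right hT2
        have h1 := le_max_left T1 T2
        have h2 := le_max_right T1 T2
        have b1 := k1 (a := max T1 T2) (b := max T1 T2 + 1) h1 (show T1 ≤ _ by linarith) (by linarith)
        have b2 := k2 (a := max T1 T2) (b := max T1 T2 + 1) h2 (show T2 ≤ _ by linarith) (by linarith)
        linarith
      rcases mono_or with h | h
      · exact key G h hup hbot
      · refine key (fun t => - G t) (fun T => ?_) (by simpa using hup.neg) (by simpa using hbot.neg)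
        exact fun x hx y hy hxy => neg_lt_neg (h T hx hy hxy)

end

section
open Filter Topology

lemma lap_congr {n : ℕ} {u w : EuclideanSpace ℝ (Fin n) → ℝ} {x : EuclideanSpace ℝ (Fin n)}
    (h : u =ᶠ[𝓝 x] w) : lap u x = lap w x := by
  unfold lap
  refine Finset.sum_congr rfl fun i _ => ?_
  have : (fun y => fderiv ℝ u y (EuclideanSpace.single i 1)) =ᶠ[𝓝 x]
      (fun y => fderiv ℝ w y (EuclideanSpace.single i 1)) := by
    filter_upwards [h.eventuallyEq_nhds] with y hy
    rw [hy.fderiv_eq]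
  rw [this.fderiv_eq]

lemma lap_congr' {n : ℕ} {u w : EuclideanSpace ℝ (Fin n) → ℝ} {x : EuclideanSpace ℝ (Fin n)}
    (h : u =ᶠ[𝓝 x] w) : lap u =ᶠ[𝓝 x] lap w := by
  filter_upwards [h.eventuallyEq_nhds] with y hy
  exact lap_congr hy

lemma hasFDerivAt_sqdist {n : ℕ} (x0 y : EuclideanSpace ℝ (Fin n)) :
    HasFDerivAt (fun y => ‖y - x0‖^2) (2 • innerSL ℝ (y - x0)) y := by
  have h1 : HasFDerivAt (fun y : EuclideanSpace ℝ (Fin n) => y - x0)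
    (ContinuousLinearMap.id ℝ _) y := (hasFDerivAt_id y).sub_const x0
  simpa using h1.norm_sq

lemma lap_rad {n : ℕ} {H H1 : ℝ → ℝ} {h2 : ℝ} {x0 x : EuclideanSpace ℝ (Fin n)}
    (d1 : ∀ᶠ s in 𝓝 (‖x - x0‖^2), HasDerivAt H (H1 s) s) (d2 : HasDerivAt H1 h2 (‖x - x0‖^2)) :
    lap (fun y => H (‖y - x0‖^2)) x = 4 * ‖x - x0‖^2 * h2 + 2 * n * H1 (‖x - x0‖^2) := by
  have hc : Continuous (fun y : EuclideanSpace ℝ (Fin n) => ‖y - x0‖^2) := by fun_prop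
  have e1 : ∀ i : Fin n, (fun y => fderiv ℝ (fun y => H (‖y - x0‖^2)) y (EuclideanSpace.single i 1))
      =ᶠ[𝓝 x] fun y => H1 (‖y - x0‖^2) * (2 * (y i - x0 i)) := by
    intro i
    filter_upwards [hc.continuousAt.eventually d1] with y hy
    have := (hy.comp_hasFDerivAt y (hasFDerivAt_sqdist x0 y)).fderiv
    rw [show (fun y => H (‖y - x0‖^2)) = (H ∘ fun y => ‖y - x0‖^2) from rfl, this]
    simp [EuclideanSpace.inner_single_right]
  unfold lap
  have e2 : ∀ i : Fin n, fderiv ℝ (fun y => fderiv ℝ (fun y => H (‖y - x0‖^2)) y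
      (EuclideanSpace.single i 1)) x (EuclideanSpace.single i 1) =
      4 * h2 * (x i - x0 i)^2 + 2 * H1 (‖x - x0‖^2) := by
    intro i
    rw [(e1 i).fderiv_eq]
    have f1 := d2.comp_hasFDerivAt x (hasFDerivAt_sqdist x0 x)
    have f2 : HasFDerivAt (fun y : EuclideanSpace ℝ (Fin n) => 2 * (y i - x0 i))
        ((2:ℝ) • (EuclideanSpace.proj i : EuclideanSpace ℝ (Fin n) →L[ℝ] ℝ)) x := by
      have : HasFDerivAt (fun y : EuclideanSpace ℝ (Fin n) => y i)
        (EuclideanSpace.proj i : EuclideanSpace ℝ (Fin n) →L[ℝ] ℝ) x :=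
        (EuclideanSpace.proj i : EuclideanSpace ℝ (Fin n) →L[ℝ] ℝ).hasFDerivAt
      exact (this.sub_const (x0 i)).const_mul 2
    have f3 := (f1.mul f2).fderiv
    rw [show (fun y : EuclideanSpace ℝ (Fin n) => H1 (‖y - x0‖^2) * (2 * (y i - x0 i))) =
      ((H1 ∘ fun y => ‖y - x0‖^2) * fun y => 2 * (y i - x0 i)) from rfl, f3]
    simp [EuclideanSpace.inner_single_right]
    ring
  rw [Finset.sum_congr rfl fun i _ => e2 i, Finset.sum_add_distrib, ← Finset.mul_sum]
  have e3 : ∑ i, (x i - x0 i)^2 = ‖x - x0‖^2 := by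
    rw [EuclideanSpace.norm_sq_eq]; simp
  rw [e3]
  simp
  ring

lemma lap_log {n : ℕ} {G G1 G2 : ℝ → ℝ} (h1 : ∀ t, HasDerivAt G (G1 t) t)
    (h2 : ∀ t, HasDerivAt G1 (G2 t) t) {x : EuclideanSpace ℝ (Fin n)} (hx : x ≠ 0) :
    lap (fun y => G (-Real.log ‖y‖)) x =
      Real.exp (2 * (-Real.log ‖x‖)) * (G2 (-Real.log ‖x‖) + (2 - n) * G1 (-Real.log ‖x‖)) := by
  have hn : 0 < ‖x‖ := norm_pos_iff.2 hx
  have hlog : ∀ y : EuclideanSpace ℝ (Fin n), -Real.log ‖y‖ = -(1/2) * Real.log (‖y - 0‖^2) := by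
    intro y; rw [sub_zero, Real.log_pow]; push_cast; ring
  have hT : ∀ s : ℝ, 0 < s → HasDerivAt (fun s => -(1/2) * Real.log s) (-(1/2) * s⁻¹) s :=
    fun s hs => (Real.hasDerivAt_log hs.ne').const_mul _
  have hpos : 0 < ‖x - 0‖^2 := by rw [sub_zero]; positivity
  have := lap_rad (n := n) (x0 := 0) (x := x) (H := fun s => G (-(1/2) * Real.log s))
    (H1 := fun s => G1 (-(1/2) * Real.log s) * (-(1/2) * s⁻¹))
    (by
      filter_upwards [lt_mem_nhds hpos] with s hs
      exact (h1 _).comp s (hT s hs))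
    (((h2 _).comp _ (hT _ hpos)).mul ((hasDerivAt_inv hpos.ne').const_mul (-(1/2))))
  have e : (fun y : EuclideanSpace ℝ (Fin n) => G (-Real.log ‖y‖)) =
      fun y => G (-(1/2) * Real.log (‖y - 0‖^2)) := by
    funext y; rw [hlog]
  rw [e, this]
  have e2 : Real.exp (2 * (-Real.log ‖x‖)) = (‖x‖^2)⁻¹ := by
    rw [show 2 * (-Real.log ‖x‖) = -(2 * Real.log ‖x‖) by ring, Real.exp_neg]
    congr 1
    rw [show (2:ℝ) * Real.log ‖x‖ = ((2:ℕ):ℝ) * Real.log ‖x‖ by norm_num, ← Real.log_pow,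
      Real.exp_log (by positivity)]
  rw [e2, hlog x]
  simp only [sub_zero, Function.comp]
  field_simp
  ring

lemma lap_log_exp {n : ℕ} {F F1 F2 : ℝ → ℝ} (α : ℝ) (h1 : ∀ t, HasDerivAt F (F1 t) t)
    (h2 : ∀ t, HasDerivAt F1 (F2 t) t) {x : EuclideanSpace ℝ (Fin n)} (hx : x ≠ 0) :
    lap (fun y => Real.exp (α * (-Real.log ‖y‖)) * F (-Real.log ‖y‖)) x =
      Real.exp ((α + 2) * (-Real.log ‖x‖)) * (F2 (-Real.log ‖x‖)
        + (2 * α + 2 - n) * F1 (-Real.log ‖x‖) + α * (α + 2 - n) * F (-Real.log ‖x‖)) := by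
  have hexpd : ∀ r t : ℝ, HasDerivAt (fun y => Real.exp (r * y)) (Real.exp (r * t) * r) t := by
    intro r t
    simpa using ((hasDerivAt_id t).const_mul r).exp
  have d1 : ∀ t, HasDerivAt (fun t => Real.exp (α * t) * F t)
      (Real.exp (α * t) * (F1 t + α * F t)) t := fun t =>
    ((hexpd α t).mul (h1 t)).congr_deriv (by ring)
  have d2 : ∀ t, HasDerivAt (fun t => Real.exp (α * t) * (F1 t + α * F t))
      (Real.exp (α * t) * (F2 t + 2 * α * F1 t + α^2 * F t)) t := fun t =>
    ((hexpd α t).mul ((h2 t).add ((h1 t).const_mul α))).congr_deriv (by simp; ring)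
  rw [lap_log d1 d2 hx]
  have : Real.exp ((α + 2) * (-Real.log ‖x‖)) =
      Real.exp (2 * (-Real.log ‖x‖)) * Real.exp (α * (-Real.log ‖x‖)) := by
    rw [← Real.exp_add]; ring_nf
  rw [this]; ring

/-- Emden-Fowler ODE for radial functions -/
lemma lap3_radial {n : ℕ} {u : EuclideanSpace ℝ (Fin n) → ℝ} {V : ℕ → ℝ → ℝ} {a : ℝ}
    (ha : a = ((n:ℝ)-6)/2)
    (hd : ∀ k, k < 6 → ∀ t, HasDerivAt (V k) (V (k+1) t) t)
    (hu : ∀ x, x ≠ 0 → u x = Real.exp (a * (-Real.log ‖x‖)) * V 0 (-Real.log ‖x‖)) :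
    ∀ x, x ≠ 0 → lap (lap (lap u)) x = Real.exp ((a + 6) * (-Real.log ‖x‖)) *
      (V 6 (-Real.log ‖x‖) - K4 n * V 4 (-Real.log ‖x‖) + K2 n * V 2 (-Real.log ‖x‖)
        - K0 n * V 0 (-Real.log ‖x‖)) := by
  have D0 := hd 0 (by norm_num)
  have D1 := hd 1 (by norm_num)
  have D2 := hd 2 (by norm_num)
  have D3 := hd 3 (by norm_num)
  have D4 := hd 4 (by norm_num)
  have D5 := hd 5 (by norm_num)
  norm_num at D0 D1 D2 D3 D4 D5
  have ev : ∀ {f g : EuclideanSpace ℝ (Fin n) → ℝ}, (∀ x, x ≠ 0 → f x = g x) → ∀ x, x ≠ 0 →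
      f =ᶠ[𝓝 x] g := by
    intro f g h x hx
    filter_upwards [isOpen_ne.mem_nhds hx] with y hy using h y hy
  set p1 := 2 * a + 2 - n with hp1
  set q1 := a * (a + 2 - n) with hq1
  set p2 := 2 * (a+2) + 2 - n with hp2
  set q2 := (a+2) * ((a+2) + 2 - n) with hq2
  set p3 := 2 * (a+2+2) + 2 - n with hp3
  set q3 := (a+2+2) * ((a+2+2) + 2 - n) with hq3
  set F1 : ℕ → ℝ → ℝ := fun k t => V (k+2) t + p1 * V (k+1) t + q1 * V k t with hF1
  have l1 : ∀ x, x ≠ 0 → lap u x = Real.exp ((a+2) * (-Real.log ‖x‖)) * F1 0 (-Real.log ‖x‖) := by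
    intro x hx
    rw [lap_congr (ev hu x hx), lap_log_exp a D0 D1 hx]
  have dF1 : ∀ k, k < 4 → ∀ t, HasDerivAt (F1 k) (F1 (k+1) t) t := fun k hk t =>
    (((hd (k+2) (by omega) t).add ((hd (k+1) (by omega) t).const_mul p1)).add
      ((hd k (by omega) t).const_mul q1))
  set F2 : ℕ → ℝ → ℝ := fun k t => F1 (k+2) t + p2 * F1 (k+1) t + q2 * F1 k t with hF2
  have l2 : ∀ x, x ≠ 0 → lap (lap u) x =
      Real.exp ((a+2+2) * (-Real.log ‖x‖)) * F2 0 (-Real.log ‖x‖) := by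
    intro x hx
    rw [lap_congr (ev l1 x hx), lap_log_exp (a+2) (dF1 0 (by norm_num)) (dF1 1 (by norm_num)) hx]
  have dF2 : ∀ k, k < 2 → ∀ t, HasDerivAt (F2 k) (F2 (k+1) t) t := fun k hk t =>
    (((dF1 (k+2) (by omega) t).add ((dF1 (k+1) (by omega) t).const_mul p2)).add
      ((dF1 k (by omega) t).const_mul q2))
  intro x hx
  rw [lap_congr (ev l2 x hx), lap_log_exp (a+2+2) (dF2 0 (by norm_num)) (dF2 1 (by norm_num)) hx]
  rw [show a + 2 + 2 + 2 = a + 6 by ring]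
  congr 1
  simp only [hF2, hF1, hp1, hq1, hp2, hq2, hp3, hq3, K4, K2, K0, ha]
  norm_num
  ring

end

section
open Filter Topology

lemma cst_pos {n : ℕ} (hn : 7 ≤ n) : 0 < cst n := by
  have : (7:ℝ) ≤ n := by exact_mod_cast hn
  unfold cst
  have h1 : 0 < (n:ℝ) - 6 := by linarith
  have h2 : 0 < (n:ℝ) - 4 := by linarith
  have h3 : 0 < (n:ℝ) - 2 := by linarith
  have h4 : 0 < (n:ℝ) := by linarith
  positivity

theorem final_assembly (n : ℕ) (hn : 7 ≤ n)
    (u : EuclideanSpace ℝ (Fin n) → ℝ)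
    (hu : ContDiffOn ℝ 6 u {(0 : EuclideanSpace ℝ (Fin n))}ᶜ)
    (hupos : ∀ x : EuclideanSpace ℝ (Fin n), x ≠ 0 → 0 < u x)
    (hsol : ∀ x : EuclideanSpace ℝ (Fin n), x ≠ 0 →
      -(lap (lap (lap u)) x) = cst n * u x ^ (((n:ℝ)+6)/((n:ℝ)-6)))
    (hsing : ∀ M : ℝ, ∀ δ : ℝ, 0 < δ →
      ∃ x : EuclideanSpace ℝ (Fin n), x ≠ 0 ∧ ‖x‖ < δ ∧ M < u x)
    (hrad : ∀ x y : EuclideanSpace ℝ (Fin n), ‖x‖ = ‖y‖ → u x = u y)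
    (hbd : ∃ C : ℝ, ∀ x : EuclideanSpace ℝ (Fin n), x ≠ 0 →
      Real.exp (((n:ℝ)-6)/2 * Real.log ‖x‖) * u x ≤ C) :
    (∀ x y : EuclideanSpace ℝ (Fin n), ‖x‖ = ‖y‖ → u x = u y)
    ∧ (∀ ω : EuclideanSpace ℝ (Fin n), ‖ω‖ = 1 →
        (∀ t : ℝ, 0 < Real.exp (-(((n:ℝ)-6)/2)*t) * u (Real.exp (-t) • ω))
        ∧ (∃ C : ℝ, ∀ t : ℝ, Real.exp (-(((n:ℝ)-6)/2)*t) * u (Real.exp (-t) • ω) ≤ C)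
        ∧ (∃ p : ℝ, 0 < p ∧ ∀ t : ℝ,
            Real.exp (-(((n:ℝ)-6)/2)*(t+p)) * u (Real.exp (-(t+p)) • ω)
              = Real.exp (-(((n:ℝ)-6)/2)*t) * u (Real.exp (-t) • ω))
        ∧ (∀ t : ℝ,
            -(iteratedDeriv 6 (fun s => Real.exp (-(((n:ℝ)-6)/2)*s) * u (Real.exp (-s) • ω)) t)
              + K4 n * iteratedDeriv 4 (fun s => Real.exp (-(((n:ℝ)-6)/2)*s) * u (Real.exp (-s) • ω)) t
              - K2 n * iteratedDeriv 2 (fun s => Real.exp (-(((n:ℝ)-6)/2)*s) * u (Real.exp (-s) • ω)) t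
              + K0 n * (Real.exp (-(((n:ℝ)-6)/2)*t) * u (Real.exp (-t) • ω))
              = cst n * (Real.exp (-(((n:ℝ)-6)/2)*t) * u (Real.exp (-t) • ω))
                  ^ (((n:ℝ)+6)/((n:ℝ)-6)))) := by
  have hn' : (7:ℝ) ≤ n := by exact_mod_cast hn
  refine ⟨hrad, fun ω hω => ?_⟩
  set a := ((n:ℝ)-6)/2 with ha
  set p := ((n:ℝ)+6)/((n:ℝ)-6) with hp
  have ha0 : 0 < a := by rw [ha]; linarith
  have hω0 : ω ≠ 0 := by intro h; rw [h] at hω; simp at hω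
  have hne : ∀ t : ℝ, Real.exp (-t) • ω ≠ 0 := fun t =>
    smul_ne_zero (Real.exp_pos _).ne' hω0
  have hnorm : ∀ t : ℝ, ‖Real.exp (-t) • ω‖ = Real.exp (-t) := fun t => by
    rw [norm_smul, hω, mul_one, Real.norm_eq_abs, abs_of_pos (Real.exp_pos _)]
  set v : ℝ → ℝ := fun s => Real.exp (-a*s) * u (Real.exp (-s) • ω) with hv
  have hvpos : ∀ t, 0 < v t := fun t => mul_pos (Real.exp_pos _) (hupos _ (hne t))
  have hvc : ContDiff ℝ 6 v := by
    refine ContDiff.mul (by fun_prop) ?_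
    rw [contDiff_iff_contDiffAt]
    intro t
    have h1 : ContDiffAt ℝ 6 u (Real.exp (-t) • ω) :=
      hu.contDiffAt (isOpen_compl_singleton.mem_nhds (hne t))
    have h2 : ContDiffAt ℝ 6 (fun s : ℝ => Real.exp (-s) • ω) t := by
      apply ContDiff.contDiffAt; fun_prop
    exact h1.comp t h2
  set V : ℕ → ℝ → ℝ := fun k => iteratedDeriv k v with hV
  have hV0 : V 0 = v := iteratedDeriv_zero
  have hd : ∀ k, k < 6 → ∀ t, HasDerivAt (V k) (V (k+1) t) t := by
    intro k hk t
    simp only [hV, iteratedDeriv_succ]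
    exact (hvc.differentiable_iteratedDeriv k (by exact_mod_cast hk) t).hasDerivAt
  have hurad : ∀ x, x ≠ 0 → u x = Real.exp (a * (-Real.log ‖x‖)) * V 0 (-Real.log ‖x‖) := by
    intro x hx
    have hx' : 0 < ‖x‖ := norm_pos_iff.2 hx
    rw [hV0]
    simp only [hv]
    rw [← mul_assoc, ← Real.exp_add, show a * -Real.log ‖x‖ + -a * -Real.log ‖x‖ = 0 by ring,
      Real.exp_zero, one_mul]
    apply hrad
    rw [hnorm, neg_neg, Real.exp_log hx']
  have hODE : ∀ t, -(V 6 t) + K4 n * V 4 t - K2 n * V 2 t + K0 n * v t = cst n * (v t)^p := by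
    intro t
    have e1 := lap3_radial ha hd hurad _ (hne t)
    have e2 := hsol _ (hne t)
    rw [e1] at e2
    have e3 : -Real.log ‖Real.exp (-t) • ω‖ = t := by rw [hnorm, Real.log_exp, neg_neg]
    rw [hurad _ (hne t), e3, hV0, Real.mul_rpow (Real.exp_pos _).le (hvpos t).le, ← Real.exp_mul] at e2
    have e4 : a * t * p = (a + 6) * t := by
      have : a * p = a + 6 := by
        rw [ha, hp]
        have : (n:ℝ) - 6 ≠ 0 := by linarith
        field_simp; ring
      calc a * t * p = (a * p) * t := by ring
        _ = _ := by rw [this]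
    rw [e4] at e2
    have hE := (Real.exp_pos ((a + 6) * t)).ne'
    apply mul_left_cancel₀ hE
    linarith
  obtain ⟨C, hC⟩ := hbd
  have hvC : ∀ t, v t ≤ C := by
    intro t
    have := hC _ (hne t)
    rw [hnorm, Real.log_exp] at this
    simp only [hv]
    rwa [show -a * t = a * -t by ring]
  have S : SolV a (((n:ℝ)-2)/2) (((n:ℝ)+2)/2) (cst n) p C V := by
    refine ⟨ha0, by rw [ha]; linarith, by linarith, cst_pos hn, ?_, hd, ?_, ?_, ?_⟩
    · rw [hp, lt_div_iff₀ (by linarith)]; linarith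
    · rw [hV0]; exact hvpos
    · rw [hV0]; exact hvC
    · intro t
      have := hODE t
      rw [hV0]
      have k4 : a^2 + (((n:ℝ)-2)/2)^2 + (((n:ℝ)+2)/2)^2 = K4 n := by rw [ha]; unfold K4; ring
      have k2 : a^2 * (((n:ℝ)-2)/2)^2 + a^2 * (((n:ℝ)+2)/2)^2 + (((n:ℝ)-2)/2)^2 * (((n:ℝ)+2)/2)^2 = K2 n := by
        rw [ha]; unfold K2; ring
      have k0 : a^2 * (((n:ℝ)-2)/2)^2 * (((n:ℝ)+2)/2)^2 = K0 n := by rw [ha]; unfold K0; ring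
      rw [k4, k2, k0]
      linarith
  refine ⟨hvpos, ⟨C, hvC⟩, ?_, hODE⟩
  have := S.periodic (by
    intro N t0
    obtain ⟨x, hx, hx1, hx2⟩ := hsing N (Real.exp (-t0)) (Real.exp_pos _)
    have hx' : 0 < ‖x‖ := norm_pos_iff.2 hx
    refine ⟨-Real.log ‖x‖, ?_, ?_⟩
    · have := Real.log_lt_log hx' hx1
      rw [Real.log_exp] at this
      linarith
    · rw [← hurad x hx]; exact hx2)
  rw [hV0] at this
  exact this

end

section
open Filter Topology MeasureTheory
open scoped ContDiff

lemma contDiffOn_dirDeriv {E : Type*} [NormedAddCommGroup E] [NormedSpace ℝ E] {f : E → ℝ} {U : Set E}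
    (hU : IsOpen U) {m k : WithTop ℕ∞} (hf : ContDiffOn ℝ k f U) (h : m + 1 ≤ k) (v : E) :
    ContDiffOn ℝ m (fun y => fderiv ℝ f y v) U :=
  (hf.fderiv_of_isOpen hU h).clm_apply contDiffOn_const

lemma contDiffOn_lap {n : ℕ} {f : EuclideanSpace ℝ (Fin n) → ℝ} {U : Set (EuclideanSpace ℝ (Fin n))}
    (hU : IsOpen U) {m k : WithTop ℕ∞} (hf : ContDiffOn ℝ k f U) (h : m + 1 + 1 ≤ k) :
    ContDiffOn ℝ m (lap f) U := by
  unfold lap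
  refine ContDiffOn.sum fun i _ => ?_
  exact contDiffOn_dirDeriv hU (contDiffOn_dirDeriv hU hf h _) le_rfl _

lemma contDiff_lap {n : ℕ} {f : EuclideanSpace ℝ (Fin n) → ℝ}
    {m k : WithTop ℕ∞} (hf : ContDiff ℝ k f) (h : m + 1 + 1 ≤ k) :
    ContDiff ℝ m (lap f) := by
  rw [← contDiffOn_univ] at *
  exact contDiffOn_lap isOpen_univ hf h

lemma tsupport_dirDeriv {E : Type*} [NormedAddCommGroup E] [NormedSpace ℝ E] (f : E → ℝ) (v : E) :
    tsupport (fun y => fderiv ℝ f y v) ⊆ tsupport f :=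
  tsupport_fderiv_apply_subset ℝ v

lemma lap_eq_zero_of_notMem {n : ℕ} {f : EuclideanSpace ℝ (Fin n) → ℝ} {x} (hx : x ∉ tsupport f) :
    lap f x = 0 := by
  have h : f =ᶠ[𝓝 x] fun _ => 0 := notMem_tsupport_iff_eventuallyEq.1 hx
  rw [lap_congr h]; simp [lap]

lemma tsupport_lap {n : ℕ} (f : EuclideanSpace ℝ (Fin n) → ℝ) : tsupport (lap f) ⊆ tsupport f := by
  refine closure_minimal (fun x hx => ?_) (isClosed_tsupport f)
  by_contra h
  exact hx (lap_eq_zero_of_notMem h)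

lemma continuous_mul_supp {E : Type*} [NormedAddCommGroup E] {f φ : E → ℝ} {U : Set E}
    (hU : IsOpen U) (hf : ContinuousOn f U) (hφ : Continuous φ) (hs : tsupport φ ⊆ U) :
    Continuous (fun x => f x * φ x) := by
  rw [continuous_iff_continuousAt]
  intro x
  by_cases hx : x ∈ tsupport φ
  · exact (hf.continuousAt (hU.mem_nhds (hs hx))).mul hφ.continuousAt
  · have h : φ =ᶠ[𝓝 x] fun _ => 0 := notMem_tsupport_iff_eventuallyEq.1 hx
    have : (fun x => f x * φ x) =ᶠ[𝓝 x] fun _ => 0 := by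
      filter_upwards [h] with y hy
      simp [hy]
    exact (continuousAt_const).congr this.symm

lemma integrable_mul_supp {n : ℕ} {f φ : EuclideanSpace ℝ (Fin n) → ℝ} {U : Set (EuclideanSpace ℝ (Fin n))}
    (hU : IsOpen U) (hf : ContinuousOn f U) (hφ : Continuous φ) (hs : tsupport φ ⊆ U)
    (hc : HasCompactSupport φ) : Integrable (fun x => f x * φ x) :=
  (continuous_mul_supp hU hf hφ hs).integrable_of_hasCompactSupport (hc.mul_left)

lemma ibp1 {n : ℕ} {f φ : EuclideanSpace ℝ (Fin n) → ℝ} {U : Set (EuclideanSpace ℝ (Fin n))}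
    (hU : IsOpen U) (hf : ContDiffOn ℝ 1 f U) (hφ : ContDiff ℝ 1 φ) (hs : tsupport φ ⊆ U)
    (hc : HasCompactSupport φ) (v) : ∫ x, f x * fderiv ℝ φ x v = - ∫ x, fderiv ℝ f x v * φ x := by
  have hd : Continuous (fun y => fderiv ℝ φ y v) := (hφ.continuous_fderiv (by simp)).clm_apply continuous_const
  refine integral_mul_fderiv_eq_neg_fderiv_mul_of_integrable ?_ ?_ ?_ ?_ ?_
  · exact integrable_mul_supp hU (contDiffOn_dirDeriv (m := 0) hU hf (by simp) v).continuousOn hφ.continuous hs hc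
  · exact integrable_mul_supp hU hf.continuousOn hd ((tsupport_dirDeriv φ v).trans hs) (hc.fderiv_apply ℝ v)
  · exact integrable_mul_supp hU hf.continuousOn hφ.continuous hs hc
  · exact fun x hx => (hf.contDiffAt (hU.mem_nhds (hs hx))).differentiableAt (by simp)
  · exact fun x _ => hφ.differentiable (by simp) x

lemma ibp2 {n : ℕ} {f φ : EuclideanSpace ℝ (Fin n) → ℝ} {U : Set (EuclideanSpace ℝ (Fin n))}
    (hU : IsOpen U) (hf : ContDiffOn ℝ 2 f U) (hφ : ContDiff ℝ 2 φ) (hs : tsupport φ ⊆ U)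
    (hc : HasCompactSupport φ) : ∫ x, f x * lap φ x = ∫ x, lap f x * φ x := by
  unfold lap
  simp_rw [Finset.mul_sum, Finset.sum_mul]
  have hd (v) : ContDiff ℝ 1 (fun y => fderiv ℝ φ y v) :=
    (hφ.fderiv_right (by norm_num)).clm_apply contDiff_const
  have hd2 (v) : ContDiff ℝ 0 (fun y => fderiv ℝ (fun y => fderiv ℝ φ y v) y v) :=
    ((hd v).fderiv_right (by norm_num)).clm_apply contDiff_const
  have hg (v) : ContDiffOn ℝ 1 (fun y => fderiv ℝ f y v) U := contDiffOn_dirDeriv hU hf (by norm_num) v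
  have hg2 (v) : ContDiffOn ℝ 0 (fun y => fderiv ℝ (fun y => fderiv ℝ f y v) y v) U :=
    contDiffOn_dirDeriv hU (hg v) (by norm_num) v
  have ht (v) : tsupport (fun y => fderiv ℝ φ y v) ⊆ U := (tsupport_dirDeriv φ v).trans hs
  have hcc (v) : HasCompactSupport (fun y => fderiv ℝ φ y v) := hc.fderiv_apply ℝ v
  rw [integral_finsetSum, integral_finsetSum]
  · refine Finset.sum_congr rfl fun i _ => ?_
    rw [ibp1 hU (hf.of_le (by norm_num)) (hd _) (ht _) (hcc _),
      ibp1 hU (hg _) (hφ.of_le (by norm_num)) hs hc, neg_neg]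
  · exact fun i _ => integrable_mul_supp hU (hg2 _).continuousOn hφ.continuous hs hc
  · exact fun i _ => integrable_mul_supp hU hf.continuousOn (hd2 _).continuous
      ((tsupport_dirDeriv _ _).trans (ht _)) ((hcc _).fderiv_apply ℝ _)

lemma hcs_lap {n : ℕ} {φ : EuclideanSpace ℝ (Fin n) → ℝ} (hc : HasCompactSupport φ) :
    HasCompactSupport (lap φ) := hc.of_isClosed_subset (isClosed_tsupport _) (tsupport_lap φ)

lemma ibp6 {n : ℕ} {f φ : EuclideanSpace ℝ (Fin n) → ℝ} {U : Set (EuclideanSpace ℝ (Fin n))}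
    (hU : IsOpen U) (hf : ContDiffOn ℝ 6 f U) (hφ : ContDiff ℝ 6 φ) (hs : tsupport φ ⊆ U)
    (hc : HasCompactSupport φ) :
    ∫ x, f x * lap (lap (lap φ)) x = ∫ x, lap (lap (lap f)) x * φ x := by
  have h1 : ContDiff ℝ 4 (lap φ) := contDiff_lap hφ (by norm_num)
  have h2 : ContDiff ℝ 2 (lap (lap φ)) := contDiff_lap h1 (by norm_num)
  have g1 : ContDiffOn ℝ 4 (lap f) U := contDiffOn_lap hU hf (by norm_num)
  have g2 : ContDiffOn ℝ 2 (lap (lap f)) U := contDiffOn_lap hU g1 (by norm_num)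
  have t1 := (tsupport_lap φ).trans hs
  rw [ibp2 hU (hf.of_le (by norm_num)) h2 ((tsupport_lap _).trans t1) (hcs_lap (hcs_lap hc)),
    ibp2 hU (g1.of_le (by norm_num)) (h1.of_le (by norm_num)) t1 (hcs_lap hc),
    ibp2 hU g2 (hφ.of_le (by norm_num)) hs hc]

lemma fderiv_cmul {n : ℕ} (f : EuclideanSpace ℝ (Fin n) → ℝ) (c : ℝ) (x) :
    fderiv ℝ (fun y => c * f y) x = c • fderiv ℝ f x := by
  have := congrFun (fderiv_const_smul_field (𝕜 := ℝ) (f := f) c) x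
  exact this

lemma lap_comp_smul {n : ℕ} (f : EuclideanSpace ℝ (Fin n) → ℝ) (c : ℝ) :
    lap (fun y => f (c • y)) = fun x => c^2 * lap f (c • x) := by
  funext x
  unfold lap
  rw [Finset.mul_sum]
  refine Finset.sum_congr rfl fun i _ => ?_
  have : (fun y => fderiv ℝ (fun y => f (c • y)) y (EuclideanSpace.single i 1)) =
     fun y => c * (fun y => fderiv ℝ f y (EuclideanSpace.single i 1)) (c • y) := by
    funext y
    rw [fderiv_comp_smul]; simp
  rw [this, fderiv_cmul, fderiv_comp_smul (f := fun y => fderiv ℝ f y (EuclideanSpace.single i 1))]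
  simp; ring

lemma lap_const_mul {n : ℕ} (f : EuclideanSpace ℝ (Fin n) → ℝ) (c : ℝ) :
    lap (fun y => c * f y) = fun x => c * lap f x := by
  funext x
  unfold lap
  rw [Finset.mul_sum]
  refine Finset.sum_congr rfl fun i _ => ?_
  have : (fun y => fderiv ℝ (fun y => c * f y) y (EuclideanSpace.single i 1)) =
     fun y => c * (fun y => fderiv ℝ f y (EuclideanSpace.single i 1)) y := by
    funext y
    rw [fderiv_cmul]; simp
  rw [this, fderiv_cmul]
  simp

lemma lap3_comp_smul {n : ℕ} (f : EuclideanSpace ℝ (Fin n) → ℝ) (c d : ℝ) :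
    lap (lap (lap (fun y => d * f (c • y)))) = fun x => d * c^6 * lap (lap (lap f)) (c • x) := by
  simp only [lap_const_mul, lap_comp_smul]
  funext x; ring

lemma lap_add {n : ℕ} {f g : EuclideanSpace ℝ (Fin n) → ℝ} {x}
    (hf : ContDiffAt ℝ 2 f x) (hg : ContDiffAt ℝ 2 g x) :
    lap (fun y => f y + g y) x = lap f x + lap g x := by
  unfold lap
  rw [← Finset.sum_add_distrib]
  refine Finset.sum_congr rfl fun i _ => ?_
  have d (f : EuclideanSpace ℝ (Fin n) → ℝ) (hf : ContDiffAt ℝ 2 f x) :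
      DifferentiableAt ℝ (fun y => fderiv ℝ f y (EuclideanSpace.single i 1)) x :=
    ((hf.fderiv_right (m := 1) (by norm_num)).clm_apply contDiffAt_const).differentiableAt (by simp)
  have : (fun y => fderiv ℝ (fun y => f y + g y) y (EuclideanSpace.single i 1)) =ᶠ[𝓝 x]
     fun y => fderiv ℝ f y (EuclideanSpace.single i 1) + fderiv ℝ g y (EuclideanSpace.single i 1) := by
    filter_upwards [hf.eventually (by simp), hg.eventually (by simp)] with y h1 h2
    rw [fderiv_fun_add (h1.differentiableAt (by simp)) (h2.differentiableAt (by simp))]; rfl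
  rw [this.fderiv_eq, fderiv_fun_add (d f hf) (d g hg)]; rfl

end

section
open Filter Topology MeasureTheory
open scoped ContDiff

lemma six_le : (6 : WithTop ℕ∞) ≤ ∞ := by
  have : ((6:ℕ∞) : WithTop ℕ∞) ≤ ((⊤:ℕ∞) : WithTop ℕ∞) := WithTop.coe_le_coe.2 le_top
  exact this

structure SolU (n : ℕ) (a p c : ℝ) (u : EuclideanSpace ℝ (Fin n) → ℝ) : Prop where
  na : (n:ℝ) = 2 * a + 6
  ha : 1/2 ≤ a
  hp : p * a = a + 6
  hc : 0 < c
  hu : ContDiffOn ℝ 6 u {(0:EuclideanSpace ℝ (Fin n))}ᶜ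
  upos : ∀ x ≠ 0, 0 < u x
  sol : ∀ x ≠ 0, lap (lap (lap u)) x = -(c * u x ^ p)

lemma SolU.p1 {n a p c u} (S : SolU n a p c u) : 1 < p := by
  have := S.ha; have h := S.hp
  by_contra hh
  push Not at hh
  nlinarith

lemma SolU.hn {n a p c u} (S : SolU n a p c u) : 7 ≤ n := by
  have := S.ha; have h := S.na
  have : (7:ℝ) ≤ n := by linarith
  exact_mod_cast this

lemma SolU.cont {n a p c u} (S : SolU n a p c u) : ContinuousOn u {0}ᶜ := S.hu.continuousOn

lemma SolU.contp {n a p c u} (S : SolU n a p c u) : ContinuousOn (fun y => u y ^ p) {0}ᶜ :=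
  S.cont.rpow_const (fun x hx => Or.inl (S.upos x hx).ne')

/-- cutoff: 0 on the unit ball, 1 outside of the ball of radius √2 -/
def cutA {n : ℕ} (z : EuclideanSpace ℝ (Fin n)) : ℝ := Real.smoothTransition (‖z‖^2 - 1)

lemma cutA_smooth {n : ℕ} : ContDiff ℝ ∞ (cutA (n := n)) := by
  unfold cutA
  exact Real.smoothTransition.contDiff.comp ((contDiff_norm_sq ℝ).sub contDiff_const)

lemma cutA_zero {n : ℕ} {z : EuclideanSpace ℝ (Fin n)} (h : ‖z‖ ≤ 1) : cutA z = 0 :=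
  Real.smoothTransition.zero_of_nonpos (by nlinarith [norm_nonneg z])

lemma cutA_one {n : ℕ} {z : EuclideanSpace ℝ (Fin n)} (h : 2 ≤ ‖z‖^2) : cutA z = 1 :=
  Real.smoothTransition.one_of_one_le (by linarith)

lemma cutA_nonneg {n : ℕ} (z : EuclideanSpace ℝ (Fin n)) : 0 ≤ cutA z :=
  Real.smoothTransition.nonneg _

lemma cutA_le {n : ℕ} (z : EuclideanSpace ℝ (Fin n)) : cutA z ≤ 1 :=
  Real.smoothTransition.le_one _

def cutE {n : ℕ} (z : EuclideanSpace ℝ (Fin n)) : ℝ := cutA ((2:ℝ) • z) * (1 - cutA ((1/2:ℝ) • z))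

lemma cutE_smooth {n : ℕ} : ContDiff ℝ ∞ (cutE (n := n)) := by
  unfold cutE
  have h (c : ℝ) : ContDiff ℝ ∞ (fun z : EuclideanSpace ℝ (Fin n) => cutA (c • z)) :=
    cutA_smooth.comp (contDiff_const_smul c)
  exact (h 2).mul (contDiff_const.sub (h (1/2)))

lemma cutE_nonneg {n : ℕ} (z : EuclideanSpace ℝ (Fin n)) : 0 ≤ cutE z :=
  mul_nonneg (cutA_nonneg _) (sub_nonneg.2 (cutA_le _))

lemma cutE_le {n : ℕ} (z : EuclideanSpace ℝ (Fin n)) : cutE z ≤ 1 :=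
  mul_le_one₀ (cutA_le _) (sub_nonneg.2 (cutA_le _)) (by linarith [cutA_nonneg ((1/2:ℝ) • z)])

lemma cutE_one {n : ℕ} {z : EuclideanSpace ℝ (Fin n)} (h : 1 ≤ ‖z‖) (h2 : ‖z‖ ≤ 2) : cutE z = 1 := by
  unfold cutE
  rw [cutA_one, cutA_zero]
  · simp
  · rw [norm_smul]; norm_num; linarith
  · rw [norm_smul]; norm_num; nlinarith

lemma cutE_zero_in {n : ℕ} {z : EuclideanSpace ℝ (Fin n)} (h : ‖z‖ ≤ 1/2) : cutE z = 0 := by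
  unfold cutE
  rw [cutA_zero]
  · simp
  · rw [norm_smul]; norm_num; linarith

lemma cutE_zero_out {n : ℕ} {z : EuclideanSpace ℝ (Fin n)} (h : 4 ≤ ‖z‖) : cutE z = 0 := by
  unfold cutE
  rw [cutA_one (z := (1/2:ℝ) • z)]
  · simp
  · rw [norm_smul]; norm_num; nlinarith

lemma dirDeriv_pow {E : Type*} [NormedAddCommGroup E] [NormedSpace ℝ E] {η g : E → ℝ}
    (hη : ContDiff ℝ ∞ η) (hg : ContDiff ℝ ∞ g) (k : ℕ) (v : E) :
    ∃ g', ContDiff ℝ ∞ g' ∧ (fun y => fderiv ℝ (fun y => η y ^ (k+1) * g y) y v) =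
      fun y => η y ^ k * g' y := by
  refine ⟨fun y => (k+1) * fderiv ℝ η y v * g y + η y * fderiv ℝ g y v, ?_, ?_⟩
  · have h1 : ContDiff ℝ ∞ (fun y => fderiv ℝ η y v) := (hη.fderiv_right (by simp)).clm_apply contDiff_const
    have h2 : ContDiff ℝ ∞ (fun y => fderiv ℝ g y v) := (hg.fderiv_right (by simp)).clm_apply contDiff_const
    exact ((contDiff_const.mul h1).mul hg).add (hη.mul h2)
  · funext y
    have h1 := (hη.differentiable (by simp) y).hasFDerivAt
    have h2 := (hg.differentiable (by simp) y).hasFDerivAt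
    have := ((h1.pow (k+1)).mul h2).fderiv
    have e : (fun y => η y ^ (k+1) * g y) = ((fun x => η x ^ (k+1)) * g) := rfl
    rw [e, this]
    simp
    ring

lemma lap_pow {n : ℕ} {η g : EuclideanSpace ℝ (Fin n) → ℝ}
    (hη : ContDiff ℝ ∞ η) (hg : ContDiff ℝ ∞ g) (k : ℕ) :
    ∃ g', ContDiff ℝ ∞ g' ∧ lap (fun y => η y ^ (k+2) * g y) = fun y => η y ^ k * g' y := by
  have (i : Fin n) : ∃ g', ContDiff ℝ ∞ g' ∧ (fun y => fderiv ℝ (fun y =>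
      fderiv ℝ (fun y => η y ^ (k+2) * g y) y (EuclideanSpace.single i 1)) y
        (EuclideanSpace.single i 1)) = fun y => η y ^ k * g' y := by
    obtain ⟨g1, h1, e1⟩ := dirDeriv_pow hη hg (k+1) (EuclideanSpace.single i 1)
    obtain ⟨g2, h2, e2⟩ := dirDeriv_pow hη h1 k (EuclideanSpace.single i 1)
    refine ⟨g2, h2, ?_⟩
    rw [show k + 2 = k+1+1 from rfl, e1, e2]
  choose g' h e using this
  refine ⟨fun y => ∑ i, g' i y, ContDiff.sum fun i _ => h i, ?_⟩
  funext y
  unfold lap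
  rw [Finset.mul_sum]
  exact Finset.sum_congr rfl fun i _ => congrFun (e i) y

lemma lap3_cutE (n : ℕ) : ∃ C, 0 ≤ C ∧ ∀ z : EuclideanSpace ℝ (Fin n),
    |lap (lap (lap (fun y => cutE y ^ (n+6)))) z| ≤ C * cutE z ^ n := by
  obtain ⟨g1, h1, e1⟩ := lap_pow (cutE_smooth (n := n)) (contDiff_const (c := 1)) (n+4)
  obtain ⟨g2, h2, e2⟩ := lap_pow (cutE_smooth (n := n)) h1 (n+2)
  obtain ⟨g3, h3, e3⟩ := lap_pow (cutE_smooth (n := n)) h2 n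
  have E : lap (lap (lap (fun y : EuclideanSpace ℝ (Fin n) => cutE y ^ (n+6)))) =
      fun y => cutE y ^ n * g3 y := by
    rw [← e3, ← e2, ← e1]; simp
  obtain ⟨C, hC⟩ := (isCompact_closedBall (0:EuclideanSpace ℝ (Fin n)) 4).exists_bound_of_continuousOn
    (f := g3) h3.continuous.continuousOn
  have hC0 : 0 ≤ C := (norm_nonneg _).trans (hC 0 (by simp))
  refine ⟨C, hC0, fun z => ?_⟩
  rw [E]
  by_cases hz : ‖z‖ ≤ 4
  · have := hC z (by simpa using hz)
    rw [Real.norm_eq_abs] at this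
    show |cutE z ^ n * g3 z| ≤ _
    rw [abs_mul, abs_of_nonneg (pow_nonneg (cutE_nonneg z) n), mul_comm]
    exact mul_le_mul_of_nonneg_right this (pow_nonneg (cutE_nonneg z) n)
  · have h6 : (fun y : EuclideanSpace ℝ (Fin n) => cutE y ^ (n+6)) =ᶠ[𝓝 z] fun _ => 0 := by
      filter_upwards [(isOpen_lt continuous_const continuous_norm).mem_nhds (not_le.1 hz)] with y hy
      rw [cutE_zero_out hy.le]; simp
    have := lap_congr (lap_congr' (lap_congr' h6))
    rw [E] at this
    rw [this]
    have l0 : lap (fun _ : EuclideanSpace ℝ (Fin n) => (0:ℝ)) = fun _ => 0 := by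
      funext x; simp [lap]
    rw [l0, l0, l0]
    simpa using mul_nonneg hC0 (pow_nonneg (cutE_nonneg z) n)

lemma young {c p C0 : ℝ} (hc : 0 < c) (hp : 1 < p) (hC : 0 ≤ C0) :
    ∃ C1, 0 ≤ C1 ∧ ∀ X, 0 ≤ X → C0 * X ≤ c / 2 * X ^ p + C1 := by
  set X0 := (2 * C0 / c) ^ (1/(p-1)) with hX0
  have h0 : 0 ≤ X0 := by positivity
  refine ⟨C0 * X0, by positivity, fun X hX => ?_⟩
  by_cases h : X ≤ X0
  · have : 0 ≤ c / 2 * X ^ p := by positivity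
    nlinarith
  · push Not at h
    have hXp : 0 < X := lt_of_le_of_lt h0 h
    have h1 : 2 * C0 / c ≤ X ^ (p-1) := by
      have := Real.rpow_le_rpow h0 h.le (show 0 ≤ p - 1 by linarith)
      rwa [hX0, ← Real.rpow_mul (by positivity), one_div_mul_cancel (by linarith), Real.rpow_one] at this
    have h2 : X ^ p = X ^ (p-1) * X := by
      rw [← Real.rpow_add_one hXp.ne']; congr 1; ring
    rw [h2]
    have h3 : C0 ≤ c / 2 * X ^ (p-1) := by
      rw [div_le_iff₀ hc] at h1; nlinarith
    have : 0 ≤ C0 * X0 := by positivity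
    nlinarith [mul_le_mul_of_nonneg_right h3 hX]

/-- closed annulus -/
def ann (n : ℕ) (R : ℝ) : Set (EuclideanSpace ℝ (Fin n)) := {y | R ≤ ‖y‖ ∧ ‖y‖ ≤ 2 * R}

lemma ann_compact (n : ℕ) (R : ℝ) : IsCompact (ann n R) := by
  refine (isCompact_closedBall (0:EuclideanSpace ℝ (Fin n)) (2*R)).of_isClosed_subset ?_ ?_
  · exact (isClosed_le continuous_const continuous_norm).inter (isClosed_le continuous_norm continuous_const)
  · intro y hy; simpa using hy.2

lemma ann_ne {n : ℕ} {R : ℝ} (hR : 0 < R) : ann n R ⊆ {0}ᶜ := by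
  rintro y ⟨h1, _⟩ rfl
  simp at h1; linarith

lemma SolU.ann_p {n a p c u} (S : SolU n a p c u) : ∃ C, 0 ≤ C ∧ ∀ R, 0 < R →
    ∫ y in ann n R, u y ^ p ≤ C * R ^ a := by
  obtain ⟨C0, hC0, hL⟩ := lap3_cutE n
  obtain ⟨C1, hC1, hY⟩ := young S.hc S.p1 hC0
  have hc := S.hc
  set ww : ℝ := volume.real (Metric.closedBall (0:EuclideanSpace ℝ (Fin n)) 1)
  refine ⟨2 / c * (C1 * 4^n * ww), by positivity, fun R hR => ?_⟩
  set L := lap (lap (lap (fun y : EuclideanSpace ℝ (Fin n) => cutE y ^ (n+6))))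
  set ψ : EuclideanSpace ℝ (Fin n) → ℝ := fun y => cutE (R⁻¹ • y) ^ (n+6) with hψ
  have hψs : ContDiff ℝ ∞ ψ := (cutE_smooth.comp (contDiff_const_smul (R⁻¹))).pow _
  have nrm (y : EuclideanSpace ℝ (Fin n)) : ‖R⁻¹ • y‖ = ‖y‖ / R := by
    rw [norm_smul, Real.norm_of_nonneg (by positivity)]; field_simp
  have supp1 : tsupport ψ ⊆ {y | R / 2 ≤ ‖y‖ ∧ ‖y‖ ≤ 4 * R} := by
    refine closure_minimal (fun y hy => ?_) ((isClosed_le continuous_const continuous_norm).inter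
      (isClosed_le continuous_norm continuous_const))
    by_contra h
    refine hy ?_
    have h' : ¬ (R/2 ≤ ‖y‖ ∧ ‖y‖ ≤ 4 * R) := h
    rw [not_and_or, not_le, not_le] at h'
    show cutE (R⁻¹ • y) ^ (n+6) = 0
    rcases h' with h' | h'
    · rw [cutE_zero_in]; · simp
      rw [nrm, div_le_iff₀ hR]; linarith
    · rw [cutE_zero_out]; · simp
      rw [nrm, le_div_iff₀ hR]; linarith
  have supp : tsupport ψ ⊆ {0}ᶜ := by
    rintro y hy rfl
    have := (supp1 hy).1; simp at this; linarith
  have hcs : HasCompactSupport ψ := by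
    refine (isCompact_closedBall (0:EuclideanSpace ℝ (Fin n)) (4*R)).of_isClosed_subset
      (isClosed_tsupport _) fun y hy => by simpa using (supp1 hy).2
  have hl : lap (lap (lap ψ)) = fun x => (R⁻¹)^6 * L (R⁻¹ • x) := by
    have := lap3_comp_smul (fun y : EuclideanSpace ℝ (Fin n) => cutE y ^ (n+6)) (R⁻¹) 1
    simpa using this
  have hI := ibp6 isOpen_compl_singleton S.hu (hψs.of_le six_le) supp hcs
  have i1 : Integrable (fun x => u x * lap (lap (lap ψ)) x) := by
    have h6 : ContDiff ℝ 6 ψ := hψs.of_le six_le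
    have h1 : ContDiff ℝ 4 (lap ψ) := contDiff_lap h6 (by norm_num)
    have h2 : ContDiff ℝ 2 (lap (lap ψ)) := contDiff_lap h1 (by norm_num)
    have h3 : ContDiff ℝ 0 (lap (lap (lap ψ))) := contDiff_lap h2 (by norm_num)
    exact integrable_mul_supp isOpen_compl_singleton S.cont h3.continuous
      ((tsupport_lap _).trans ((tsupport_lap _).trans ((tsupport_lap _).trans supp))) (hcs_lap (hcs_lap (hcs_lap hcs)))
  have i2 : Integrable (fun x => u x ^ p * ψ x) :=
    integrable_mul_supp isOpen_compl_singleton S.contp hψs.continuous supp hcs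
  have ψ0 : ψ 0 = 0 := by
    show cutE (R⁻¹ • (0 : EuclideanSpace ℝ (Fin n))) ^ (n+6) = 0
    rw [smul_zero, cutE_zero_in (by simp)]; simp
  have e1 : ∫ x, lap (lap (lap u)) x * ψ x = - (c * ∫ x, u x ^ p * ψ x) := by
    rw [← integral_const_mul, ← integral_neg]
    refine integral_congr_ae (Eventually.of_forall fun x => ?_)
    show lap (lap (lap u)) x * ψ x = - (c * (u x ^ p * ψ x))
    by_cases hx : x = 0
    · rw [hx, ψ0]; simp
    · rw [S.sol x hx]; ring
  set K : ℝ := C1 * (R⁻¹)^6 * R ^ (-a)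
  have hball : volume (Metric.closedBall (0:EuclideanSpace ℝ (Fin n)) (4*R)) < ⊤ := measure_closedBall_lt_top
  have i3 : Integrable ((Metric.closedBall (0:EuclideanSpace ℝ (Fin n)) (4*R)).indicator (fun _ => K)) := by
    rw [integrable_indicator_iff measurableSet_closedBall]
    exact integrableOn_const hball.ne
  have pt : ∀ᵐ x, -(u x * lap (lap (lap ψ)) x) ≤ c / 2 * (u x ^ p * ψ x) +
      (Metric.closedBall (0:EuclideanSpace ℝ (Fin n)) (4*R)).indicator (fun _ => K) x := by
    have : ∀ᵐ x : EuclideanSpace ℝ (Fin n), x ≠ 0 := by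
      have : Nonempty (Fin n) := ⟨⟨0, by have := S.hn; omega⟩⟩
      exact Measure.ae_ne volume 0
    filter_upwards [this] with x hx
    have ux := S.upos x hx
    rw [hl]
    set z := R⁻¹ • x with hz
    have hLz := (abs_le.1 (hL z)).1
    have e0 := cutE_nonneg z
    have e1 := cutE_le z
    have s1 : -(u x * ((R⁻¹)^6 * L z)) ≤ u x * ((R⁻¹)^6 * (C0 * cutE z ^ n)) := by
      have : 0 ≤ u x * (R⁻¹)^6 := by positivity
      nlinarith [mul_le_mul_of_nonneg_left hLz this]
    refine s1.trans ?_
    by_cases hb : ‖x‖ ≤ 4 * R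
    · rw [Set.indicator_of_mem (by simpa using hb)]
      set X := R ^ a * u x * cutE z ^ (n-6) with hX
      have hX0 : 0 ≤ X := by positivity
      have y := hY X hX0
      have hn := S.hn
      have s2 : cutE z ^ n ≤ cutE z ^ (n-6) := pow_le_pow_of_le_one e0 e1 (by omega)
      have Xp : X ^ p = R ^ a * R ^ 6 * (u x ^ p * ψ x) := by
        rw [hX, Real.mul_rpow (by positivity) (by positivity), Real.mul_rpow (by positivity) ux.le,
          ← Real.rpow_mul hR.le, ← Real.rpow_natCast (cutE z), ← Real.rpow_mul e0,
          Nat.cast_sub (by omega), mul_comm a p, S.hp, Real.rpow_add hR]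
        have : ((n:ℝ) - (6:ℕ)) * p = ((n + 6 : ℕ):ℝ) := by
          push_cast; rw [S.na]; linear_combination 2 * S.hp
        rw [this, Real.rpow_natCast, show (6:ℝ) = ((6:ℕ):ℝ) by norm_num, Real.rpow_natCast]
        simp only [hψ, hz]; ring
      rw [Xp] at y
      have Ra : R ^ (-a) * R ^ a = 1 := by rw [← Real.rpow_add hR]; simp
      have R6 : (R⁻¹)^6 * R^6 = 1 := by field_simp
      have t : 0 ≤ (R⁻¹)^6 * R ^ (-a) := by positivity
      have y2 := mul_le_mul_of_nonneg_left y t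
      have l1 : (R⁻¹)^6 * R ^ (-a) * (C0 * X) = u x * ((R⁻¹)^6 * (C0 * cutE z ^ (n-6))) := by
        rw [hX]; linear_combination (R⁻¹)^6 * C0 * u x * cutE z ^ (n-6) * Ra
      have l2 : (R⁻¹)^6 * R ^ (-a) * (c/2 * (R ^ a * R ^ 6 * (u x ^ p * ψ x)) + C1) =
          c / 2 * (u x ^ p * ψ x) + K := by
        simp only [K]
        linear_combination (c/2 * (u x ^ p * ψ x)) * ((R⁻¹)^6 * R^6 * Ra + R6)
      rw [l1, l2] at y2
      refine le_trans ?_ y2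
      gcongr
    · have : cutE z = 0 := cutE_zero_out (by rw [hz, nrm, le_div_iff₀ hR]; linarith)
      rw [Set.indicator_of_notMem (by simpa using hb), this]
      have hn := S.hn
      simp only [hψ, ← hz, this]
      simp [show n ≠ 0 by omega]
  have fin := integral_mono_ae i1.neg ((i2.const_mul (c/2)).add i3) pt
  have fin2 : c * ∫ x, u x ^ p * ψ x ≤ c / 2 * (∫ x, u x ^ p * ψ x) +
      volume.real (Metric.closedBall (0:EuclideanSpace ℝ (Fin n)) (4*R)) * K := by
    have r1 : ∫ x, (c / 2 * (u x ^ p * ψ x) +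
      (Metric.closedBall (0:EuclideanSpace ℝ (Fin n)) (4*R)).indicator (fun _ => K) x) =
      c / 2 * (∫ x, u x ^ p * ψ x) +
      volume.real (Metric.closedBall (0:EuclideanSpace ℝ (Fin n)) (4*R)) * K := by
      rw [integral_add (i2.const_mul _) i3, integral_const_mul,
        integral_indicator_const _ measurableSet_closedBall, smul_eq_mul]
    have r2 : ∫ x, -(u x * lap (lap (lap ψ)) x) = c * ∫ x, u x ^ p * ψ x := by
      rw [integral_neg, hI, e1, neg_neg]
    rw [← r1, ← r2]; exact fin
  have vol : volume.real (Metric.closedBall (0:EuclideanSpace ℝ (Fin n)) (4*R)) = (4*R)^n * ww := by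
    rw [Measure.addHaar_real_closedBall' _ _ (by positivity)]; simp [ww]
  have RR : R^n * ((R⁻¹)^6 * R ^ (-a)) = R ^ a := by
    rw [← Real.rpow_natCast R n, S.na, inv_pow, ← Real.rpow_natCast R 6, ← Real.rpow_neg hR.le,
      ← Real.rpow_add hR, ← Real.rpow_add hR]
    congr 1; push_cast; ring
  have st : ∫ y in ann n R, u y ^ p ≤ ∫ x, u x ^ p * ψ x := by
    have : ∫ y in ann n R, u y ^ p = ∫ y in ann n R, u y ^ p * ψ y := by
      refine setIntegral_congr_fun (ann_compact n R).isClosed.measurableSet fun y hy => ?_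
      have : ψ y = 1 := by
        show cutE (R⁻¹ • y) ^ (n+6) = 1
        rw [cutE_one, one_pow]
        · rw [nrm, le_div_iff₀ hR]; linarith [hy.1]
        · rw [nrm, div_le_iff₀ hR]; exact hy.2
      simp [this]
    rw [this]
    refine setIntegral_le_integral i2 (Eventually.of_forall fun x => ?_)
    show 0 ≤ u x ^ p * ψ x
    by_cases hx : x = 0
    · rw [hx, ψ0]; simp
    · exact mul_nonneg (Real.rpow_nonneg (S.upos x hx).le _) (pow_nonneg (cutE_nonneg _) _)
  refine st.trans ?_
  rw [vol] at fin2
  have key : (4*R)^n * ww * K = C1 * 4^n * ww * R ^ a := by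
    simp only [K]; rw [mul_pow]; linear_combination C1 * 4^n * ww * RR
  rw [key] at fin2
  rw [show 2 / c * (C1 * 4^n * ww) * R ^ a = (C1 * 4^n * ww * R ^ a) / (c/2) by field_simp,
    le_div_iff₀ (by positivity)]
  linarith

end

section
open Filter Topology MeasureTheory
open scoped ContDiff

lemma SolU.ann_u {n a p c u} (S : SolU n a p c u) : ∃ C, 0 ≤ C ∧ ∀ R, 0 < R →
    ∫ y in ann n R, u y ≤ C * R ^ (a+6) := by
  obtain ⟨C, hC, h⟩ := S.ann_p
  set ww : ℝ := volume.real (Metric.closedBall (0:EuclideanSpace ℝ (Fin n)) 1)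
  refine ⟨2^n * ww + C, by positivity, fun R hR => ?_⟩
  have hm : MeasurableSet (ann n R) := (ann_compact n R).isClosed.measurableSet
  have i1 : IntegrableOn u (ann n R) := (S.cont.mono (ann_ne hR)).integrableOn_compact (ann_compact n R)
  have i2 : IntegrableOn (fun y => u y ^ p) (ann n R) :=
    (S.contp.mono (ann_ne hR)).integrableOn_compact (ann_compact n R)
  have i3 : IntegrableOn (fun _ => R ^ (-a)) (ann n R) :=
    integrableOn_const (ann_compact n R).measure_lt_top.ne
  have pt : ∀ y ∈ ann n R, u y ≤ R ^ (-a) + R^6 * u y ^ p := by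
    intro y hy
    have uy := S.upos y (ann_ne hR hy)
    set X := R ^ a * u y
    have X0 : 0 ≤ X := by positivity
    have hX : X ≤ 1 + X ^ p := by
      by_cases h1 : X ≤ 1
      · have : 0 ≤ X ^ p := by positivity
        linarith
      · push Not at h1
        have := Real.self_le_rpow_of_one_le h1.le S.p1.le
        linarith
    have Ra : R ^ (-a) * R ^ a = 1 := by rw [← Real.rpow_add hR]; simp
    have Xp : X ^ p = R ^ a * R ^ 6 * u y ^ p := by
      rw [Real.mul_rpow (by positivity) uy.le, ← Real.rpow_mul hR.le, mul_comm a p, S.hp, Real.rpow_add hR,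
        show (6:ℝ) = ((6:ℕ):ℝ) by norm_num, Real.rpow_natCast]
    rw [Xp] at hX
    have := mul_le_mul_of_nonneg_left hX (show 0 ≤ R ^ (-a) by positivity)
    have e1 : R ^ (-a) * X = u y := by simp only [X]; linear_combination u y * Ra
    have e2 : R ^ (-a) * (1 + R ^ a * R ^ 6 * u y ^ p) = R ^ (-a) + R^6 * u y ^ p := by
      linear_combination R^6 * u y ^ p * Ra
    rw [e1, e2] at this
    exact this
  have h1 := setIntegral_mono_on i1 (i3.add (i2.const_mul (R^6))) hm pt
  have h2 : ∫ y in ann n R, (R ^ (-a) + R^6 * u y ^ p) =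
      volume.real (ann n R) * R ^ (-a) + R^6 * ∫ y in ann n R, u y ^ p := by
    rw [integral_add i3 (i2.const_mul _), integral_const_mul, setIntegral_const, smul_eq_mul]
  have vol : volume.real (ann n R) ≤ (2*R)^n * ww := by
    have : volume.real (Metric.closedBall (0:EuclideanSpace ℝ (Fin n)) (2*R)) = (2*R)^n * ww := by
      rw [Measure.addHaar_real_closedBall' _ _ (by positivity)]; simp [ww]
    rw [← this]
    refine measureReal_mono (fun y hy => by simpa using hy.2) measure_closedBall_lt_top.ne
  have RR : R^n * R ^ (-a) = R ^ (a+6) := by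
    rw [← Real.rpow_natCast R n, S.na, ← Real.rpow_add hR]
    congr 1; ring
  have R6 : R^6 * R ^ a = R ^ (a+6) := by
    rw [Real.rpow_add hR, show (6:ℝ) = ((6:ℕ):ℝ) by norm_num, Real.rpow_natCast]; ring
  have h3 : ∫ y in ann n R, u y ≤ volume.real (ann n R) * R ^ (-a) + R^6 * ∫ y in ann n R, u y ^ p := by
    rw [← h2]; exact h1
  refine h3.trans ?_
  have h4 := mul_le_mul_of_nonneg_right vol (show 0 ≤ R ^ (-a) by positivity)
  have h5 := mul_le_mul_of_nonneg_left (h R hR) (show 0 ≤ R ^ 6 by positivity)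
  rw [mul_pow] at h4
  have e4 : 2^n * R^n * ww * R ^ (-a) = 2^n * ww * R ^ (a+6) := by linear_combination 2^n * ww * RR
  have e5 : R^6 * (C * R ^ a) = C * R ^ (a+6) := by linear_combination C * R6
  linarith

lemma aesm_of_cont {n : ℕ} (hn : 7 ≤ n) {g : EuclideanSpace ℝ (Fin n) → ℝ} (hg : ContinuousOn g {0}ᶜ) :
    AEStronglyMeasurable g := by
  have : Nonempty (Fin n) := ⟨⟨0, by omega⟩⟩
  have h := hg.aestronglyMeasurable (μ := volume) (measurableSet_singleton _).compl
  rwa [restrict_compl_singleton] at h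

lemma ann_min {n : ℕ} {g w : EuclideanSpace ℝ (Fin n) → ℝ} (hg : ContinuousOn g {0}ᶜ)
    (hw : ContinuousOn w {0}ᶜ) (g0 : ∀ y ≠ 0, 0 ≤ g y) {C s t : ℝ} (ht : 0 ≤ t)
    (hw0 : ∀ y ≠ 0, 0 ≤ w y) (hwt : ∀ y ≠ 0, w y ≤ ‖y‖ ^ (-t))
    (h : ∀ R, 0 < R → ∫ y in ann n R, g y ≤ C * R ^ s) {R : ℝ} (hR : 0 < R) :
    IntegrableOn (fun y => g y * w y) (ann n R) ∧ ∫ y in ann n R, ‖g y * w y‖ ≤ C * R ^ (s - t) := by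
  have hm : MeasurableSet (ann n R) := (ann_compact n R).isClosed.measurableSet
  have i1 : IntegrableOn (fun y => g y * w y) (ann n R) :=
    ((hg.mul hw).mono (ann_ne hR)).integrableOn_compact (ann_compact n R)
  have i2 : IntegrableOn g (ann n R) := (hg.mono (ann_ne hR)).integrableOn_compact (ann_compact n R)
  refine ⟨i1, ?_⟩
  have : ∫ y in ann n R, ‖g y * w y‖ ≤ ∫ y in ann n R, g y * R ^ (-t) := by
    refine setIntegral_mono_on i1.norm (i2.mul_const _) hm fun y hy => ?_
    have y0 := ann_ne hR hy
    rw [Real.norm_of_nonneg (mul_nonneg (g0 y y0) (hw0 y y0))]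
    refine mul_le_mul_of_nonneg_left ((hwt y y0).trans ?_) (g0 y y0)
    exact Real.rpow_le_rpow_of_nonpos hR hy.1 (by linarith)
  refine this.trans ?_
  rw [integral_mul_const, sub_eq_add_neg, Real.rpow_add hR, ← mul_assoc]
  exact mul_le_mul_of_nonneg_right (h R hR) (by positivity)

lemma dyadic {n : ℕ} (hn : 7 ≤ n) {g : EuclideanSpace ℝ (Fin n) → ℝ} (hg : ContinuousOn g {0}ᶜ)
    (g0 : ∀ y ≠ 0, 0 ≤ g y) {C s t1 t2 : ℝ} (ht1 : 0 ≤ t1) (h1 : t1 < s) (h2 : s < t2)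
    (h : ∀ R, 0 < R → ∫ y in ann n R, g y ≤ C * R ^ s) :
    Integrable (fun y => g y * min (‖y‖ ^ (-t1)) (‖y‖ ^ (-t2))) := by
  set w : EuclideanSpace ℝ (Fin n) → ℝ := fun y => min (‖y‖ ^ (-t1)) (‖y‖ ^ (-t2)) with hw
  have cw : ContinuousOn w {0}ᶜ := by
    have k (t : ℝ) : ContinuousOn (fun y : EuclideanSpace ℝ (Fin n) => ‖y‖ ^ (-t)) {0}ᶜ :=
      continuous_norm.continuousOn.rpow_const (fun y hy => Or.inl (norm_ne_zero_iff.2 hy))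
    exact ContinuousOn.inf (k t1) (k t2)
  have w0 : ∀ y ≠ 0, 0 ≤ w y := fun y _ => by positivity
  have A1 : IntegrableOn (fun y => g y * w y) (⋃ k : ℕ, ann n (2^k)) := by
    refine integrableOn_iUnion_of_summable_integral_norm
      (fun k => (ann_min hg cw g0 (t := t2) (by linarith) w0 (fun y _ => min_le_right _ _) h
        (by positivity)).1) ?_
    refine Summable.of_nonneg_of_le (fun k => integral_nonneg fun _ => norm_nonneg _)
      (fun k => (ann_min hg cw g0 (t := t2) (by linarith) w0 (fun y _ => min_le_right _ _) h
        (by positivity)).2) ?_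
    refine Summable.mul_left _ ?_
    have : (fun k : ℕ => ((2:ℝ)^k) ^ (s - t2)) = fun k => ((2:ℝ)^(s-t2))^k := by
      funext k
      rw [← Real.rpow_natCast, ← Real.rpow_mul (by norm_num), ← Real.rpow_natCast, ← Real.rpow_mul (by norm_num), mul_comm]
    rw [this]
    exact summable_geometric_of_lt_one (by positivity) (Real.rpow_lt_one_of_one_lt_of_neg (by norm_num) (by linarith))
  have A2 : IntegrableOn (fun y => g y * w y) (⋃ k : ℕ, ann n ((1/2)^k)) := by
    refine integrableOn_iUnion_of_summable_integral_norm
      (fun k => (ann_min hg cw g0 (t := t1) (by linarith) w0 (fun y _ => min_le_left _ _) h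
        (by positivity)).1) ?_
    refine Summable.of_nonneg_of_le (fun k => integral_nonneg fun _ => norm_nonneg _)
      (fun k => (ann_min hg cw g0 (t := t1) (by linarith) w0 (fun y _ => min_le_left _ _) h
        (by positivity)).2) ?_
    refine Summable.mul_left _ ?_
    have : (fun k : ℕ => (((1/2:ℝ))^k) ^ (s - t1)) = fun k => ((1/2:ℝ)^(s-t1))^k := by
      funext k
      rw [← Real.rpow_natCast, ← Real.rpow_mul (by norm_num), ← Real.rpow_natCast, ← Real.rpow_mul (by norm_num), mul_comm]
    rw [this]
    exact summable_geometric_of_lt_one (by positivity) (Real.rpow_lt_one (by norm_num) (by norm_num) (by linarith))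
  have A3 := A1.union A2
  have : Nonempty (Fin n) := ⟨⟨0, by omega⟩⟩
  rw [← integrableOn_univ]
  have A4 : IntegrableOn (fun y => g y * w y) {0}ᶜ := by
    refine A3.mono_set fun y hy => ?_
    have hy0 : 0 < ‖y‖ := norm_pos_iff.2 hy
    by_cases h1 : 1 ≤ ‖y‖
    · left
      obtain ⟨k, hk1, hk2⟩ := exists_nat_pow_near h1 (show (1:ℝ) < 2 by norm_num)
      exact Set.mem_iUnion.2 ⟨k, hk1, by rw [pow_succ] at hk2; linarith⟩
    · right
      push Not at h1
      obtain ⟨k, hk1, hk2⟩ := exists_nat_pow_near_of_lt_one hy0 h1.le (show (0:ℝ) < 1/2 by norm_num) (by norm_num)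
      exact Set.mem_iUnion.2 ⟨k+1, hk1.le, by rw [pow_succ]; linarith⟩
  rwa [IntegrableOn, restrict_compl_singleton, ← integrableOn_univ] at A4

lemma SolU.int_u {n a p c u} (S : SolU n a p c u) :
    Integrable (fun y => u y * min (‖y‖ ^ (-(6:ℝ))) (‖y‖ ^ (-(n:ℝ)))) := by
  obtain ⟨C, _, h⟩ := S.ann_u
  have := S.ha
  exact dyadic S.hn S.cont (fun y hy => (S.upos y hy).le) (by norm_num) (by linarith) (by rw [S.na]; linarith) h

lemma SolU.int_p {n a p c u} (S : SolU n a p c u) :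
    Integrable (fun y => u y ^ p * min (‖y‖ ^ (-(0:ℝ))) (‖y‖ ^ (-(2*a)))) := by
  obtain ⟨C, _, h⟩ := S.ann_p
  have := S.ha
  exact dyadic S.hn S.contp (fun y hy => Real.rpow_nonneg (S.upos y hy).le _) le_rfl (by linarith) (by linarith) h

end

section
open Filter Topology MeasureTheory
open scoped ContDiff

lemma rho_pos {n : ℕ} {e : ℝ} (he : 0 < e) (x y : EuclideanSpace ℝ (Fin n)) : 0 < e^2 + ‖y - x‖^2 := by
  positivity

lemma rho_bound {n : ℕ} {e : ℝ} (he : 0 < e) (x : EuclideanSpace ℝ (Fin n)) {s1 s2 : ℝ} (h1 : 0 ≤ s1)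
    (h2 : 0 ≤ s2) : ∃ C, 0 ≤ C ∧ ∀ y : EuclideanSpace ℝ (Fin n), y ≠ 0 →
      (e^2 + ‖y - x‖^2) ^ (-(s1+s2)) ≤ C * min (‖y‖ ^ (-(2*s1))) (‖y‖ ^ (-(2*s2))) := by
  set k : ℝ := (2 + 2 * ‖x‖^2 / e^2)⁻¹ with hk
  have k0 : 0 < k := by positivity
  have main (s1 s2 : ℝ) (h1 : 0 ≤ s1) (h2 : 0 ≤ s2) : ∀ y : EuclideanSpace ℝ (Fin n), y ≠ 0 →
      (e^2 + ‖y - x‖^2) ^ (-(s1+s2)) ≤ (k ^ (-s1) * (e^2) ^ (-s2)) * ‖y‖ ^ (-(2*s1)) := by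
    intro y hy
    have hy0 : 0 < ‖y‖ := norm_pos_iff.2 hy
    have r0 := rho_pos he x y
    have r1 : k * ‖y‖^2 ≤ e^2 + ‖y - x‖^2 := by
      rw [hk, inv_mul_le_iff₀ (by positivity)]
      have t : ‖y‖ ≤ ‖y - x‖ + ‖x‖ := by simpa using norm_add_le (y - x) x
      have t2 : ‖y‖^2 ≤ 2 * ‖y-x‖^2 + 2 * ‖x‖^2 := by
        nlinarith [sq_nonneg (‖y-x‖ - ‖x‖), norm_nonneg y, norm_nonneg x, norm_nonneg (y-x)]
      have : (2 + 2 * ‖x‖^2 / e^2) * (e^2 + ‖y-x‖^2) =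
          2 * e^2 + 2 * ‖y-x‖^2 + 2 * ‖x‖^2 + 2 * ‖x‖^2 / e^2 * ‖y-x‖^2 := by
        field_simp; ring
      rw [this]
      have : 0 ≤ 2 * ‖x‖^2 / e^2 * ‖y-x‖^2 := by positivity
      nlinarith
    have r2 : e^2 ≤ e^2 + ‖y - x‖^2 := by nlinarith [sq_nonneg ‖y-x‖]
    have q1 := Real.rpow_le_rpow_of_nonpos (z := -s1) (by positivity) r1 (by linarith)
    have q2 := Real.rpow_le_rpow_of_nonpos (z := -s2) (by positivity) r2 (by linarith)
    rw [neg_add, Real.rpow_add r0]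
    have q3 : (k * ‖y‖^2) ^ (-s1) = k ^ (-s1) * ‖y‖ ^ (-(2*s1)) := by
      rw [Real.mul_rpow k0.le (by positivity), ← Real.rpow_natCast, ← Real.rpow_mul hy0.le]
      congr 2; push_cast; ring
    rw [q3] at q1
    calc _ ≤ (k ^ (-s1) * ‖y‖ ^ (-(2*s1))) * (e^2) ^ (-s2) := by gcongr
      _ = _ := by ring
  refine ⟨max (k ^ (-s1) * (e^2) ^ (-s2)) (k ^ (-s2) * (e^2) ^ (-s1)), by positivity, fun y hy => ?_⟩
  rw [mul_min_of_nonneg _ _ (by positivity)]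
  refine le_min ?_ ?_
  · refine (main s1 s2 h1 h2 y hy).trans ?_
    gcongr; exact le_max_left _ _
  · have := main s2 s1 h2 h1 y hy
    rw [add_comm s2 s1] at this
    refine this.trans ?_
    gcongr; exact le_max_right _ _

lemma rho_smooth {n : ℕ} {e : ℝ} (he : 0 < e) (x : EuclideanSpace ℝ (Fin n)) (s : ℝ) :
    ContDiff ℝ ∞ (fun y : EuclideanSpace ℝ (Fin n) => (e^2 + ‖y - x‖^2) ^ s) := by
  have h : ContDiff ℝ ∞ (fun y : EuclideanSpace ℝ (Fin n) => e^2 + ‖y - x‖^2) :=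
    contDiff_const.add ((contDiff_id.sub contDiff_const).norm_sq ℝ)
  exact h.rpow_const_of_ne (fun y => (rho_pos he x y).ne')

lemma lap_rho {n : ℕ} {e : ℝ} (he : 0 < e) (x : EuclideanSpace ℝ (Fin n)) (s : ℝ) (y) :
    lap (fun y : EuclideanSpace ℝ (Fin n) => (e^2 + ‖y - x‖^2) ^ (-s)) y =
     2*s*(2*s+2-n) * (e^2 + ‖y - x‖^2) ^ (-(s+1)) - 4*s*(s+1)*e^2 * (e^2 + ‖y - x‖^2) ^ (-(s+2)) := by
  have r0 := rho_pos he x y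
  have d (t : ℝ) (σ : ℝ) (hs : 0 < e^2 + σ) :
      HasDerivAt (fun σ => (e^2 + σ) ^ t) (t * (e^2 + σ) ^ (t-1)) σ := by
    have := ((hasDerivAt_id σ).const_add (e^2)).rpow_const (p := t) (Or.inl hs.ne')
    exact this.congr_deriv (by simp)
  have h := lap_rad (n := n) (H := fun σ => (e^2 + σ) ^ (-s)) (H1 := fun σ => -s * (e^2 + σ) ^ (-s-1))
    (h2 := -s * ((-s-1) * (e^2 + ‖y-x‖^2) ^ (-s-1-1))) (x0 := x) (x := y)
    (by
      have : ∀ᶠ σ in 𝓝 (‖y-x‖^2), 0 < e^2 + σ :=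
        (continuous_const.add continuous_id).continuousAt.eventually (lt_mem_nhds r0)
      filter_upwards [this] with σ hσ
      exact d _ _ hσ)
    ((d _ _ r0).const_mul _)
  rw [h]
  have e1 : (e^2 + ‖y-x‖^2) ^ (-(s+1)) = (e^2 + ‖y-x‖^2) * (e^2 + ‖y-x‖^2) ^ (-(s+2)) := by
    nth_rw 2 [← Real.rpow_one (e^2 + ‖y-x‖^2)]
    rw [← Real.rpow_add r0]
    congr 1; ring
  rw [show -s - 1 - 1 = -(s+2) by ring, show -s-1 = -(s+1) by ring, e1]
  ring

lemma lap3_rho {n : ℕ} {a e : ℝ} (hna : (n:ℝ) = 2*a+6) (he : 0 < e) (x : EuclideanSpace ℝ (Fin n)) :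
    lap (lap (lap (fun y : EuclideanSpace ℝ (Fin n) => (e^2 + ‖y - x‖^2) ^ (-a)))) =
    fun y => -(64*a*(a+1)*(a+2)*(a+3)*(a+4)*(a+5)) * (e^6 * (e^2 + ‖y - x‖^2) ^ (-(a+6))) := by
  have sm (k s : ℝ) (y) : ContDiffAt ℝ 2 (fun y : EuclideanSpace ℝ (Fin n) => k * (e^2 + ‖y - x‖^2) ^ s) y :=
    (contDiffAt_const.mul (rho_smooth he x s).contDiffAt).of_le ((by norm_num : (2:WithTop ℕ∞) ≤ 6).trans six_le)
  have A1 : lap (fun y : EuclideanSpace ℝ (Fin n) => (e^2 + ‖y - x‖^2) ^ (-a)) =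
      fun y => (-8*a) * (e^2 + ‖y - x‖^2) ^ (-(a+1)) + (-4*a*(a+1)*e^2) * (e^2 + ‖y - x‖^2) ^ (-(a+2)) := by
    funext y
    rw [lap_rho he, hna]; ring
  have A2 : lap (fun y : EuclideanSpace ℝ (Fin n) => (-8*a) * (e^2 + ‖y - x‖^2) ^ (-(a+1)) +
      (-4*a*(a+1)*e^2) * (e^2 + ‖y - x‖^2) ^ (-(a+2))) =
      fun y => (32*a*(a+1)) * (e^2 + ‖y - x‖^2) ^ (-(a+2)) +
        ((32*a*(a+1)*(a+2)*e^2) * (e^2 + ‖y - x‖^2) ^ (-(a+3))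
        + (16*a*(a+1)*(a+2)*(a+3)*e^4) * (e^2 + ‖y - x‖^2) ^ (-(a+4))) := by
    funext y
    rw [lap_add (sm _ _ _) (sm _ _ _), lap_const_mul, lap_const_mul]
    beta_reduce
    rw [lap_rho he, lap_rho he, hna, show a+1+1=a+2 by ring, show a+1+2=a+3 by ring,
      show a+2+1=a+3 by ring, show a+2+2=a+4 by ring]
    ring
  rw [A1, A2]
  funext y
  rw [lap_add (sm _ _ _) ((sm _ _ _).add (sm _ _ _)), lap_add (sm _ _ _) (sm _ _ _), lap_const_mul,
    lap_const_mul, lap_const_mul]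
  beta_reduce
  rw [lap_rho he, lap_rho he, lap_rho he, hna, show a+2+1=a+3 by ring, show a+2+2=a+4 by ring,
    show a+3+1=a+4 by ring, show a+3+2=a+5 by ring, show a+4+1=a+5 by ring, show a+4+2=a+6 by ring]
  ring

/-- partial Laplacian in the second variable -/
def plap {n : ℕ} (G : ℝ × EuclideanSpace ℝ (Fin n) → ℝ) (q : ℝ × EuclideanSpace ℝ (Fin n)) : ℝ :=
  ∑ i : Fin n, fderiv ℝ (fun q => fderiv ℝ G q (0, EuclideanSpace.single i 1)) q
    (0, EuclideanSpace.single i 1)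

lemma plap_smooth {n : ℕ} {G : ℝ × EuclideanSpace ℝ (Fin n) → ℝ} (hG : ContDiff ℝ ∞ G) :
    ContDiff ℝ ∞ (plap G) := by
  unfold plap
  refine ContDiff.sum fun i _ => ?_
  have h1 : ContDiff ℝ ∞ (fun q => fderiv ℝ G q (0, EuclideanSpace.single i 1)) :=
    (hG.fderiv_right (by simp)).clm_apply contDiff_const
  exact (h1.fderiv_right (by simp)).clm_apply contDiff_const

lemma fderiv_slice {n : ℕ} {G : ℝ × EuclideanSpace ℝ (Fin n) → ℝ} (hG : ContDiff ℝ ∞ G) (t : ℝ) (z v) :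
    fderiv ℝ (fun z => G (t, z)) z v = fderiv ℝ G (t, z) (0, v) := by
  have h1 : HasFDerivAt (fun z : EuclideanSpace ℝ (Fin n) => (t, z))
      (ContinuousLinearMap.inr ℝ ℝ (EuclideanSpace ℝ (Fin n))) z := hasFDerivAt_prodMk_right t z
  have h2 := (hG.differentiable (by simp) (t, z)).hasFDerivAt
  have h3 := (HasFDerivAt.comp z h2 h1).fderiv
  rw [show (fun z => G (t, z)) = G ∘ (fun z => (t, z)) from rfl, h3]
  simp

lemma lap_slice {n : ℕ} {G : ℝ × EuclideanSpace ℝ (Fin n) → ℝ} (hG : ContDiff ℝ ∞ G) (t : ℝ) :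
    lap (fun z => G (t, z)) = fun z => plap G (t, z) := by
  funext z
  unfold lap plap
  refine Finset.sum_congr rfl fun i _ => ?_
  have h1 : ContDiff ℝ ∞ (fun q => fderiv ℝ G q (0, EuclideanSpace.single i 1)) :=
    (hG.fderiv_right (by simp)).clm_apply contDiff_const
  simp_rw [fderiv_slice hG]
  exact fderiv_slice h1 t z _

lemma lap3_slice_bound {n : ℕ} {G : ℝ × EuclideanSpace ℝ (Fin n) → ℝ} (hG : ContDiff ℝ ∞ G) (r : ℝ) :
    ∃ C, 0 ≤ C ∧ ∀ t, 0 ≤ t → t ≤ 1 → ∀ z, ‖z‖ ≤ r → |lap (lap (lap (fun z => G (t, z)))) z| ≤ C := by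
  have hc : IsCompact (Set.Icc (0:ℝ) 1 ×ˢ Metric.closedBall (0:EuclideanSpace ℝ (Fin n)) r) :=
    isCompact_Icc.prod (isCompact_closedBall _ _)
  obtain ⟨C, hC⟩ := hc.exists_bound_of_continuousOn (f := plap (plap (plap G)))
    (plap_smooth (plap_smooth (plap_smooth hG))).continuous.continuousOn
  refine ⟨max C 0, le_max_right _ _, fun t h0 h1 z hz => ?_⟩
  rw [lap_slice hG, lap_slice (plap_smooth hG), lap_slice (plap_smooth (plap_smooth hG))]
  exact (hC (t, z) ⟨⟨h0, h1⟩, by simpa using hz⟩).trans (le_max_left _ _)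

def G1 {n : ℕ} (a e : ℝ) (x : EuclideanSpace ℝ (Fin n)) (q : ℝ × EuclideanSpace ℝ (Fin n)) : ℝ :=
  cutA q.2 * (e^2 + ‖q.1 • q.2 - x‖^2) ^ (-a)

def G2 {n : ℕ} (a e : ℝ) (x : EuclideanSpace ℝ (Fin n)) (q : ℝ × EuclideanSpace ℝ (Fin n)) : ℝ :=
  cutA ((2:ℝ) • q.2) * (1 - cutA q.2) * ((e*q.1)^2 + ‖q.2 - q.1 • x‖^2) ^ (-a)

lemma G1_smooth {n : ℕ} {a e : ℝ} (he : 0 < e) (x : EuclideanSpace ℝ (Fin n)) : ContDiff ℝ ∞ (G1 a e x) := by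
  unfold G1
  refine (cutA_smooth.comp contDiff_snd).mul ?_
  have h : ContDiff ℝ ∞ (fun q : ℝ × EuclideanSpace ℝ (Fin n) => e^2 + ‖q.1 • q.2 - x‖^2) :=
    contDiff_const.add (((contDiff_fst.smul contDiff_snd).sub contDiff_const).norm_sq ℝ)
  exact h.rpow_const_of_ne (fun q => (by positivity : (0:ℝ) < e^2 + ‖q.1 • q.2 - x‖^2).ne')

lemma G2_smooth {n : ℕ} {a e : ℝ} (he : 0 < e) (x : EuclideanSpace ℝ (Fin n)) : ContDiff ℝ ∞ (G2 a e x) := by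
  rw [contDiff_iff_contDiffAt]
  intro q
  by_cases hq : q.2 = 0
  · have : G2 a e x =ᶠ[𝓝 q] fun _ => 0 := by
      have : ∀ᶠ q' : ℝ × EuclideanSpace ℝ (Fin n) in 𝓝 q, ‖q'.2‖ < 1/2 :=
        (continuous_snd.norm).continuousAt.eventually (gt_mem_nhds (by show ‖q.2‖ < 1/2; rw [hq]; norm_num))
      filter_upwards [this] with q' h
      unfold G2
      rw [cutA_zero (by rw [norm_smul]; norm_num; linarith)]; simp
    exact contDiffAt_const.congr_of_eventuallyEq this
  · unfold G2
    have h1 : ContDiff ℝ ∞ (fun q : ℝ × EuclideanSpace ℝ (Fin n) => cutA ((2:ℝ) • q.2) * (1 - cutA q.2)) :=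
      (cutA_smooth.comp ((contDiff_const_smul (2:ℝ)).comp contDiff_snd)).mul
        (contDiff_const.sub (cutA_smooth.comp contDiff_snd))
    have h2 : ContDiff ℝ ∞ (fun q : ℝ × EuclideanSpace ℝ (Fin n) => (e*q.1)^2 + ‖q.2 - q.1 • x‖^2) :=
      ((contDiff_const.mul contDiff_fst).pow 2).add ((contDiff_snd.sub (contDiff_fst.smul contDiff_const)).norm_sq ℝ)
    refine h1.contDiffAt.mul (h2.contDiffAt.rpow_const_of_ne ?_)
    intro h0
    have t1 : (e*q.1)^2 = 0 := by nlinarith [sq_nonneg (e*q.1), sq_nonneg ‖q.2 - q.1 • x‖]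
    have t2 : ‖q.2 - q.1 • x‖^2 = 0 := by nlinarith [sq_nonneg (e*q.1), sq_nonneg ‖q.2 - q.1 • x‖]
    have t3 : q.1 = 0 := by simpa [he.ne'] using t1
    rw [t3] at t2
    simp at t2
    exact hq t2

end

section
open Filter Topology MeasureTheory
open scoped ContDiff

def TF {n : ℕ} (a e : ℝ) (x : EuclideanSpace ℝ (Fin n)) (d : ℝ) (y : EuclideanSpace ℝ (Fin n)) : ℝ :=
  cutA (d⁻¹ • y) * (1 - cutA (d • y)) * (e^2 + ‖y - x‖^2) ^ (-a)

lemma TF_smooth {n : ℕ} {a e : ℝ} (he : 0 < e) (x : EuclideanSpace ℝ (Fin n)) (d : ℝ) :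
    ContDiff ℝ ∞ (TF a e x d) := by
  unfold TF
  exact ((cutA_smooth.comp (contDiff_const_smul (d⁻¹))).mul
    (contDiff_const.sub (cutA_smooth.comp (contDiff_const_smul d)))).mul (rho_smooth he x _)

lemma TF_supp {n : ℕ} {a e : ℝ} (x : EuclideanSpace ℝ (Fin n)) {d : ℝ} (hd : 0 < d) :
    tsupport (TF a e x d) ⊆ {y | d ≤ ‖y‖ ∧ ‖y‖ ≤ 2 / d} := by
  refine closure_minimal (fun y hy => ?_) ((isClosed_le continuous_const continuous_norm).inter
    (isClosed_le continuous_norm continuous_const))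
  by_contra h
  refine hy ?_
  have h' : ¬ (d ≤ ‖y‖ ∧ ‖y‖ ≤ 2 / d) := h
  rw [not_and_or, not_le, not_le] at h'
  unfold TF
  rcases h' with h' | h'
  · rw [cutA_zero (z := d⁻¹ • y)]; · simp
    rw [norm_smul, Real.norm_of_nonneg (by positivity), inv_mul_le_iff₀ hd]; linarith
  · rw [cutA_one (z := d • y)]; · simp
    rw [norm_smul, Real.norm_of_nonneg (by positivity)]
    rw [div_lt_iff₀ hd] at h'
    nlinarith

lemma TF_nhds1 {n : ℕ} {a e : ℝ} (x : EuclideanSpace ℝ (Fin n)) {d : ℝ} (hd : 0 < d) {y}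
    (hy : ‖y‖ < 1 / d) : TF a e x d =ᶠ[𝓝 y] fun y => 1 * (fun z => G1 a e x (d, z)) (d⁻¹ • y) := by
  filter_upwards [continuous_norm.continuousAt.eventually (gt_mem_nhds hy)] with z hz
  unfold TF G1
  have : cutA (d • z) = 0 := cutA_zero (by
    rw [norm_smul, Real.norm_of_nonneg (by positivity)]; rw [lt_div_iff₀ hd] at hz; linarith)
  rw [this]
  simp [smul_smul, hd.ne']

lemma TF_nhds2 {n : ℕ} {a e : ℝ} (x : EuclideanSpace ℝ (Fin n)) {d : ℝ} (hd : 0 < d) {y}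
    (hy : ‖y‖ < 1 / d) (hy2 : 3 / 2 * d < ‖y‖) :
    TF a e x d =ᶠ[𝓝 y] fun y => (e^2 + ‖y - x‖^2) ^ (-a) := by
  filter_upwards [continuous_norm.continuousAt.eventually (gt_mem_nhds hy),
    continuous_norm.continuousAt.eventually (lt_mem_nhds hy2)] with z hz hz2
  unfold TF
  have h1 : cutA (d • z) = 0 := cutA_zero (by
    rw [norm_smul, Real.norm_of_nonneg (by positivity)]; rw [lt_div_iff₀ hd] at hz; linarith)
  have h2 : cutA (d⁻¹ • z) = 1 := cutA_one (by
    have : 3/2 ≤ ‖d⁻¹ • z‖ := by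
      rw [norm_smul, Real.norm_of_nonneg (by positivity), inv_mul_eq_div, le_div_iff₀ hd]; linarith
    nlinarith)
  rw [h1, h2]
  simp

lemma TF_nhds3 {n : ℕ} {a e : ℝ} (x : EuclideanSpace ℝ (Fin n)) {d : ℝ} (hd : 0 < d) {y}
    (hy : 3 / 4 < ‖y‖ * d) (hy2 : 3 / 2 * d < ‖y‖) :
    TF a e x d =ᶠ[𝓝 y] fun y => d ^ (2*a) * (fun z => G2 a e x (d, z)) (d • y) := by
  have hc : Continuous fun y : EuclideanSpace ℝ (Fin n) => ‖y‖ * d := by fun_prop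
  filter_upwards [hc.continuousAt.eventually (lt_mem_nhds hy),
    continuous_norm.continuousAt.eventually (lt_mem_nhds hy2)] with z hz hz2
  unfold TF G2
  have nz : ‖d • z‖ = ‖z‖ * d := by rw [norm_smul, Real.norm_of_nonneg (by positivity), mul_comm]
  have h1 : cutA ((2:ℝ) • (d • z)) = 1 := cutA_one (by
    rw [norm_smul, nz]; norm_num; nlinarith)
  have h2 : cutA (d⁻¹ • z) = 1 := cutA_one (by
    have : 3/2 ≤ ‖d⁻¹ • z‖ := by
      rw [norm_smul, Real.norm_of_nonneg (by positivity), inv_mul_eq_div, le_div_iff₀ hd]; linarith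
    nlinarith)
  have h3 : (e*d)^2 + ‖d • z - d • x‖^2 = d^2 * (e^2 + ‖z - x‖^2) := by
    rw [← smul_sub, norm_smul, Real.norm_of_nonneg hd.le]; ring
  beta_reduce
  rw [h1, h2, h3, Real.mul_rpow (by positivity) (by positivity), ← Real.rpow_natCast d 2, ← Real.rpow_mul hd.le]
  have h4 : d ^ (2*a) * d ^ (((2:ℕ):ℝ) * -a) = 1 := by
    rw [← Real.rpow_add hd]; push_cast; simp
  linear_combination -((1 - cutA (d • z)) * (e^2 + ‖z-x‖^2) ^ (-a)) * h4

lemma lap3_congr {n : ℕ} {f g : EuclideanSpace ℝ (Fin n) → ℝ} {y} (h : f =ᶠ[𝓝 y] g) :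
    lap (lap (lap f)) y = lap (lap (lap g)) y := lap_congr (lap_congr' (lap_congr' h))

lemma TF_bound {n : ℕ} {a e : ℝ} (hna : (n:ℝ) = 2*a+6) (ha : 1/2 ≤ a) (he : 0 < e)
    (x : EuclideanSpace ℝ (Fin n)) : ∃ C, 0 ≤ C ∧ ∀ d, 0 < d → d ≤ 1/4 → ∀ y ≠ 0,
      |lap (lap (lap (TF a e x d))) y| ≤ C * min (‖y‖ ^ (-(6:ℝ))) (‖y‖ ^ (-(n:ℝ))) := by
  obtain ⟨C1, hC1, h1⟩ := lap3_slice_bound (G1_smooth (a := a) he x) 2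
  obtain ⟨C2, hC2, h2⟩ := lap3_slice_bound (G2_smooth (a := a) he x) 2
  obtain ⟨C3, hC3, h3⟩ := rho_bound he x (s1 := 3) (s2 := a+3) (by norm_num) (by linarith)
  have np (k : ℕ) (t : ℝ) (ht : 0 < t) : t ^ (-(k:ℝ)) = (t^k)⁻¹ := by
    rw [Real.rpow_neg ht.le, Real.rpow_natCast]
  set C3' := 64*a*(a+1)*(a+2)*(a+3)*(a+4)*(a+5) * e^6 * C3 with hC3'
  have hC3p : 0 ≤ C3' := by positivity
  have hn7 : 7 ≤ n := by
    have : (7:ℝ) ≤ n := by rw [hna]; linarith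
    exact_mod_cast this
  have hM : ∀ y ≠ 0, |lap (lap (lap (fun y : EuclideanSpace ℝ (Fin n) => (e^2 + ‖y - x‖^2) ^ (-a)))) y| ≤
      C3' * min (‖y‖ ^ (-(6:ℝ))) (‖y‖ ^ (-(n:ℝ))) := by
    intro y hy
    rw [lap3_rho hna he]
    have := h3 y hy
    rw [show (3:ℝ) + (a+3) = a+6 by ring, show 2*(3:ℝ) = 6 by norm_num, show 2*(a+3) = (n:ℝ) by rw [hna]; ring] at this
    have r0 := rho_pos he x y
    beta_reduce
    rw [neg_mul, abs_neg, abs_of_nonneg (by positivity), hC3']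
    calc _ = 64*a*(a+1)*(a+2)*(a+3)*(a+4)*(a+5) * e^6 * (e^2 + ‖y - x‖^2) ^ (-(a+6)) := by ring
      _ ≤ 64*a*(a+1)*(a+2)*(a+3)*(a+4)*(a+5) * e^6 * (C3 * min (‖y‖ ^ (-(6:ℝ))) (‖y‖ ^ (-(n:ℝ)))) := by
        gcongr
      _ = _ := by ring
  refine ⟨max C3' (max (C1 * 2^n) (C2 * 2^n)), by positivity, fun d hd hd4 y hy => ?_⟩
  have hy0 : 0 < ‖y‖ := norm_pos_iff.2 hy
  set m := min (‖y‖ ^ (-(6:ℝ))) (‖y‖ ^ (-(n:ℝ))) with hm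
  have m0 : 0 ≤ m := by positivity
  have fin3 {X : ℝ} (h : X ≤ C3' * m) : X ≤ max C3' (max (C1 * 2^n) (C2 * 2^n)) * m :=
    h.trans (mul_le_mul_of_nonneg_right (le_max_left _ _) m0)
  have fin1 {X : ℝ} (h : X ≤ C1 * 2^n * m) : X ≤ max C3' (max (C1 * 2^n) (C2 * 2^n)) * m :=
    h.trans (mul_le_mul_of_nonneg_right (le_max_of_le_right (le_max_left _ _)) m0)
  have fin2 {X : ℝ} (h : X ≤ C2 * 2^n * m) : X ≤ max C3' (max (C1 * 2^n) (C2 * 2^n)) * m :=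
    h.trans (mul_le_mul_of_nonneg_right (le_max_of_le_right (le_max_right _ _)) m0)
  by_cases c1 : ‖y‖ < 1 / d
  · by_cases c2 : 2 * d < ‖y‖
    · rw [lap3_congr (TF_nhds2 x hd c1 (by linarith))]
      exact fin3 (hM y hy)
    · push Not at c2
      rw [lap3_congr (TF_nhds1 x hd c1), lap3_comp_smul (fun z => G1 a e x (d, z))]
      refine fin1 ?_
      have b := h1 d hd.le (by linarith) (d⁻¹ • y) (by
        rw [norm_smul, Real.norm_of_nonneg (by positivity), inv_mul_le_iff₀ hd]; linarith)
      beta_reduce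
      rw [abs_mul, abs_of_nonneg (by positivity), one_mul]
      have k1 : (d⁻¹)^6 ≤ 2^n * m := by
        rw [hm, mul_min_of_nonneg _ _ (by positivity), show (6:ℝ) = ((6:ℕ):ℝ) by norm_num, np 6 _ hy0, np n _ hy0]
        have y1 : ‖y‖ ≤ 1 := by linarith
        refine le_min ?_ ?_
        · rw [inv_pow, ← div_eq_mul_inv, inv_eq_one_div, div_le_div_iff₀ (by positivity) (by positivity), one_mul]
          calc ‖y‖^6 ≤ (2*d)^6 := by gcongr
            _ = 2^6 * d^6 := by ring
            _ ≤ 2^n * d^6 := by gcongr <;> first | omega | norm_num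
        · rw [inv_pow, ← div_eq_mul_inv, inv_eq_one_div, div_le_div_iff₀ (by positivity) (by positivity), one_mul]
          calc ‖y‖^n ≤ ‖y‖^6 := pow_le_pow_of_le_one hy0.le y1 (by omega)
            _ ≤ (2*d)^6 := by gcongr
            _ = 2^6 * d^6 := by ring
            _ ≤ 2^n * d^6 := by gcongr <;> first | omega | norm_num
      calc _ ≤ (2^n * m) * C1 := by gcongr
        _ = _ := by ring
  · push Not at c1
    rw [div_le_iff₀ hd] at c1
    have c3 : 3 / 2 * d < ‖y‖ := by nlinarith
    by_cases c2 : ‖y‖ * d ≤ 2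
    · rw [lap3_congr (TF_nhds3 x hd (by linarith) c3), lap3_comp_smul (fun z => G2 a e x (d, z))]
      refine fin2 ?_
      have b := h2 d hd.le (by linarith) (d • y) (by
        rw [norm_smul, Real.norm_of_nonneg (by positivity)]; linarith)
      beta_reduce
      rw [abs_mul, abs_of_nonneg (by positivity)]
      have e1 : d ^ (2*a) * d^6 = d^n := by
        rw [← Real.rpow_natCast d n, hna, Real.rpow_add hd, show (6:ℝ) = ((6:ℕ):ℝ) by norm_num, Real.rpow_natCast]
      rw [e1]
      have k1 : d^n ≤ 2^n * m := by
        rw [hm, mul_min_of_nonneg _ _ (by positivity), show (6:ℝ) = ((6:ℕ):ℝ) by norm_num, np 6 _ hy0, np n _ hy0]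
        have y1 : 1 ≤ ‖y‖ := by nlinarith
        have q : d^n * ‖y‖^n ≤ 2^n := by
          rw [← mul_pow, mul_comm]; gcongr
        refine le_min ?_ ?_
        · rw [← div_eq_mul_inv, le_div_iff₀ (by positivity)]
          refine le_trans ?_ q
          gcongr <;> first | assumption | omega
        · rw [← div_eq_mul_inv, le_div_iff₀ (by positivity)]
          exact q
      calc _ ≤ (2^n * m) * C2 := by gcongr
        _ = _ := by ring
    · push Not at c2
      have : lap (lap (lap (TF a e x d))) y = 0 := by
        apply lap_eq_zero_of_notMem
        intro h
        have := (TF_supp x hd ((tsupport_lap _) ((tsupport_lap _) h))).2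
        rw [le_div_iff₀ hd] at this
        linarith
      rw [this, abs_zero]
      positivity

lemma SolU.eps_id {n a p c u} (S : SolU n a p c u) {e : ℝ} (he : 0 < e) (x : EuclideanSpace ℝ (Fin n)) :
    Integrable (fun y => u y ^ p * (e^2 + ‖y - x‖^2) ^ (-a)) ∧
    Integrable (fun y => u y * (e^6 * (e^2 + ‖y - x‖^2) ^ (-(a+6)))) ∧
    c * ∫ y, u y ^ p * (e^2 + ‖y - x‖^2) ^ (-a) =
      (64*a*(a+1)*(a+2)*(a+3)*(a+4)*(a+5)) * ∫ y, u y * (e^6 * (e^2 + ‖y - x‖^2) ^ (-(a+6))) := by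
  have ha := S.ha
  have hn := S.hn
  have hne : Nonempty (Fin n) := ⟨⟨0, by omega⟩⟩
  have ae0 : ∀ᵐ y : EuclideanSpace ℝ (Fin n), y ≠ 0 := Measure.ae_ne volume 0
  obtain ⟨C1, hC1, h1⟩ := rho_bound he x (s1 := 0) (s2 := a) le_rfl (by linarith)
  obtain ⟨C, hC, hb⟩ := TF_bound S.na ha he x
  have mp : AEStronglyMeasurable (fun y => u y ^ p) := aesm_of_cont hn S.contp
  have mu : AEStronglyMeasurable u := aesm_of_cont hn S.cont
  have I1 : Integrable (fun y => u y ^ p * (e^2 + ‖y - x‖^2) ^ (-a)) := by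
    refine (S.int_p.const_mul C1).mono' (mp.mul (rho_smooth he x _).continuous.aestronglyMeasurable) ?_
    filter_upwards [ae0] with y hy
    have r0 := rho_pos he x y
    have up : 0 ≤ u y ^ p := Real.rpow_nonneg (S.upos y hy).le _
    rw [Real.norm_of_nonneg (by positivity)]
    have := h1 y hy
    simp only [zero_add, mul_zero] at this
    calc _ ≤ u y ^ p * (C1 * min (‖y‖ ^ (-(0:ℝ))) (‖y‖ ^ (-(2*a)))) := by gcongr
      _ = _ := by ring
  have hT (d : ℝ) : ContDiff ℝ 6 (TF a e x d) := (TF_smooth he x d).of_le six_le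
  have hl (d : ℝ) : Continuous (lap (lap (lap (TF a e x d)))) := by
    have h1 : ContDiff ℝ 4 (lap (TF a e x d)) := contDiff_lap (hT d) (by norm_num)
    have h2 : ContDiff ℝ 2 (lap (lap (TF a e x d))) := contDiff_lap h1 (by norm_num)
    have h3 : ContDiff ℝ 0 (lap (lap (lap (TF a e x d)))) := contDiff_lap h2 (by norm_num)
    exact h3.continuous
  have small : ∀ᶠ d : ℝ in 𝓝[>] 0, 0 < d ∧ d ≤ 1/4 := by
    filter_upwards [Ioc_mem_nhdsGT (show (0:ℝ) < 1/4 by norm_num)] with d hd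
    exact ⟨hd.1, hd.2⟩
  have near (y : EuclideanSpace ℝ (Fin n)) (hy : y ≠ 0) : ∀ᶠ d : ℝ in 𝓝[>] 0,
      TF a e x d =ᶠ[𝓝 y] fun y => (e^2 + ‖y - x‖^2) ^ (-a) := by
    have hy0 : 0 < ‖y‖ := norm_pos_iff.2 hy
    filter_upwards [Ioo_mem_nhdsGT (show (0:ℝ) < min (‖y‖/2) (‖y‖⁻¹) by positivity)] with d hd
    have d1 := (lt_min_iff.1 hd.2).1
    have d2 := (lt_min_iff.1 hd.2).2
    refine TF_nhds2 x hd.1 ?_ (by linarith)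
    rw [lt_inv_comm₀ hd.1 hy0] at d2
    simpa using d2
  -- dominated convergence
  have D1 : Tendsto (fun d => ∫ y, u y * lap (lap (lap (TF a e x d))) y) (𝓝[>] 0)
      (𝓝 (∫ y, u y * (-(64*a*(a+1)*(a+2)*(a+3)*(a+4)*(a+5)) * (e^6 * (e^2 + ‖y - x‖^2) ^ (-(a+6)))))) := by
    refine tendsto_integral_filter_of_dominated_convergence
      (fun y => C * (u y * min (‖y‖ ^ (-(6:ℝ))) (‖y‖ ^ (-(n:ℝ))))) ?_ ?_ (S.int_u.const_mul C) ?_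
    · exact Eventually.of_forall fun d => mu.mul (hl d).aestronglyMeasurable
    · filter_upwards [small] with d hd
      filter_upwards [ae0] with y hy
      have := hb d hd.1 hd.2 y hy
      rw [norm_mul, Real.norm_of_nonneg (S.upos y hy).le, Real.norm_eq_abs]
      calc _ ≤ u y * (C * min (‖y‖ ^ (-(6:ℝ))) (‖y‖ ^ (-(n:ℝ)))) :=
            mul_le_mul_of_nonneg_left this (S.upos y hy).le
        _ = _ := by ring
    · filter_upwards [ae0] with y hy
      refine tendsto_const_nhds.congr' ?_
      filter_upwards [near y hy] with d hd
      rw [lap3_congr hd, lap3_rho S.na he]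
  have D2 : Tendsto (fun d => ∫ y, u y ^ p * TF a e x d y) (𝓝[>] 0)
      (𝓝 (∫ y, u y ^ p * (e^2 + ‖y - x‖^2) ^ (-a))) := by
    refine tendsto_integral_filter_of_dominated_convergence
      (fun y => u y ^ p * (e^2 + ‖y - x‖^2) ^ (-a)) ?_ ?_ I1 ?_
    · exact Eventually.of_forall fun d => mp.mul (hT d).continuous.aestronglyMeasurable
    · filter_upwards [small] with d hd
      filter_upwards [ae0] with y hy
      have r0 := rho_pos he x y
      have up : 0 ≤ u y ^ p := Real.rpow_nonneg (S.upos y hy).le _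
      have a1 := cutA_nonneg (d⁻¹ • y)
      have a2 := cutA_le (d⁻¹ • y)
      have b1 := cutA_nonneg (d • y)
      have b2 := cutA_le (d • y)
      have hTF : TF a e x d y = cutA (d⁻¹ • y) * (1 - cutA (d • y)) * (e^2 + ‖y - x‖^2) ^ (-a) := rfl
      have q0 : 0 ≤ cutA (d⁻¹ • y) * (1 - cutA (d • y)) := mul_nonneg a1 (by linarith)
      have q1 : cutA (d⁻¹ • y) * (1 - cutA (d • y)) ≤ 1 := mul_le_one₀ a2 (by linarith) (by linarith)
      have rp : 0 ≤ (e^2 + ‖y - x‖^2) ^ (-a) := by positivity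
      rw [hTF, Real.norm_of_nonneg (mul_nonneg up (mul_nonneg q0 rp))]
      refine mul_le_mul_of_nonneg_left ?_ up
      exact mul_le_of_le_one_left rp q1
    · filter_upwards [ae0] with y hy
      refine tendsto_const_nhds.congr' ?_
      filter_upwards [near y hy] with d hd
      rw [hd.eq_of_nhds]
  have Eq : ∀ᶠ d : ℝ in 𝓝[>] 0, ∫ y, u y * lap (lap (lap (TF a e x d))) y =
      -c * ∫ y, u y ^ p * TF a e x d y := by
    filter_upwards [small] with d hd
    have sp : tsupport (TF a e x d) ⊆ {0}ᶜ := by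
      rintro y hy rfl
      have := (TF_supp x hd.1 hy).1
      simp at this; linarith [hd.1]
    have hcs : HasCompactSupport (TF a e x d) :=
      (isCompact_closedBall (0:EuclideanSpace ℝ (Fin n)) (2/d)).of_isClosed_subset
        (isClosed_tsupport _) fun y hy => by simpa using (TF_supp x hd.1 hy).2
    rw [ibp6 isOpen_compl_singleton S.hu (hT d) sp hcs, ← integral_const_mul]
    refine integral_congr_ae ?_
    filter_upwards [ae0] with y hy
    rw [S.sol y hy]; ring
  have I2 : Integrable (fun y => u y * (e^6 * (e^2 + ‖y - x‖^2) ^ (-(a+6)))) := by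
    obtain ⟨C3, hC3, h3⟩ := rho_bound he x (s1 := 3) (s2 := a+3) (by norm_num) (by linarith)
    refine (S.int_u.const_mul (e^6 * C3)).mono' (mu.mul
      ((rho_smooth he x _).continuous.const_smul (e^6)).aestronglyMeasurable) ?_
    filter_upwards [ae0] with y hy
    have r0 := rho_pos he x y
    have up := (S.upos y hy).le
    rw [Real.norm_of_nonneg (by positivity)]
    have := h3 y hy
    rw [show (3:ℝ) + (a+3) = a+6 by ring, show 2*(3:ℝ) = 6 by norm_num,
      show 2*(a+3) = (n:ℝ) by rw [S.na]; ring] at this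
    calc _ ≤ u y * (e^6 * (C3 * min (‖y‖ ^ (-(6:ℝ))) (‖y‖ ^ (-(n:ℝ))))) := by gcongr
      _ = _ := by ring
  refine ⟨I1, I2, ?_⟩
  have U := tendsto_nhds_unique (D1.congr' Eq) (D2.const_mul (-c))
  have e2 : ∫ y, u y * (-(64*a*(a+1)*(a+2)*(a+3)*(a+4)*(a+5)) * (e^6 * (e^2 + ‖y - x‖^2) ^ (-(a+6)))) =
     -(64*a*(a+1)*(a+2)*(a+3)*(a+4)*(a+5)) * ∫ y, u y * (e^6 * (e^2 + ‖y - x‖^2) ^ (-(a+6))) := by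
    rw [← integral_const_mul]; congr 1; funext y; ring
  rw [e2] at U
  linarith

end

section
open Filter Topology MeasureTheory
open scoped ContDiff

lemma mono_lim {α : Type*} [MeasurableSpace α] {μ : Measure α} {F : ℕ → α → ℝ} {f : α → ℝ} {L : ℝ}
    (hF : ∀ k, Integrable (F k) μ) (h0 : ∀ᵐ x ∂μ, ∀ k, 0 ≤ F k x)
    (hlim : ∀ᵐ x ∂μ, Tendsto (fun k => F k x) atTop (𝓝 (f x)))
    (hm : ∀ᵐ x ∂μ, Monotone fun k => F k x)
    (hL : Tendsto (fun k => ∫ x, F k x ∂μ) atTop (𝓝 L)) : Integrable f μ ∧ ∫ x, f x ∂μ = L := by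
  have hme : AEStronglyMeasurable f μ := aestronglyMeasurable_of_tendsto_ae _ (fun k => (hF k).1) hlim
  have hInt0 : Integrable f μ := by
    refine ⟨hme, ?_⟩
    have h1 : Tendsto (fun k => ∫⁻ x, ENNReal.ofReal (F k x) ∂μ) atTop
        (𝓝 (∫⁻ x, ENNReal.ofReal (f x) ∂μ)) := by
      refine lintegral_tendsto_of_tendsto_of_monotone (fun k => (hF k).1.aemeasurable.ennreal_ofReal) ?_ ?_
      · filter_upwards [hm] with x hx
        exact fun i j hij => ENNReal.ofReal_le_ofReal (hx hij)
      · filter_upwards [hlim] with x hx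
        exact (ENNReal.continuous_ofReal.tendsto _).comp hx
    have h2 : Tendsto (fun k => ∫⁻ x, ENNReal.ofReal (F k x) ∂μ) atTop (𝓝 (ENNReal.ofReal L)) := by
      refine ((ENNReal.continuous_ofReal.tendsto _).comp hL).congr fun k => ?_
      exact ofReal_integral_eq_lintegral_ofReal (hF k) (h0.mono fun x hx => hx k)
    have h3 := tendsto_nhds_unique h1 h2
    have hf0 : 0 ≤ᵐ[μ] f := by
      filter_upwards [h0, hlim] with x hx hx2
      exact ge_of_tendsto' hx2 hx
    rw [hasFiniteIntegral_iff_ofReal hf0, h3]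
    exact ENNReal.ofReal_lt_top
  exact ⟨hInt0, tendsto_nhds_unique (integral_tendsto_of_tendsto_of_monotone hF hInt0 hm hlim) hL⟩

def MJ (n : ℕ) (a : ℝ) : ℝ := ∫ z : EuclideanSpace ℝ (Fin n), (1 + ‖z‖^2) ^ (-(a+6))

lemma intJ {n : ℕ} {a : ℝ} (hna : (n:ℝ) = 2*a+6) : 
    Integrable (fun z : EuclideanSpace ℝ (Fin n) => (1 + ‖z‖^2) ^ (-(a+6))) := by
  have := integrable_rpow_neg_one_add_norm_sq (E := EuclideanSpace ℝ (Fin n)) (μ := volume) (r := n + 6)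
    (by simp)
  refine this.congr (Eventually.of_forall fun z => ?_)
  have e : -((n:ℝ) + 6) / 2 = -(a+6) := by rw [hna]; ring
  simp only [e]

lemma MJ_pos {n : ℕ} {a : ℝ} (hna : (n:ℝ) = 2*a+6) : 0 < MJ n a := by
  unfold MJ
  rw [integral_pos_iff_support_of_nonneg (fun z => by positivity) (intJ hna)]
  have : (Function.support fun z : EuclideanSpace ℝ (Fin n) => (1 + ‖z‖^2) ^ (-(a+6))) = Set.univ := by
    ext z
    simp only [Function.mem_support, Set.mem_univ, iff_true]
    positivity
  rw [this]
  exact isOpen_univ.measure_pos _ Set.univ_nonempty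

lemma SolU.rhs_lim {n a p c u} (S : SolU n a p c u) {x : EuclideanSpace ℝ (Fin n)} (hx : x ≠ 0) :
    Tendsto (fun s : ℝ => ∫ y, u y * ((s⁻¹)^6 * ((s⁻¹)^2 + ‖y - x‖^2) ^ (-(a+6)))) atTop
      (𝓝 (MJ n a * u x)) := by
  have hM := MJ_pos S.na
  have ha := S.ha
  set r := ‖x‖/2 with hr
  have hx0 : 0 < ‖x‖ := norm_pos_iff.2 hx
  have hr0 : 0 < r := by positivity
  set B := Metric.closedBall x r
  have hB : MeasurableSet B := Metric.isClosed_closedBall.measurableSet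
  have hBs : B ⊆ {0}ᶜ := by
    rintro y hy rfl
    rw [Metric.mem_closedBall, dist_zero_left] at hy
    linarith
  -- near part
  have hIB : IntegrableOn u B := (S.cont.mono hBs).integrableOn_compact (isCompact_closedBall _ _)
  have hgi : Integrable (B.indicator u) := (integrable_indicator_iff hB).2 hIB
  have hgi2 : Integrable (fun z => B.indicator u (x + z)) := hgi.comp_add_left x
  have hgc : ContinuousAt (fun z => B.indicator u (x + z)) 0 := by
    have h1 : ContinuousAt (B.indicator u) x := by
      have h2 : ContinuousAt u x := S.cont.continuousAt (isOpen_compl_singleton.mem_nhds hx)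
      refine h2.congr ?_
      filter_upwards [Metric.closedBall_mem_nhds x hr0] with y hy
      exact (Set.indicator_of_mem hy _).symm
    have h3 : ContinuousAt (fun z : EuclideanSpace ℝ (Fin n) => x + z) 0 := by fun_prop
    refine ContinuousAt.comp (g := B.indicator u) ?_ h3
    simpa using h1
  have hnear := tendsto_integral_comp_smul_smul_of_integrable (μ := (volume : Measure (EuclideanSpace ℝ (Fin n))))
    (φ := fun z => (MJ n a)⁻¹ * (1 + ‖z‖^2) ^ (-(a+6))) (fun z => by positivity)
    (by rw [integral_const_mul]; exact inv_mul_cancel₀ hM.ne') (by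
      rw [finrank_euclideanSpace_fin]
      have h1 : Tendsto (fun z : EuclideanSpace ℝ (Fin n) => (MJ n a)⁻¹ * ‖z‖^(-(6:ℝ))) 
          (Bornology.cobounded _) (𝓝 ((MJ n a)⁻¹ * 0)) :=
        ((tendsto_rpow_neg_atTop (by norm_num)).comp tendsto_norm_cobounded_atTop).const_mul _
      rw [mul_zero] at h1
      refine squeeze_zero' (Eventually.of_forall fun z => by positivity) ?_ h1
      have h2 : ∀ᶠ z : EuclideanSpace ℝ (Fin n) in Bornology.cobounded _, 0 < ‖z‖ :=
        tendsto_norm_cobounded_atTop.eventually (eventually_gt_atTop 0)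
      filter_upwards [h2] with z hz
      have h3 : (1 + ‖z‖^2) ^ (-(a+6)) ≤ (‖z‖^2) ^ (-(a+6)) :=
        Real.rpow_le_rpow_of_nonpos (by positivity) (by linarith) (by linarith)
      have h4 : ‖z‖^n * (‖z‖^2) ^ (-(a+6)) = ‖z‖^(-(6:ℝ)) := by
        rw [← Real.rpow_natCast ‖z‖ n, ← Real.rpow_natCast ‖z‖ 2, ← Real.rpow_mul hz.le, ← Real.rpow_add hz, S.na]
        congr 1; push_cast; ring
      calc ‖z‖^n * ((MJ n a)⁻¹ * (1 + ‖z‖^2) ^ (-(a+6))) ≤ ‖z‖^n * ((MJ n a)⁻¹ * (‖z‖^2) ^ (-(a+6))) := by gcongr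
        _ = (MJ n a)⁻¹ * (‖z‖^n * (‖z‖^2) ^ (-(a+6))) := by ring
        _ = _ := by rw [h4]) hgi2 hgc
  have hnear2 := hnear.const_mul (MJ n a)
  simp only [add_zero] at hnear2
  rw [Set.indicator_of_mem (Metric.mem_closedBall_self hr0.le)] at hnear2
  -- far part
  obtain ⟨-, hW, -⟩ := S.eps_id one_pos x
  simp only [one_pow, one_mul] at hW
  set C := (1 + r⁻¹^2)^(a+6) with hC
  have hfar : Tendsto (fun s : ℝ => ∫ y, Bᶜ.indicator (fun y => u y * ((s⁻¹)^6 * ((s⁻¹)^2 + ‖y - x‖^2) ^ (-(a+6)))) y) atTop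
      (𝓝 0) := by
    have hz : Tendsto (fun s : ℝ => (s⁻¹)^6 * (C * ∫ y, |u y * (1 + ‖y - x‖^2) ^ (-(a+6))|)) atTop (𝓝 0) := by
      have := ((tendsto_inv_atTop_zero (𝕜 := ℝ)).pow 6).mul_const (C * ∫ y, |u y * (1 + ‖y - x‖^2) ^ (-(a+6))|)
      simpa using this
    refine squeeze_zero_norm' ?_ hz
    filter_upwards [eventually_gt_atTop 0] with s hs
    rw [← integral_const_mul, ← integral_const_mul]
    refine norm_integral_le_of_norm_le ((hW.abs.const_mul C).const_mul _) (Eventually.of_forall fun y => ?_)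
    by_cases hy : y ∈ B
    · rw [Set.indicator_of_notMem (by simpa using hy)]
      simp only [norm_zero]; positivity
    · rw [Set.indicator_of_mem (by simpa using hy), Real.norm_eq_abs, abs_mul, abs_mul (u y) ((1 + ‖y - x‖^2) ^ (-(a+6))),
        abs_of_pos (show 0 < (1 + ‖y - x‖^2) ^ (-(a+6)) by positivity),
        abs_of_pos (show 0 < (s⁻¹)^6 * ((s⁻¹)^2 + ‖y - x‖^2) ^ (-(a+6)) by positivity)]
      have hy' : r < ‖y - x‖ := by
        rw [Metric.mem_closedBall, not_le, dist_eq_norm] at hy; exact hy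
      have hyp : 0 < ‖y - x‖ := hr0.trans hy'
      have k1 : 1 + ‖y - x‖^2 ≤ (1 + r⁻¹^2) * (s⁻¹^2 + ‖y - x‖^2) := by
        have : 1 ≤ r⁻¹^2 * ‖y - x‖^2 := by
          rw [← mul_pow]
          refine one_le_pow₀ ?_
          rw [inv_mul_eq_div, one_le_div hr0]; exact hy'.le
        have : 0 ≤ r⁻¹^2 * s⁻¹^2 := by positivity
        have : 0 ≤ s⁻¹^2 := by positivity
        nlinarith
      have k2 : (s⁻¹^2 + ‖y - x‖^2) ^ (-(a+6)) ≤ C * (1 + ‖y - x‖^2) ^ (-(a+6)) := by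
        rw [Real.rpow_neg (by positivity), Real.rpow_neg (by positivity), ← div_eq_mul_inv, inv_eq_one_div,
          div_le_div_iff₀ (by positivity) (by positivity), one_mul, hC, ← Real.mul_rpow (by positivity) (by positivity)]
        exact Real.rpow_le_rpow (by positivity) k1 (by linarith)
      calc |u y| * (s⁻¹^6 * (s⁻¹^2 + ‖y - x‖^2) ^ (-(a+6))) ≤ |u y| * (s⁻¹^6 * (C * (1 + ‖y - x‖^2) ^ (-(a+6)))) := by gcongr
        _ = _ := by ring
  have hsum := hnear2.add hfar
  rw [add_zero] at hsum
  refine hsum.congr' ?_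
  filter_upwards [eventually_gt_atTop 0] with s hs
  obtain ⟨-, hI, -⟩ := S.eps_id (inv_pos.2 hs) x
  rw [← integral_const_mul]
  have e1 : ∫ z, MJ n a * ((s ^ Module.finrank ℝ (EuclideanSpace ℝ (Fin n)) * ((MJ n a)⁻¹ * (1 + ‖s • z‖^2) ^ (-(a+6)))) • B.indicator u (x + z))
     = ∫ y, B.indicator (fun y => u y * ((s⁻¹)^6 * ((s⁻¹)^2 + ‖y - x‖^2) ^ (-(a+6)))) y := by
    conv_rhs => rw [← integral_add_left_eq_self _ x]
    congr 1
    ext z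
    by_cases hz : x + z ∈ B
    · rw [Set.indicator_of_mem hz, Set.indicator_of_mem hz, finrank_euclideanSpace_fin, smul_eq_mul,
        add_sub_cancel_left, norm_smul, Real.norm_of_nonneg hs.le]
      have h1 : 1 + (s * ‖z‖)^2 = s^2 * (s⁻¹^2 + ‖z‖^2) := by field_simp
      have h2 : s^n * (s^2)^(-(a+6)) = s⁻¹^6 := by
        rw [inv_pow, ← Real.rpow_natCast s n, ← Real.rpow_natCast s 2, ← Real.rpow_mul hs.le, ← Real.rpow_add hs,
          S.na, ← Real.rpow_natCast s 6, ← Real.rpow_neg hs.le]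
        congr 1; push_cast; ring
      rw [h1, Real.mul_rpow (by positivity) (by positivity), ← h2]
      field_simp
    · rw [Set.indicator_of_notMem hz, Set.indicator_of_notMem hz]; simp
  rw [e1, ← integral_add (hI.indicator hB) (hI.indicator hB.compl)]
  congr 1
  ext y
  exact congrFun (Set.indicator_self_add_compl B _) y

lemma SolU.repr {n a p c u} (S : SolU n a p c u) : ∃ κ : ℝ, 0 < κ ∧ ∀ x : EuclideanSpace ℝ (Fin n), x ≠ 0 →
    Integrable (fun y => u y ^ p * ‖y - x‖ ^ (-(2*a))) ∧ u x = κ * ∫ y, u y ^ p * ‖y - x‖ ^ (-(2*a)) := by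
  have ha := S.ha
  have hM := MJ_pos S.na
  have hc := S.hc
  set K := 64*a*(a+1)*(a+2)*(a+3)*(a+4)*(a+5) with hK
  have hK0 : 0 < K := by positivity
  have : Nonempty (Fin n) := ⟨⟨0, by have := S.hn; omega⟩⟩
  refine ⟨c / (K * MJ n a), by positivity, fun x hx => ?_⟩
  have hlim : Tendsto (fun k : ℕ => ∫ y, u y ^ p * (((k:ℝ)+1)⁻¹^2 + ‖y - x‖^2) ^ (-a)) atTop (𝓝 (K / c * (MJ n a * u x))) := by
    have h1 : Tendsto (fun k : ℕ => (k:ℝ)+1) atTop atTop := 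
      tendsto_atTop_add_const_right _ _ tendsto_natCast_atTop_atTop
    refine (((S.rhs_lim hx).comp h1).const_mul (K/c)).congr fun k => ?_
    obtain ⟨-, -, h⟩ := S.eps_id (e := ((k:ℝ)+1)⁻¹) (by positivity) x
    simp only [Function.comp]
    rw [div_mul_eq_mul_div, div_eq_iff hc.ne', mul_comm _ c, h]
  suffices H : Integrable (fun y => u y ^ p * ‖y - x‖ ^ (-(2*a))) ∧
      ∫ y, u y ^ p * ‖y - x‖ ^ (-(2*a)) = K / c * (MJ n a * u x) by
    obtain ⟨h1, h2⟩ := H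
    refine ⟨h1, ?_⟩
    rw [h2]; field_simp
  refine mono_lim (F := fun (k:ℕ) y => u y ^ p * (((k:ℝ)+1)⁻¹^2 + ‖y - x‖^2) ^ (-a))
    (f := fun y => u y ^ p * ‖y - x‖ ^ (-(2*a))) 
    (fun k => (S.eps_id (e := ((k:ℝ)+1)⁻¹) (by positivity) x).1) ?_ ?_ ?_ hlim
  · filter_upwards [Measure.ae_ne volume 0] with y hy k
    have := S.upos y hy
    positivity
  · filter_upwards [Measure.ae_ne volume x] with y hy
    have hyx : 0 < ‖y - x‖ := norm_pos_iff.2 (sub_ne_zero.2 hy)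
    refine Tendsto.const_mul _ ?_
    have e : ‖y - x‖ ^ (-(2*a)) = (0^2 + ‖y-x‖^2)^(-a) := by
      rw [zero_pow (by norm_num), zero_add, ← Real.rpow_natCast _ 2, ← Real.rpow_mul hyx.le]; congr 1; push_cast; ring
    rw [e]
    refine Tendsto.rpow_const ?_ (Or.inl (by positivity))
    refine Tendsto.add_const _ (Tendsto.pow ?_ 2)
    have h1 : Tendsto (fun k : ℕ => (k:ℝ)+1) atTop atTop := 
      tendsto_atTop_add_const_right _ _ tendsto_natCast_atTop_atTop
    exact tendsto_inv_atTop_zero.comp h1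
  · filter_upwards [Measure.ae_ne volume 0, Measure.ae_ne volume x] with y hy hyx
    have hyx : 0 < ‖y - x‖ := norm_pos_iff.2 (sub_ne_zero.2 hyx)
    intro i j hij
    have := S.upos y hy
    simp only
    refine mul_le_mul_of_nonneg_left ?_ (by positivity)
    refine Real.rpow_le_rpow_of_nonpos (by positivity) ?_ (by linarith)
    gcongr

end

section
open Filter Topology MeasureTheory EuclideanGeometry
open scoped ContDiff

lemma abs_det_isom {n : ℕ} (L : EuclideanSpace ℝ (Fin n) ≃ₗᵢ[ℝ] EuclideanSpace ℝ (Fin n)) (s : ℝ) (hs : 0 ≤ s) :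
    |(s • (L : EuclideanSpace ℝ (Fin n) →L[ℝ] EuclideanSpace ℝ (Fin n))).det| = s ^ n := by
  have h1 := Measure.addHaar_image_continuousLinearMap (μ := (volume : Measure (EuclideanSpace ℝ (Fin n))))
    (L : EuclideanSpace ℝ (Fin n) →L[ℝ] EuclideanSpace ℝ (Fin n)) (Metric.ball 0 1)
  have h2 : (L : EuclideanSpace ℝ (Fin n) →L[ℝ] EuclideanSpace ℝ (Fin n)) '' (Metric.ball 0 1) = Metric.ball 0 1 := by
    have := L.image_ball 0 1
    simpa using this
  rw [h2] at h1
  have h3 : |(L : EuclideanSpace ℝ (Fin n) →L[ℝ] EuclideanSpace ℝ (Fin n)).det| = 1 := by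
    have h4 : (volume : Measure (EuclideanSpace ℝ (Fin n))) (Metric.ball 0 1) ≠ 0 := (Metric.measure_ball_pos _ _ one_pos).ne'
    have h5 : (volume : Measure (EuclideanSpace ℝ (Fin n))) (Metric.ball 0 1) ≠ ⊤ := Metric.isBounded_ball.measure_lt_top.ne
    have h6 := (ENNReal.mul_left_inj h4 h5).1 (h1.symm.trans (one_mul _).symm)
    exact ENNReal.ofReal_eq_one.1 h6
  have h7 : (s • (L : EuclideanSpace ℝ (Fin n) →L[ℝ] EuclideanSpace ℝ (Fin n))).det
     = s ^ n * (L : EuclideanSpace ℝ (Fin n) →L[ℝ] EuclideanSpace ℝ (Fin n)).det := by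
    have := LinearMap.det_smul s (L : EuclideanSpace ℝ (Fin n) →ₗ[ℝ] EuclideanSpace ℝ (Fin n))
    rw [finrank_euclideanSpace_fin] at this
    exact this
  rw [h7, abs_mul, h3, mul_one, abs_of_nonneg (by positivity)]

lemma inv_image {n : ℕ} (x : EuclideanSpace ℝ (Fin n)) {l : ℝ} (hl : 0 < l) :
    inversion x l '' (Metric.ball x l \ {x}) = (Metric.closedBall x l)ᶜ := by
  ext y
  constructor
  · rintro ⟨z, ⟨hz, hzx⟩, rfl⟩
    have h0 : 0 < dist z x := dist_pos.2 hzx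
    rw [Metric.mem_ball] at hz
    rw [Set.mem_compl_iff, Metric.mem_closedBall, not_le, dist_inversion_center, lt_div_iff₀ h0]
    nlinarith
  · intro hy
    rw [Set.mem_compl_iff, Metric.mem_closedBall, not_le] at hy
    have h0 : 0 < dist y x := hl.trans hy
    refine ⟨inversion x l y, ⟨?_, ?_⟩, inversion_inversion x hl.ne' y⟩
    · rw [Metric.mem_ball, dist_inversion_center, div_lt_iff₀ h0]; nlinarith
    · rw [Set.mem_singleton_iff, inversion_eq_center hl.ne']
      rintro rfl
      simp at h0

lemma cov {n : ℕ} (hn : 1 ≤ n) (x : EuclideanSpace ℝ (Fin n)) {l : ℝ} (hl : 0 < l) {h : EuclideanSpace ℝ (Fin n) → ℝ}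
    (hh : Integrable h) : IntegrableOn (fun y => (l / ‖y - x‖)^(2*n) * h (inversion x l y)) (Metric.ball x l) ∧
    ∫ y, h y = (∫ y in Metric.ball x l, h y) + ∫ y in Metric.ball x l, (l / ‖y - x‖)^(2*n) * h (inversion x l y) := by
  have : Nonempty (Fin n) := ⟨⟨0, by omega⟩⟩
  have hs : MeasurableSet (Metric.ball x l \ {x}) := Metric.isOpen_ball.measurableSet.diff (measurableSet_singleton x)
  have hd : ∀ y ∈ Metric.ball x l \ {x}, HasFDerivWithinAt (inversion x l) 
      ((l / dist y x) ^ 2 • ((ℝ ∙ (y - x))ᗮ.reflection : EuclideanSpace ℝ (Fin n) →L[ℝ] EuclideanSpace ℝ (Fin n)))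
      (Metric.ball x l \ {x}) y := fun y hy => (hasFDerivAt_inversion hy.2).hasFDerivWithinAt
  have hi := (inversion_injective x hl.ne').injOn (s := Metric.ball x l \ {x})
  have hae : (Metric.ball x l \ {x} : Set (EuclideanSpace ℝ (Fin n))) =ᵐ[volume] Metric.ball x l :=
    sdiff_null_ae_eq_self (measure_singleton x)
  have k1 := (integrableOn_image_iff_integrableOn_abs_det_fderiv_smul (μ := volume) hs hd hi h).1 hh.integrableOn
  have k2 := integral_image_eq_integral_abs_det_fderiv_smul (μ := volume) hs hd hi h
  have e : ∀ y, |((l / dist y x) ^ 2 • ((ℝ ∙ (y - x))ᗮ.reflection : EuclideanSpace ℝ (Fin n) →L[ℝ] EuclideanSpace ℝ (Fin n))).det|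
     • h (inversion x l y) = (l / ‖y - x‖)^(2*n) * h (inversion x l y) := fun y => by
    rw [abs_det_isom _ _ (by positivity), smul_eq_mul, pow_mul, dist_eq_norm]
  simp only [e] at k1 k2
  rw [integrableOn_congr_set_ae hae] at k1
  rw [setIntegral_congr_set hae, inv_image x hl] at k2
  refine ⟨k1, ?_⟩
  rw [← k2]
  have hae2 : (Metric.ball x l : Set (EuclideanSpace ℝ (Fin n))) =ᵐ[volume] Metric.closedBall x l := by
    rw [← Metric.closedBall_sdiff_sphere]
    exact sdiff_null_ae_eq_self (Measure.addHaar_sphere _ x l)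
  rw [setIntegral_congr_set hae2]
  exact (integral_add_compl Metric.isClosed_closedBall.measurableSet hh).symm

end

section
open Filter Topology MeasureTheory EuclideanGeometry
open scoped ContDiff

def uI {n : ℕ} (a : ℝ) (x : EuclideanSpace ℝ (Fin n)) (l : ℝ) (u : EuclideanSpace ℝ (Fin n) → ℝ)
  (y : EuclideanSpace ℝ (Fin n)) : ℝ := (l / ‖y - x‖)^(2*a) * u (inversion x l y)

def kD {n : ℕ} (a : ℝ) (x : EuclideanSpace ℝ (Fin n)) (l : ℝ) (z y : EuclideanSpace ℝ (Fin n)) : ℝ :=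
  ‖y - z‖ ^ (-(2*a)) - (l / ‖z - x‖)^(2*a) * ‖y - inversion x l z‖ ^ (-(2*a))

lemma ker1 {n : ℕ} {a p l r s U d d' : ℝ} (na : (n:ℝ) = 2 * a + 6) (hp : p * a = a + 6)
    (hl : 0 < l) (hr : 0 < r) (hs : 0 < s) (hU : 0 ≤ U) (hd' : 0 ≤ d') (hd : d = d' * s / r) :
    (l/r)^(2*n) * (U^p * d^(-(2*a))) = ((l/r)^(2*a) * U)^p * ((l/s)^(2*a) * d'^(-(2*a))) := by
  have h1 : (l/r)^(2*n) = (l/r)^(2*a*p) * (l/r)^(2*a) := by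
    rw [← Real.rpow_natCast, ← Real.rpow_add (by positivity)]
    congr 1
    push_cast; rw [na]; linarith
  rw [h1, Real.mul_rpow (by positivity) hU, ← Real.rpow_mul (by positivity), hd,
    Real.div_rpow (mul_nonneg hd' hs.le) hr.le, Real.mul_rpow hd' hs.le, Real.div_rpow hl.le hr.le (2*a),
    Real.div_rpow hl.le hs.le (2*a), Real.rpow_neg hr.le, Real.rpow_neg hs.le]
  have := Real.rpow_pos_of_pos hr (2*a)
  have := Real.rpow_pos_of_pos hs (2*a)
  field_simp

lemma ker2 {n : ℕ} {a p l r s U d d' : ℝ} (na : (n:ℝ) = 2 * a + 6) (hp : p * a = a + 6)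
    (hl : 0 < l) (hr : 0 < r) (hs : 0 < s) (hU : 0 ≤ U) (hd' : 0 ≤ d') (hd : d = l^2 / (r * s) * d') :
    (l/s)^(2*a) * ((l/r)^(2*n) * (U^p * d^(-(2*a)))) = ((l/r)^(2*a) * U)^p * d'^(-(2*a)) := by
  have e : d = (l * d' / s) * l / r := by rw [hd]; field_simp
  rw [ker1 na hp hl hr hl hU (by positivity) e, div_self hl.ne', Real.one_rpow, one_mul,
    Real.div_rpow (mul_nonneg hl.le hd') hs.le, Real.mul_rpow hl.le hd', Real.div_rpow hl.le hs.le,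
    Real.rpow_neg hl.le, Real.rpow_neg hs.le]
  have := Real.rpow_pos_of_pos hl (2*a)
  have := Real.rpow_pos_of_pos hs (2*a)
  field_simp

lemma dist_inv1 {n : ℕ} {x y z : EuclideanSpace ℝ (Fin n)} {l : ℝ} (hl : 0 < l) (hy : y ≠ x) (hz : z ≠ x) :
    ‖inversion x l y - z‖ = ‖y - inversion x l z‖ * ‖z - x‖ / ‖y - x‖ := by
  have h1 : inversion x l z ≠ x := by rwa [Ne, inversion_eq_center hl.ne']
  have h2 := dist_inversion_inversion hy h1 l
  rw [inversion_inversion x hl.ne', dist_inversion_center] at h2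
  simp only [dist_eq_norm] at h2
  have := norm_pos_iff.2 (sub_ne_zero.2 hy)
  have := norm_pos_iff.2 (sub_ne_zero.2 hz)
  rw [h2]; field_simp

lemma dist_inv2 {n : ℕ} {x y z : EuclideanSpace ℝ (Fin n)} {l : ℝ} (hy : y ≠ x) (hz : z ≠ x) :
    ‖inversion x l y - inversion x l z‖ = l^2 / (‖y - x‖ * ‖z - x‖) * ‖y - z‖ := by
  have h2 := dist_inversion_inversion hy hz l
  simp only [dist_eq_norm] at h2
  exact h2

lemma dist_inv3 {n : ℕ} {x y z : EuclideanSpace ℝ (Fin n)} {l : ℝ} (hl : 0 < l) (hz : z ≠ x) :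
    (‖z - x‖ * ‖y - inversion x l z‖)^2 = (l * ‖y - z‖)^2 + (l^2 - ‖z - x‖^2) * (l^2 - ‖y - x‖^2) := by
  have hs := norm_pos_iff.2 (sub_ne_zero.2 hz)
  have e1 : y - inversion x l z = (y - x) - (l/‖z-x‖)^2 • (z - x) := by
    have := inversion_vsub_center x l z
    rw [dist_eq_norm] at this
    simp only [vsub_eq_sub] at this
    rw [← this]; abel
  have e2 : y - z = (y - x) - (z - x) := by abel
  rw [mul_pow, mul_pow, e1, e2]
  generalize z - x = Z at *
  generalize y - x = Y at *
  rw [norm_sub_sq_real, norm_sub_sq_real, inner_smul_right, norm_smul,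
    Real.norm_of_nonneg (by positivity)]
  field_simp
  ring

lemma kD_pos {n : ℕ} {a : ℝ} (ha : 0 < a) {x y z : EuclideanSpace ℝ (Fin n)} {l : ℝ} (hl : 0 < l)
    (hz : z ≠ x) (hzl : ‖z - x‖ < l) (hyl : ‖y - x‖ < l) (hyz : y ≠ z) : 0 < kD a x l z y := by
  have hs := norm_pos_iff.2 (sub_ne_zero.2 hz)
  have hyz := norm_pos_iff.2 (sub_ne_zero.2 hyz)
  have h1 := dist_inv3 (y := y) hl hz
  have h2 : 0 < (l^2 - ‖z - x‖^2) * (l^2 - ‖y - x‖^2) :=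
    mul_pos (by nlinarith [norm_nonneg (z-x)]) (by nlinarith [norm_nonneg (y-x)])
  have h3 : l * ‖y - z‖ < ‖z - x‖ * ‖y - inversion x l z‖ := by
    refine lt_of_pow_lt_pow_left₀ 2 (by positivity) (by linarith)
  have h4 : 0 < ‖y - inversion x l z‖ := by
    by_contra h
    have : ‖y - inversion x l z‖ = 0 := le_antisymm (not_lt.1 h) (norm_nonneg _)
    rw [this] at h3
    nlinarith [mul_pos hl hyz]
  unfold kD
  rw [sub_pos, Real.rpow_neg hyz.le, Real.rpow_neg h4.le, ← Real.inv_rpow hyz.le, ← Real.inv_rpow h4.le,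
    ← Real.mul_rpow (by positivity) (by positivity)]
  refine Real.rpow_lt_rpow (by positivity) ?_ (by linarith)
  rw [← div_eq_mul_inv, div_div, inv_eq_one_div, div_lt_div_iff₀ (by positivity) (by positivity)]
  linarith

lemma kD_le {n : ℕ} {a : ℝ} {x y z : EuclideanSpace ℝ (Fin n)} {l : ℝ} (hl : 0 < l) :
    kD a x l z y ≤ ‖y - z‖ ^ (-(2*a)) := by
  unfold kD
  have : 0 ≤ (l / ‖z - x‖)^(2*a) * ‖y - inversion x l z‖ ^ (-(2*a)) := by positivity
  linarith

def IRep {n : ℕ} (a p κ : ℝ) (u : EuclideanSpace ℝ (Fin n) → ℝ) : Prop := 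
  ∀ x : EuclideanSpace ℝ (Fin n), x ≠ 0 →
    Integrable (fun y => u y ^ p * ‖y - x‖ ^ (-(2*a))) ∧ u x = κ * ∫ y, u y ^ p * ‖y - x‖ ^ (-(2*a))

lemma SolU.diff {n a p c u} (S : SolU n a p c u) {κ : ℝ} (hrep : IRep a p κ u) 
    {x z : EuclideanSpace ℝ (Fin n)} {l : ℝ} (hl : 0 < l) (hlx : l < ‖x‖) (hzx : z ≠ x) (hzl : ‖z - x‖ < l)
    (hz0 : inversion x l z ≠ 0) :
    IntegrableOn (fun y => kD a x l z y * (u y ^ p - uI a x l u y ^ p)) (Metric.ball x l) ∧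
    u z - uI a x l u z = κ * ∫ y in Metric.ball x l, kD a x l z y * (u y ^ p - uI a x l u y ^ p) := by
  have hn := S.hn
  have : Nonempty (Fin n) := ⟨⟨0, by omega⟩⟩
  have hz : z ≠ 0 := by
    rintro rfl
    rw [zero_sub, norm_neg] at hzl; linarith
  have hs := norm_pos_iff.2 (sub_ne_zero.2 hzx)
  obtain ⟨i1, e1⟩ := hrep z hz
  obtain ⟨i2, e2⟩ := hrep _ hz0
  obtain ⟨j1, f1⟩ := cov (by omega) x hl i1
  obtain ⟨j2, f2⟩ := cov (by omega) x hl i2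
  have hae : ∀ᵐ y ∂(volume.restrict (Metric.ball x l)), y ≠ x ∧ inversion x l y ≠ 0 := by
    refine ae_restrict_of_ae ?_
    filter_upwards [Measure.ae_ne volume x, Measure.ae_ne volume (inversion x l 0)] with y h1 h2
    refine ⟨h1, fun h => h2 ?_⟩
    rw [← h, inversion_inversion x hl.ne']
  have g1 : (fun y => (l / ‖y - x‖)^(2*n) * (u (inversion x l y) ^ p * ‖inversion x l y - z‖ ^ (-(2*a))))
     =ᵐ[volume.restrict (Metric.ball x l)] fun y => uI a x l u y ^ p * ((l/‖z-x‖)^(2*a) * ‖y - inversion x l z‖ ^ (-(2*a))) := by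
    filter_upwards [hae] with y hy
    exact ker1 S.na S.hp hl (norm_pos_iff.2 (sub_ne_zero.2 hy.1)) hs (S.upos _ hy.2).le (norm_nonneg _)
      (dist_inv1 hl hy.1 hzx)
  have g2 : (fun y => (l/‖z-x‖)^(2*a) * ((l / ‖y - x‖)^(2*n) * (u (inversion x l y) ^ p * ‖inversion x l y - inversion x l z‖ ^ (-(2*a)))))
     =ᵐ[volume.restrict (Metric.ball x l)] fun y => uI a x l u y ^ p * ‖y - z‖ ^ (-(2*a)) := by
    filter_upwards [hae] with y hy
    exact ker2 S.na S.hp hl (norm_pos_iff.2 (sub_ne_zero.2 hy.1)) hs (S.upos _ hy.2).le (norm_nonneg _)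
      (dist_inv2 hy.1 hzx)
  have j1' := Integrable.congr j1 g1
  have j2' := Integrable.congr (Integrable.const_mul j2 ((l/‖z-x‖)^(2*a))) g2
  have f2' : uI a x l u z = κ * ((∫ y in Metric.ball x l, (l/‖z-x‖)^(2*a) * (u y ^ p * ‖y - inversion x l z‖ ^ (-(2*a))))
      + ∫ y in Metric.ball x l, uI a x l u y ^ p * ‖y - z‖ ^ (-(2*a))) := by
    rw [← integral_congr_ae g2, integral_const_mul, integral_const_mul]
    unfold uI
    rw [e2, f2]; ring
  rw [integral_congr_ae g1] at f1
  have i1' := i1.integrableOn (s := Metric.ball x l)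
  have i2' := (i2.integrableOn (s := Metric.ball x l)).const_mul ((l/‖z-x‖)^(2*a))
  have eq : (fun y => kD a x l z y * (u y ^ p - uI a x l u y ^ p)) = 
    (((fun y => u y ^ p * ‖y - z‖ ^ (-(2*a))) + fun y => uI a x l u y ^ p * ((l/‖z-x‖)^(2*a) * ‖y - inversion x l z‖ ^ (-(2*a)))) - 
    ((fun y => (l/‖z-x‖)^(2*a) * (u y ^ p * ‖y - inversion x l z‖ ^ (-(2*a)))) +  fun y => uI a x l u y ^ p * ‖y - z‖ ^ (-(2*a)))) := by
    ext y
    simp only [Pi.add_apply, Pi.sub_apply, kD]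
    ring
  refine ⟨?_, ?_⟩
  · rw [eq]; exact (i1'.add j1').sub (i2'.add j2')
  · rw [eq, integral_sub' (i1'.add j1') (i2'.add j2'), integral_add' i1' j1', integral_add' i2' j2', f2', e1, f1]
    ring

end

section
open Filter Topology MeasureTheory EuclideanGeometry
open scoped ContDiff ENNReal

lemma pot_ball {n : ℕ} {a : ℝ} (na : (n:ℝ) = 2 * a + 6) (hn : 1 ≤ n) :
    IntegrableOn (fun y : EuclideanSpace ℝ (Fin n) => ‖y‖ ^ (-(2*a))) (Metric.ball 0 1) := by
  have : Nonempty (Fin n) := ⟨⟨0, by omega⟩⟩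
  rw [integrableOn_fun_norm_addHaar volume (f := fun t => t ^ (-(2*a))), finrank_euclideanSpace_fin]
  have h : IntegrableOn (fun t : ℝ => t ^ (5:ℝ)) (Set.Ioo 0 1) :=
    (intervalIntegral.integrableOn_Ioo_rpow_iff one_pos).2 (by norm_num)
  refine h.congr_fun (fun t ht => ?_) measurableSet_Ioo
  simp only [smul_eq_mul]
  rw [← Real.rpow_natCast, ← Real.rpow_add ht.1]
  congr 1
  rw [Nat.cast_sub hn, na]; push_cast; ring

lemma pot_small {n : ℕ} {a : ℝ} (na : (n:ℝ) = 2 * a + 6) (ha : 0 < a) (hn : 1 ≤ n) {ε : ℝ} (hε : 0 < ε) :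
    ∃ δ : ℝ≥0∞, 0 < δ ∧ ∀ s : Set (EuclideanSpace ℝ (Fin n)), MeasurableSet s → volume s < δ → 
    ∀ z, IntegrableOn (fun y => ‖y - z‖ ^ (-(2*a))) s ∧ ∫ y in s, ‖y - z‖ ^ (-(2*a)) ≤ ε := by
  set g : EuclideanSpace ℝ (Fin n) → ℝ := (Metric.ball 0 1).indicator (fun y => ‖y‖ ^ (-(2*a))) with hg
  have hgi : Integrable g := (integrable_indicator_iff Metric.isOpen_ball.measurableSet).2 (pot_ball na hn)
  have hg0 : ∀ y, 0 ≤ g y := fun y => Set.indicator_nonneg (fun y _ => by positivity) y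
  have hfin : ∫⁻ y, ENNReal.ofReal (g y) ≠ ⊤ := 
    ((hasFiniteIntegral_iff_ofReal (Eventually.of_forall hg0)).1 hgi.2).ne
  obtain ⟨δ, hδ, h⟩ := exists_pos_setLIntegral_lt_of_measure_lt hfin (ε := ENNReal.ofReal (ε/2)) 
    (by simpa using hε)
  refine ⟨min δ (ENNReal.ofReal (ε/2)), lt_min hδ (by simpa using hε), fun s hs hsv z => ?_⟩
  have hle : ∀ y, ENNReal.ofReal (‖y - z‖ ^ (-(2*a))) ≤ ENNReal.ofReal (g (y - z)) + 1 := by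
    intro y
    by_cases hy : y - z ∈ Metric.ball 0 1
    · rw [hg, Set.indicator_of_mem hy]; exact le_self_add
    · rw [hg, Set.indicator_of_notMem hy]
      simp only [ENNReal.ofReal_zero, zero_add]
      rw [← ENNReal.ofReal_one]
      refine ENNReal.ofReal_le_ofReal ?_
      rw [mem_ball_zero_iff, not_lt] at hy
      exact Real.rpow_le_one_of_one_le_of_nonpos hy (by linarith)
  have hmeas : Measurable (fun y : EuclideanSpace ℝ (Fin n) => ‖y - z‖ ^ (-(2*a))) := by fun_prop
  have hgm : Measurable g := (by fun_prop : Measurable fun y : EuclideanSpace ℝ (Fin n) => ‖y‖ ^ (-(2*a))).indicator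
    Metric.isOpen_ball.measurableSet
  have hl : ∫⁻ y in s, ENNReal.ofReal (‖y - z‖ ^ (-(2*a))) ≤ ENNReal.ofReal ε := by
    calc ∫⁻ y in s, ENNReal.ofReal (‖y - z‖ ^ (-(2*a))) ≤ ∫⁻ y in s, (ENNReal.ofReal (g (y - z)) + 1) := 
          lintegral_mono hle
      _ = (∫⁻ y in s, ENNReal.ofReal (g (y - z))) + volume s := by
          rw [lintegral_add_right _ measurable_const]; simp
      _ ≤ ENNReal.ofReal (ε/2) + ENNReal.ofReal (ε/2) := by
          refine add_le_add ?_ (hsv.le.trans (min_le_right _ _))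
          have h1 : ∫⁻ y in s, ENNReal.ofReal (g (y - z)) = ∫⁻ y in ((fun y => y + z) ⁻¹' s), ENNReal.ofReal (g y) := by
            have mp := (measurePreserving_add_right (volume : Measure (EuclideanSpace ℝ (Fin n))) z)
            have := mp.setLIntegral_comp_preimage hs (f := fun y => ENNReal.ofReal (g (y - z))) (by fun_prop)
            simpa using this.symm
          rw [h1]
          refine (h _ ?_).le
          rw [measure_preimage_add_right]
          exact hsv.trans_le (min_le_left _ _)
      _ = _ := by rw [← ENNReal.ofReal_add (by positivity) (by positivity)]; congr 1; ring
  have hInt0 : IntegrableOn (fun y => ‖y - z‖ ^ (-(2*a))) s := by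
    refine ⟨hmeas.aestronglyMeasurable, ?_⟩
    rw [hasFiniteIntegral_iff_ofReal (Eventually.of_forall fun y => by positivity)]
    exact hl.trans_lt ENNReal.ofReal_lt_top
  refine ⟨hInt0, ?_⟩
  rw [integral_eq_lintegral_of_nonneg_ae (Eventually.of_forall fun y => by positivity) hInt0.1]
  exact ENNReal.toReal_le_of_le_ofReal hε.le hl

lemma pow_diff {s t p : ℝ} (hs : 0 ≤ s) (hst : s ≤ t) (ht : 0 < t) (hp : 1 ≤ p) : t^p - s^p ≤ p * t^(p-1) * (t - s) := by
  have h := one_add_mul_self_le_rpow_one_add (s := s/t - 1) (by have : 0 ≤ s/t := by positivity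
                                                                linarith) hp
  have h1 : (1 + (s/t - 1))^p = s^p / t^p := by rw [← Real.div_rpow hs ht.le]; congr 1; ring
  have h2 : t^p = t^(p-1) * t := by rw [← Real.rpow_add_one ht.ne']; congr 1; ring
  have htp : 0 < t^p := by positivity
  rw [h1, le_div_iff₀ htp] at h
  have h3 : (1 + p * (s/t - 1)) * t^p = t^p + p * t^(p-1) * (s - t) := by
    rw [h2]; field_simp
  rw [h3] at h
  linarith

def Sg {n : ℕ} (a : ℝ) (x : EuclideanSpace ℝ (Fin n)) (l : ℝ) (u : EuclideanSpace ℝ (Fin n) → ℝ) :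
    Set (EuclideanSpace ℝ (Fin n)) := 
  {y | ‖y - x‖ < l ∧ y ≠ x ∧ inversion x l y ≠ 0 ∧ uI a x l u y < u y}

lemma inv_cont {n : ℕ} {x y : EuclideanSpace ℝ (Fin n)} {l : ℝ} (hy : y ≠ x) : 
    ContinuousAt (fun q : ℝ × EuclideanSpace ℝ (Fin n) => inversion x q.1 q.2) (l, y) :=
  (ContDiffAt.inversion (n := 1) contDiffAt_const contDiffAt_fst contDiffAt_snd hy).continuousAt

lemma SolU.uI_cont {n a p c u} (S : SolU n a p c u) {x y : EuclideanSpace ℝ (Fin n)} {l : ℝ} (hl : 0 < l) (hy : y ≠ x)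
    (hy0 : inversion x l y ≠ 0) : ContinuousAt (fun q : ℝ × EuclideanSpace ℝ (Fin n) => uI a x q.1 u q.2) (l, y) := by
  unfold uI
  have hr := norm_pos_iff.2 (sub_ne_zero.2 hy)
  refine ContinuousAt.mul (ContinuousAt.rpow_const ?_ (Or.inl ?_)) ?_
  · exact ContinuousAt.div continuousAt_fst (by fun_prop) hr.ne'
  · simp only; positivity
  · exact ContinuousAt.comp (f := fun q : ℝ × EuclideanSpace ℝ (Fin n) => inversion x q.1 q.2) 
      (S.cont.continuousAt (isOpen_compl_singleton.mem_nhds hy0)) (inv_cont hy)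

lemma SolU.uI_cont' {n a p c u} (S : SolU n a p c u) {x y : EuclideanSpace ℝ (Fin n)} {l : ℝ} (hl : 0 < l) (hy : y ≠ x)
    (hy0 : inversion x l y ≠ 0) : ContinuousAt (uI a x l u) y :=
  ContinuousAt.comp (g := fun q : ℝ × EuclideanSpace ℝ (Fin n) => uI a x q.1 u q.2) (f := fun y => (l, y))
    (S.uI_cont hl hy hy0) (by fun_prop)

lemma SolU.uI_pos {n a p c u} (S : SolU n a p c u) {x y : EuclideanSpace ℝ (Fin n)} {l : ℝ} (hl : 0 < l) (hy : y ≠ x)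
    (hy0 : inversion x l y ≠ 0) : 0 < uI a x l u y := by
  have hr := norm_pos_iff.2 (sub_ne_zero.2 hy)
  have := S.upos _ hy0
  unfold uI
  positivity

lemma ne0_of_ball {n : ℕ} {x y : EuclideanSpace ℝ (Fin n)} {l : ℝ} (hlx : l < ‖x‖) (hy : ‖y - x‖ < l) : y ≠ 0 := by
  rintro rfl
  rw [zero_sub, norm_neg] at hy; linarith

lemma SolU.Sg_open {n a p c u} (S : SolU n a p c u) {x : EuclideanSpace ℝ (Fin n)} {l : ℝ} (hl : 0 < l) (hlx : l < ‖x‖) :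
    IsOpen (Sg a x l u) := by
  rw [isOpen_iff_mem_nhds]
  rintro y ⟨h1, h2, h3, h4⟩
  have hu : ContinuousAt u y := S.cont.continuousAt (isOpen_compl_singleton.mem_nhds (ne0_of_ball hlx h1))
  have hi : ContinuousAt (inversion x l) y := 
    ContinuousAt.comp (g := fun q : ℝ × EuclideanSpace ℝ (Fin n) => inversion x q.1 q.2) (f := fun y => (l, y))
      (inv_cont h2) (by fun_prop)
  have hc : Continuous fun y : EuclideanSpace ℝ (Fin n) => ‖y - x‖ := by fun_prop
  filter_upwards [hc.continuousAt.eventually (gt_mem_nhds h1), isOpen_ne.mem_nhds h2,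
    hi.eventually (isOpen_ne.mem_nhds h3), (S.uI_cont' hl h2 h3).eventually_lt hu h4] with w a1 a2 a3 a4
  exact ⟨a1, a2, a3, a4⟩

lemma SolU.crit {n a p c u} (S : SolU n a p c u) {κ : ℝ} (hκ : 0 < κ) (hrep : IRep a p κ u)
    {x : EuclideanSpace ℝ (Fin n)} {R : ℝ} (hRx : R < ‖x‖) :
    ∃ δ : ℝ≥0∞, 0 < δ ∧ ∀ l, 0 < l → l ≤ R → volume (Sg a x l u) < δ → Sg a x l u = ∅ := by
  have ha := S.ha
  have hn := S.hn
  have hp := S.p1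
  have : Nonempty (Fin n) := ⟨⟨0, by omega⟩⟩
  obtain ⟨M0, hM0⟩ : ∃ M, ∀ y ∈ Metric.closedBall x R, u y ≤ M := by
    have := (isCompact_closedBall x R).bddAbove_image (f := u) (S.cont.mono (by
      rintro y hy rfl
      rw [Metric.mem_closedBall, dist_zero_left] at hy; linarith))
    obtain ⟨M, hM⟩ := this
    exact ⟨M, fun y hy => hM ⟨y, hy, rfl⟩⟩
  set M := max M0 1
  have hM1 : 0 < M := lt_max_of_lt_right one_pos
  have hM : ∀ y, ‖y - x‖ < R → u y ≤ M := fun y hy => 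
    (hM0 y (by rw [Metric.mem_closedBall, dist_eq_norm]; exact hy.le)).trans (le_max_left _ _)
  set K := κ * (p * M^(p-1)) with hK
  have hK0 : 0 < K := by positivity
  obtain ⟨δ, hδ, hδs⟩ := pot_small (n := n) S.na (by linarith) (by omega) (ε := 1 / (2 * K)) (by positivity)
  refine ⟨δ, hδ, fun l hl hlR hvol => ?_⟩
  have hlx : l < ‖x‖ := by linarith
  have hmeas := (S.Sg_open (p := p) (c := c) hl hlx).measurableSet
  have hstep : ∀ m : ℝ, (∀ z ∈ Sg a x l u, u z - uI a x l u z ≤ m) → ∀ z ∈ Sg a x l u, u z - uI a x l u z ≤ m / 2 := by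
    intro m hm z hz
    obtain ⟨i1, e1⟩ := S.diff hrep hl hlx hz.2.1 hz.1 hz.2.2.1
    obtain ⟨j1, j2⟩ := hδs _ hmeas hvol z
    have hm0 : 0 ≤ m := by have := hm z hz; have := hz.2.2.2; linarith
    have hsub : Sg a x l u ⊆ Metric.ball x l := fun y hy => by
      rw [Metric.mem_ball, dist_eq_norm]; exact hy.1
    have hle : ∫ y in Metric.ball x l, kD a x l z y * (u y ^ p - uI a x l u y ^ p) ≤ 
       ∫ y in Metric.ball x l, (Sg a x l u).indicator (fun y => ‖y - z‖ ^ (-(2*a)) * (p * M^(p-1) * m)) y := by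
      refine integral_mono_ae i1 ?_ ?_
      · exact ((integrable_indicator_iff hmeas).2 (j1.mul_const _)).integrableOn
      · filter_upwards [ae_restrict_mem Metric.isOpen_ball.measurableSet, ae_restrict_of_ae (Measure.ae_ne volume x), 
          ae_restrict_of_ae (Measure.ae_ne volume (inversion x l 0)), ae_restrict_of_ae (Measure.ae_ne volume z)] with y y1 y2 y3 y4
        rw [Metric.mem_ball, dist_eq_norm] at y1
        have y3' : inversion x l y ≠ 0 := fun h => y3 (by rw [← h, inversion_inversion x hl.ne'])
        have kp := (kD_pos (a := a) (by linarith) hl hz.2.1 hz.1 y1 y4).le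
        have up := S.upos y (ne0_of_ball hlx y1)
        have ip := S.uI_pos (p := p) (c := c) hl y2 y3'
        by_cases hy : y ∈ Sg a x l u
        · rw [Set.indicator_of_mem hy]
          have d1 := pow_diff ip.le hy.2.2.2.le up hp.le
          have d2 : p * u y ^ (p-1) * (u y - uI a x l u y) ≤ p * M^(p-1) * m := by
            have := hm y hy
            have : u y ^ (p-1) ≤ M^(p-1) := Real.rpow_le_rpow up.le (hM y (by linarith)) (by linarith)
            have : 0 ≤ u y - uI a x l u y := by have := hy.2.2.2; linarith
            gcongr
          have : 0 ≤ p * M^(p-1) * m := by positivity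
          calc kD a x l z y * (u y ^ p - uI a x l u y ^ p) ≤ kD a x l z y * (p * M^(p-1) * m) := by gcongr; linarith
            _ ≤ _ := by gcongr; exact kD_le hl
        · rw [Set.indicator_of_notMem hy]
          have : u y ≤ uI a x l u y := by
            by_contra h
            exact hy ⟨y1, y2, y3', not_le.1 h⟩
          have : u y ^ p ≤ uI a x l u y ^ p := Real.rpow_le_rpow up.le this (by linarith)
          nlinarith
    rw [setIntegral_indicator hmeas, Set.inter_eq_right.2 hsub, integral_mul_const] at hle
    rw [e1]
    calc _ ≤ κ * ((1 / (2*K)) * (p * M^(p-1) * m)) := by gcongr; exact hle.trans (by gcongr)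
      _ = _ := by rw [hK]; field_simp
  have hall : ∀ k : ℕ, ∀ z ∈ Sg a x l u, u z - uI a x l u z ≤ M / 2^k := by
    intro k
    induction k with
    | zero =>
      intro z hz
      have := hM z (by have := hz.1; linarith)
      have := S.uI_pos (p := p) (c := c) hl hz.2.1 hz.2.2.1
      simp; linarith
    | succ k ih =>
      have := hstep _ ih
      rw [pow_succ, ← div_div]; exact this
  rw [Set.eq_empty_iff_forall_notMem]
  intro z hz
  have hlim : Tendsto (fun k : ℕ => M / 2^k) atTop (𝓝 0) := 
    tendsto_const_nhds.div_atTop (tendsto_pow_atTop_atTop_of_one_lt (by norm_num))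
  have := ge_of_tendsto' hlim fun k => hall k z hz
  have := hz.2.2.2
  linarith

end

section
open Filter Topology MeasureTheory EuclideanGeometry
open scoped ContDiff ENNReal

lemma SolU.strict {n a p c u} (S : SolU n a p c u) {κ : ℝ} (hκ : 0 < κ) (hrep : IRep a p κ u)
    (hsing : ∀ M δ : ℝ, 0 < δ → ∃ x, x ≠ 0 ∧ ‖x‖ < δ ∧ M < u x)
    {x z : EuclideanSpace ℝ (Fin n)} {l : ℝ} (hl : 0 < l) (hlx : l < ‖x‖) (hSg : Sg a x l u = ∅)
    (hzx : z ≠ x) (hzl : ‖z - x‖ < l) (hz0 : inversion x l z ≠ 0) : u z < uI a x l u z := by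
  have ha := S.ha
  have hn := S.hn
  have hp := S.p1
  have : Nonempty (Fin n) := ⟨⟨0, by omega⟩⟩
  have hle : ∀ y, ‖y - x‖ < l → y ≠ x → inversion x l y ≠ 0 → u y ≤ uI a x l u y := by
    intro y h1 h2 h3
    by_contra h
    have : y ∈ Sg a x l u := ⟨h1, h2, h3, not_le.1 h⟩
    rw [hSg] at this; exact this
  by_contra hcon
  have heq : u z - uI a x l u z = 0 := by
    have := hle z hzl hzx hz0
    linarith [not_lt.1 hcon]
  obtain ⟨i1, e1⟩ := S.diff hrep hl hlx hzx hzl hz0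
  rw [heq] at e1
  have hI : ∫ y in Metric.ball x l, kD a x l z y * (u y ^ p - uI a x l u y ^ p) = 0 := by
    rcases mul_eq_zero.1 e1.symm with h | h
    · exact absurd h hκ.ne'
    · exact h
  have hgood : ∀ᵐ y ∂(volume.restrict (Metric.ball x l)), ‖y - x‖ < l ∧ y ≠ x ∧ inversion x l y ≠ 0 ∧ y ≠ z := by
    filter_upwards [ae_restrict_mem Metric.isOpen_ball.measurableSet, ae_restrict_of_ae (Measure.ae_ne volume x), 
          ae_restrict_of_ae (Measure.ae_ne volume (inversion x l 0)), ae_restrict_of_ae (Measure.ae_ne volume z)] with y y1 y2 y3 y4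
    rw [Metric.mem_ball, dist_eq_norm] at y1
    exact ⟨y1, y2, fun h => y3 (by rw [← h, inversion_inversion x hl.ne']), y4⟩
  have hI' : ∫ y in Metric.ball x l, -(kD a x l z y * (u y ^ p - uI a x l u y ^ p)) = 0 := by
    rw [integral_neg, hI, neg_zero]
  have i2 : IntegrableOn (fun y => -(kD a x l z y * (u y ^ p - uI a x l u y ^ p))) (Metric.ball x l) := i1.neg
  rw [integral_eq_zero_iff_of_nonneg_ae ?_ i2] at hI'
  swap
  · filter_upwards [hgood] with y hy
    have kp := (kD_pos (a := a) (by linarith) hl hzx hzl hy.1 hy.2.2.2).le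
    have : u y ^ p ≤ uI a x l u y ^ p := 
      Real.rpow_le_rpow (S.upos y (ne0_of_ball hlx hy.1)).le (hle y hy.1 hy.2.1 hy.2.2.1) (by linarith)
    simp only [Pi.zero_apply]
    nlinarith
  have hae : ∀ᵐ y ∂(volume.restrict (Metric.ball x l)), ¬ (u y < uI a x l u y) := by
    filter_upwards [hgood, hI'] with y hy h0 hlt
    have kp := (kD_pos (a := a) (by linarith) hl hzx hzl hy.1 hy.2.2.2)
    have : u y ^ p < uI a x l u y ^ p := 
      Real.rpow_lt_rpow (S.upos y (ne0_of_ball hlx hy.1)).le hlt (by linarith)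
    simp only [Pi.zero_apply] at h0
    nlinarith
  set T : Set (EuclideanSpace ℝ (Fin n)) := {y | ‖y - x‖ < l ∧ y ≠ x ∧ inversion x l y ≠ 0 ∧ u y < uI a x l u y} with hT
  have hTo : IsOpen T := by
    rw [isOpen_iff_mem_nhds]
    rintro y ⟨h1, h2, h3, h4⟩
    have hu : ContinuousAt u y := S.cont.continuousAt (isOpen_compl_singleton.mem_nhds (ne0_of_ball hlx h1))
    have hi : ContinuousAt (inversion x l) y := 
      ContinuousAt.comp (g := fun q : ℝ × EuclideanSpace ℝ (Fin n) => inversion x q.1 q.2) (f := fun y => (l, y))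
        (inv_cont h2) (by fun_prop)
    have hc : Continuous fun y : EuclideanSpace ℝ (Fin n) => ‖y - x‖ := by fun_prop
    filter_upwards [hc.continuousAt.eventually (gt_mem_nhds h1), isOpen_ne.mem_nhds h2,
      hi.eventually (isOpen_ne.mem_nhds h3), hu.eventually_lt (S.uI_cont' hl h2 h3) h4] with w a1 a2 a3 a4
    exact ⟨a1, a2, a3, a4⟩
  have hT0 : volume T = 0 := by
    rw [ae_restrict_iff' Metric.isOpen_ball.measurableSet] at hae
    refine measure_mono_null ?_ hae
    rintro y ⟨h1, h2, h3, h4⟩ h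
    exact h (by rw [Metric.mem_ball, dist_eq_norm]; exact h1) h4
  rw [hTo.measure_eq_zero_iff volume] at hT0
  obtain ⟨M, hM⟩ : ∃ M, ∀ y ∈ Metric.closedBall x l, u y ≤ M := by
    have := (isCompact_closedBall x l).bddAbove_image (f := u) (S.cont.mono (by
      rintro y hy rfl
      rw [Metric.mem_closedBall, dist_zero_left] at hy; linarith))
    obtain ⟨M, hM⟩ := this
    exact ⟨M, fun y hy => hM ⟨y, hy, rfl⟩⟩
  obtain ⟨w, w0, wd, wM⟩ := hsing M (‖x‖ - l) (by linarith)
  have hwx : l < ‖w - x‖ := by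
    have := norm_sub_norm_le x w
    rw [norm_sub_rev] at this; linarith
  have hwx' : w ≠ x := by rintro rfl; simp at hwx; linarith
  have hyx : ‖inversion x l w - x‖ = l^2/‖w - x‖ := by
    rw [← dist_eq_norm, dist_inversion_center, dist_eq_norm]
  have hpos : 0 < ‖w - x‖ := by linarith
  have hyl : ‖inversion x l w - x‖ < l := by
    rw [hyx, div_lt_iff₀ hpos]; nlinarith
  have hyne : inversion x l w ≠ x := by
    intro h; rw [h, sub_self, norm_zero] at hyx
    have : 0 < l^2/‖w-x‖ := by positivity
    linarith
  have hii : inversion x l (inversion x l w) = w := inversion_inversion x hl.ne' w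
  have h1 : uI a x l u (inversion x l w) ≤ u (inversion x l w) := by
    by_contra h
    have : inversion x l w ∈ T := ⟨hyl, hyne, by rw [hii]; exact w0, not_le.1 h⟩
    rw [hT0] at this; exact this
  have h2 := hM (inversion x l w) (by rw [Metric.mem_closedBall, dist_eq_norm]; exact hyl.le)
  have h3 : u w ≤ uI a x l u (inversion x l w) := by
    unfold uI
    rw [hii]
    have : 1 ≤ (l / ‖inversion x l w - x‖)^(2*a) := by
      refine Real.one_le_rpow ?_ (by linarith)
      rw [le_div_iff₀ (norm_pos_iff.2 (sub_ne_zero.2 hyne))]; linarith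
    nlinarith [S.upos w w0]
  linarith

lemma SolU.mov {n a p c u} (S : SolU n a p c u) {κ : ℝ} (hκ : 0 < κ) (hrep : IRep a p κ u)
    (hsing : ∀ M δ : ℝ, 0 < δ → ∃ x, x ≠ 0 ∧ ‖x‖ < δ ∧ M < u x)
    {x : EuclideanSpace ℝ (Fin n)} {R : ℝ} (hR : 0 < R) (hRx : R < ‖x‖) : Sg a x R u = ∅ := by
  have ha := S.ha
  have hn := S.hn
  have : Nonempty (Fin n) := ⟨⟨0, by omega⟩⟩
  obtain ⟨δ, hδ, hcrit⟩ := S.crit hκ hrep hRx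
  obtain ⟨r, hr, hrR, hrs⟩ : ∃ r, 0 < r ∧ r ≤ R ∧ Sg a x r u = ∅ := by
    obtain ⟨U, hU, hUo, hUδ⟩ := Set.exists_isOpen_lt_of_lt ({x} : Set (EuclideanSpace ℝ (Fin n))) δ 
      (μ := volume) (by simpa using hδ)
    obtain ⟨ε, hε, hεU⟩ := Metric.isOpen_iff.1 hUo x (hU rfl)
    refine ⟨min ε R, lt_min hε hR, min_le_right _ _, hcrit _ (lt_min hε hR) (min_le_right _ _) ?_⟩
    refine (measure_mono ?_).trans_lt hUδ
    intro y hy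
    refine hεU ?_
    rw [Metric.mem_ball, dist_eq_norm]; exact hy.1.trans_le (min_le_left _ _)
  have key : Set.Icc r R ⊆ {l | Sg a x l u = ∅} := by
    refine IsClosed.Icc_subset_of_forall_mem_nhdsWithin ?_ hrs ?_
    · rw [← isOpen_compl_iff, isOpen_iff_mem_nhds]
      intro l hl
      by_cases hlI : l ∈ Set.Icc r R
      · have hne : (Sg a x l u).Nonempty := by
          rw [Set.nonempty_iff_ne_empty]; exact fun h => hl ⟨h, hlI⟩
        obtain ⟨y, h1, h2, h3, h4⟩ := hne
        have l0 : 0 < l := hr.trans_le hlI.1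
        have hi : ContinuousAt (fun t => inversion x t y) l := 
          ContinuousAt.comp (g := fun q : ℝ × EuclideanSpace ℝ (Fin n) => inversion x q.1 q.2) (f := fun t => (t, y))
            (inv_cont h2) (by fun_prop)
        have hui : ContinuousAt (fun t => uI a x t u y) l := 
          ContinuousAt.comp (g := fun q : ℝ × EuclideanSpace ℝ (Fin n) => uI a x q.1 u q.2) (f := fun t => (t, y))
            (S.uI_cont l0 h2 h3) (by fun_prop)
        filter_upwards [lt_mem_nhds h1, hi.eventually (isOpen_ne.mem_nhds h3), 
          hui.eventually_lt continuousAt_const h4] with t t1 t2 t3 ht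
        have : y ∈ Sg a x t u := ⟨t1, h2, t2, t3⟩
        rw [ht.1] at this; exact this
      · filter_upwards [isClosed_Icc.isOpen_compl.mem_nhds hlI] with t ht h
        exact ht h.2
    · rintro l ⟨hls, hlI⟩
      have hls : Sg a x l u = ∅ := hls
      have l0 : 0 < l := hr.trans_le hlI.1
      have hlx : l < ‖x‖ := hlI.2.trans hRx
      classical
      set A : ℝ → Set (EuclideanSpace ℝ (Fin n)) := fun t => if 0 < t ∧ t < ‖x‖ then Sg a x t u else ∅ with hA
      have hAm : ∀ t, MeasurableSet (A t) := by
        intro t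
        simp only [hA]
        split_ifs with h
        · exact (S.Sg_open h.1 h.2).measurableSet
        · exact MeasurableSet.empty
      have hAs : ∀ t, A t ⊆ Sg a x t u := by
        intro t
        simp only [hA]
        split_ifs with h
        · exact subset_rfl
        · exact Set.empty_subset _
      have hAB : ∀ t, A t ⊆ Metric.ball x ‖x‖ := by
        intro t
        simp only [hA]
        split_ifs with h
        · intro y hy
          rw [Metric.mem_ball, dist_eq_norm]; exact hy.1.trans h.2
        · exact Set.empty_subset _
      have hlim : Tendsto (fun t => volume (A t)) (𝓝[>] l) (𝓝 (volume (∅ : Set (EuclideanSpace ℝ (Fin n))))) := by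
        refine tendsto_measure_of_ae_tendsto_indicator (𝓝[>] l) MeasurableSet.empty hAm 
          Metric.isOpen_ball.measurableSet measure_ball_lt_top.ne (Eventually.of_forall hAB) ?_
        have hsph : ∀ᵐ y : EuclideanSpace ℝ (Fin n), y ∉ Metric.sphere x l := 
          measure_eq_zero_iff_ae_notMem.1 (Measure.addHaar_sphere volume x l)
        filter_upwards [hsph, Measure.ae_ne volume x, Measure.ae_ne volume (inversion x l 0)] with y y1 y2 y3
        rw [mem_sphere_iff_norm] at y1
        have y3' : inversion x l y ≠ 0 := fun h => y3 (by rw [← h, inversion_inversion x l0.ne'])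
        suffices ∀ᶠ t in 𝓝[>] l, y ∉ Sg a x t u by
          filter_upwards [this] with t ht
          simp only [Set.mem_empty_iff_false, iff_false]
          exact fun h => ht (hAs t h)
        refine Filter.Eventually.filter_mono nhdsWithin_le_nhds ?_
        rcases lt_or_gt_of_ne y1 with h | h
        · have hui : ContinuousAt (fun t => uI a x t u y) l := 
            ContinuousAt.comp (g := fun q : ℝ × EuclideanSpace ℝ (Fin n) => uI a x q.1 u q.2) (f := fun t => (t, y))
              (S.uI_cont l0 y2 y3') (by fun_prop)
          have hs := S.strict hκ hrep hsing l0 hlx hls y2 h y3'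
          filter_upwards [ContinuousAt.eventually_lt (continuousAt_const (y := u y)) hui hs] with t ht h'
          exact lt_asymm ht h'.2.2.2
        · filter_upwards [gt_mem_nhds h] with t ht h'
          exact lt_asymm ht h'.1
      rw [measure_empty] at hlim
      filter_upwards [hlim.eventually (gt_mem_nhds hδ), Ioo_mem_nhdsGT hlI.2] with t t1 t2
      have ht0 : 0 < t := l0.trans t2.1
      have : A t = Sg a x t u := if_pos ⟨ht0, t2.2.trans hRx⟩
      rw [this] at t1
      exact hcrit t ht0 t2.2.le t1
  exact key ⟨hrR, le_rfl⟩

end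

section
open Filter Topology MeasureTheory EuclideanGeometry
open scoped ContDiff ENNReal

lemma SolU.refl {n a p c u} (S : SolU n a p c u)
    (hmov : ∀ (x : EuclideanSpace ℝ (Fin n)) (R : ℝ), 0 < R → R < ‖x‖ → Sg a x R u = ∅)
    {e z : EuclideanSpace ℝ (Fin n)} {μ : ℝ} (he : ‖e‖ = 1) (hμ : 0 ≤ μ) (hs : μ < inner ℝ z e) 
    (h0 : z - (2 * (inner ℝ z e - μ)) • e ≠ 0) : u z ≤ u (z - (2 * (inner ℝ z e - μ)) • e) := by
  set s : ℝ := inner ℝ z e with hsdef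
  set N : ℝ := ‖z‖^2 with hN
  set D : ℝ → ℝ := fun t => 1 - 2*s*t + N*t^2 with hD
  set ρ : ℝ → ℝ := fun t => (1 - μ*t - t^2)^2 / D t with hρ
  set σ : ℝ → ℝ := fun t => (-2*μ - 2*t + (μ+t)^2*t + 2*s - N*t) / D t with hσ
  have D0 : D 0 = 1 := by simp [hD]
  have Dc : ContinuousAt D 0 := by simp only [hD]; fun_prop
  have ρc : Tendsto ρ (𝓝 0) (𝓝 1) := by
    have : ContinuousAt ρ 0 := ContinuousAt.div (by fun_prop) Dc (by rw [D0]; norm_num)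
    have h := this.tendsto
    have : ρ 0 = 1 := by simp [hρ, D0]
    rwa [this] at h
  have σc : Tendsto σ (𝓝 0) (𝓝 (2*(s-μ))) := by
    have : ContinuousAt σ 0 := ContinuousAt.div (by fun_prop) Dc (by rw [D0]; norm_num)
    have h := this.tendsto
    have : σ 0 = 2*(s-μ) := by simp [hσ, D0]; ring
    rwa [this] at h
  have Pc : Tendsto (fun t => ρ t • z - σ t • e) (𝓝 0) (𝓝 (z - (2*(s-μ)) • e)) := by
    have := (ρc.smul_const z).sub (σc.smul_const e)
    rwa [one_smul] at this
  have uc : Tendsto (fun t => ρ t ^ a * u (ρ t • z - σ t • e)) (𝓝 0) (𝓝 (u (z - (2*(s-μ)) • e))) := by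
    have h1 : Tendsto (fun t => ρ t ^ a) (𝓝 0) (𝓝 (1^a)) := ρc.rpow_const (Or.inl one_ne_zero)
    have h2 := (S.cont.continuousAt (isOpen_compl_singleton.mem_nhds h0)).tendsto.comp Pc
    have := h1.mul h2
    simpa using this
  refine ge_of_tendsto (uc.mono_left (nhdsWithin_le_nhds (s := Set.Ioi 0))) ?_
  have lc : ∀ᶠ t in 𝓝 (0:ℝ), 0 < 1 - μ*t - t^2 := by
    have : ContinuousAt (fun t : ℝ => 1 - μ*t - t^2) 0 := by fun_prop
    exact this.eventually (lt_mem_nhds (by simp))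
  filter_upwards [self_mem_nhdsWithin, nhdsWithin_le_nhds lc, 
    nhdsWithin_le_nhds (Dc.eventually (lt_mem_nhds (by rw [D0]; exact one_pos))),
    nhdsWithin_le_nhds (σc.eventually (lt_mem_nhds (by linarith : (0:ℝ) < 2*(s-μ)))),
    nhdsWithin_le_nhds (Pc.eventually (isOpen_ne.mem_nhds h0))] with t t0 tl tD tσ tP
  have t0 : 0 < t := t0
  set x := t⁻¹ • e with hx
  set l := t⁻¹ - μ - t with hl
  have lt' : l = (1 - μ*t - t^2) / t := by rw [hl]; field_simp
  have l0 : 0 < l := by rw [lt']; positivity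
  have xn : ‖x‖ = t⁻¹ := by rw [hx, norm_smul, he, Real.norm_of_nonneg (by positivity), mul_one]
  have hlx : l < ‖x‖ := by rw [xn, hl]; linarith
  have hd : ‖z - x‖^2 = D t / t^2 := by
    rw [norm_sub_sq_real, xn, hx, inner_smul_right, ← hsdef, ← hN, hD]; field_simp; ring
  have hd0 : 0 < ‖z - x‖ := by
    have : 0 < ‖z - x‖^2 := by rw [hd]; positivity
    by_contra h
    rw [le_antisymm (not_lt.1 h) (norm_nonneg _)] at this
    norm_num at this
  have hr : (l / ‖z - x‖)^2 = ρ t := by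
    rw [div_pow, hd, lt', hρ]; simp only; field_simp
  have hrs : ρ t = 1 + t * σ t := by
    simp only [hρ, hσ]
    field_simp
    simp only [hD]; ring
  have hzx : z ≠ x := fun h => by rw [h, sub_self, norm_zero] at hd0; exact lt_irrefl _ hd0
  have hzl : ‖z - x‖ < l := by
    have h1 : 1 < (l / ‖z-x‖)^2 := by rw [hr, hrs]; have := mul_pos t0 tσ; linarith
    have h2 : 1 < l / ‖z-x‖ := by
      by_contra h
      have : 0 < l / ‖z-x‖ := by positivity
      nlinarith
    rwa [one_lt_div hd0] at h2
  have hinv : inversion x l z = ρ t • z - σ t • e := by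
    rw [inversion, dist_eq_norm, hr, vsub_eq_sub, vadd_eq_add, smul_sub, hx, smul_smul, hrs]
    have : (1 + t * σ t) * t⁻¹ = t⁻¹ + σ t := by field_simp
    rw [this, add_smul _ _ e]
    abel
  have hm := hmov x l l0 hlx
  by_contra h
  have : z ∈ Sg a x l u := by
    refine ⟨hzl, hzx, by rw [hinv]; exact tP, ?_⟩
    unfold uI
    rw [hinv, mul_comm 2 a, mul_comm a 2, Real.rpow_mul (by positivity), Real.rpow_two, hr]
    exact not_le.1 h
  rw [hm] at this; exact this

lemma SolU.rad_le {n a p c u} (S : SolU n a p c u)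
    (hmov : ∀ (x : EuclideanSpace ℝ (Fin n)) (R : ℝ), 0 < R → R < ‖x‖ → Sg a x R u = ∅)
    {x y : EuclideanSpace ℝ (Fin n)} (hxy : ‖x‖ = ‖y‖) : u x ≤ u y := by
  by_cases h : x = y
  · rw [h]
  have hd : 0 < ‖x - y‖ := norm_pos_iff.2 (sub_ne_zero.2 h)
  have hy : y ≠ 0 := by
    rintro rfl
    rw [norm_zero, norm_eq_zero] at hxy; exact h hxy
  set e := ‖x - y‖⁻¹ • (x - y) with he
  have he1 : ‖e‖ = 1 := by rw [he, norm_smul, norm_inv, norm_norm, inv_mul_cancel₀ hd.ne']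
  have hs : inner ℝ x e = ‖x - y‖ / 2 := by
    rw [he, inner_smul_right, inner_sub_right, real_inner_self_eq_norm_sq]
    have := norm_sub_sq_real x y
    rw [← hxy] at this
    field_simp
    linarith
  have hz : x - (2 * (inner ℝ x e - 0)) • e = y := by
    rw [hs, he, smul_smul]
    have : 2 * (‖x-y‖/2 - 0) * ‖x-y‖⁻¹ = 1 := by field_simp; ring
    rw [this, one_smul]; abel
  have := S.refl hmov he1 le_rfl (z := x) (by rw [hs]; positivity) (by rw [hz]; exact hy)
  rwa [hz] at this

lemma SolU.anti {n a p c u} (S : SolU n a p c u)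
    (hmov : ∀ (x : EuclideanSpace ℝ (Fin n)) (R : ℝ), 0 < R → R < ‖x‖ → Sg a x R u = ∅)
    {x y : EuclideanSpace ℝ (Fin n)} (hy : y ≠ 0) (hxy : ‖y‖ ≤ ‖x‖) : u x ≤ u y := by
  rcases hxy.eq_or_lt with h | h
  · exact S.rad_le hmov h.symm
  have hy0 := norm_pos_iff.2 hy
  have hx0 : 0 < ‖x‖ := by linarith
  set e := ‖x‖⁻¹ • x with he
  have he1 : ‖e‖ = 1 := by rw [he, norm_smul, norm_inv, norm_norm, inv_mul_cancel₀ hx0.ne']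
  have hxe : x = ‖x‖ • e := by rw [he, smul_smul, mul_inv_cancel₀ hx0.ne', one_smul]
  have hs : inner ℝ x e = ‖x‖ := by
    rw [he, inner_smul_right, real_inner_self_eq_norm_sq]; field_simp
  have hz : x - (2 * (inner ℝ x e - (‖x‖ + ‖y‖)/2)) • e = ‖y‖ • e := by
    rw [hs]
    nth_rewrite 1 [hxe]
    rw [← sub_smul]; congr 1; ring
  have hn : ‖‖y‖ • e‖ = ‖y‖ := by rw [norm_smul, norm_norm, he1, mul_one]
  have h1 := S.refl hmov he1 (by positivity : 0 ≤ (‖x‖+‖y‖)/2) (z := x) (by rw [hs]; linarith) 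
    (by rw [hz, ← norm_pos_iff, hn]; exact hy0)
  rw [hz] at h1
  exact h1.trans (S.rad_le hmov hn)

lemma SolU.bdd {n a p c u} (S : SolU n a p c u)
    (hmov : ∀ (x : EuclideanSpace ℝ (Fin n)) (R : ℝ), 0 < R → R < ‖x‖ → Sg a x R u = ∅) :
    ∃ C, ∀ x ≠ 0, ‖x‖ ^ a * u x ≤ C := by
  have ha := S.ha
  have hn := S.hn
  have hp := S.p1
  have : Nonempty (Fin n) := ⟨⟨0, by omega⟩⟩
  obtain ⟨C, hC, h⟩ := S.ann_p
  set w : ℝ := volume.real (Metric.ball (0:EuclideanSpace ℝ (Fin n)) 1) with hw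
  have hw0 : 0 < w := ENNReal.toReal_pos (Metric.measure_ball_pos volume _ one_pos).ne' measure_ball_lt_top.ne
  refine ⟨2^a * (C * 2^n / w)^(p⁻¹), fun x hx => ?_⟩
  have hx0 := norm_pos_iff.2 hx
  have ux := S.upos x hx
  set R := ‖x‖/2 with hR
  have R0 : 0 < R := by positivity
  have hxR : ‖x‖ = 2 * R := by rw [hR]; ring
  have hm : MeasurableSet (ann n R) := (ann_compact n R).isClosed.measurableSet
  have i2 : IntegrableOn (fun y => u y ^ p) (ann n R) :=
    (S.contp.mono (ann_ne R0)).integrableOn_compact (ann_compact n R)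
  have i3 : IntegrableOn (fun _ => u x ^ p) (ann n R) :=
    integrableOn_const (ann_compact n R).measure_lt_top.ne
  have h1 : ∫ y in ann n R, u x ^ p ≤ ∫ y in ann n R, u y ^ p := by
    refine setIntegral_mono_on i3 i2 hm fun y hy => ?_
    exact Real.rpow_le_rpow ux.le (S.anti hmov (ann_ne R0 hy) (by rw [hxR]; exact hy.2)) (by linarith)
  rw [setIntegral_const, smul_eq_mul] at h1
  have h2 : (R/2)^n * w ≤ volume.real (ann n R) := by
    have : volume.real (Metric.ball ((3/4:ℝ) • x) (R/2)) = (R/2)^n * w := by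
      rw [hw, Measure.real, Measure.addHaar_ball _ _ (by positivity), finrank_euclideanSpace_fin, 
        ENNReal.toReal_mul, ENNReal.toReal_ofReal (by positivity)]; rfl
    rw [← this]
    refine measureReal_mono ?_ (ann_compact n R).measure_lt_top.ne
    intro y hy
    rw [Metric.mem_ball, dist_eq_norm] at hy
    have hq : ‖(3/4:ℝ) • x‖ = 3/2*R := by rw [norm_smul, hxR]; norm_num; ring
    have a1 := norm_sub_norm_le ((3/4:ℝ) • x) y
    have a2 := norm_sub_norm_le y ((3/4:ℝ) • x)
    rw [norm_sub_rev] at a1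
    exact ⟨by linarith, by linarith⟩
  have h3 : (R/2)^n * w * u x ^ p ≤ C * R^a := by
    have : 0 ≤ u x ^ p := by positivity
    calc _ ≤ volume.real (ann n R) * u x ^ p := by gcongr
      _ ≤ _ := h1.trans (h R R0)
  have h4 : (R^a * u x)^p ≤ C * 2^n / w := by
    rw [Real.mul_rpow (by positivity) ux.le, ← Real.rpow_mul R0.le, le_div_iff₀ hw0]
    have e1 : R^n = R^(a*p) * R^a := by
      rw [← Real.rpow_natCast, ← Real.rpow_add R0]; congr 1; rw [S.na]; linarith [S.hp]
    rw [div_pow, e1] at h3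
    have : 0 < R^a := by positivity
    have h5 : (R^(a*p) * u x ^ p * w) * R^a / 2^n ≤ C * R^a := by
      refine le_trans (le_of_eq ?_) h3; ring
    rw [div_le_iff₀ (by positivity)] at h5
    refine le_of_mul_le_mul_right (h5.trans (le_of_eq ?_)) this
    ring
  have h6 : R^a * u x ≤ (C * 2^n / w)^(p⁻¹) := by
    have := Real.rpow_le_rpow (by positivity) h4 (by positivity : 0 ≤ p⁻¹)
    rwa [← Real.rpow_mul (by positivity), mul_inv_cancel₀ (by linarith), Real.rpow_one] at this
  rw [hxR, Real.mul_rpow (by norm_num) R0.le, mul_assoc]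
  gcongr

end

/-- A positive C⁶ solution of (−Δ)³u = c_n·u^((n+6)/(n−6)) on ℝⁿ∖{0} which is unbounded
near the origin is radially symmetric about the origin, and its Emden–Fowler transform
v(t) = e^(−((n−6)/2)t)·u(e^(−t)ω) is a positive bounded periodic solution of the
sixth-order Emden–Fowler ODE. -/
theorem classification_singular_solutions (n : ℕ) (hn : 7 ≤ n)
    (u : EuclideanSpace ℝ (Fin n) → ℝ)
    (hu : ContDiffOn ℝ 6 u {(0 : EuclideanSpace ℝ (Fin n))}ᶜ)
    (hupos : ∀ x : EuclideanSpace ℝ (Fin n), x ≠ 0 → 0 < u x)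
    (hsol : ∀ x : EuclideanSpace ℝ (Fin n), x ≠ 0 →
      -(lap (lap (lap u)) x) = cst n * u x ^ (((n:ℝ)+6)/((n:ℝ)-6)))
    (hsing : ∀ M : ℝ, ∀ δ : ℝ, 0 < δ →
      ∃ x : EuclideanSpace ℝ (Fin n), x ≠ 0 ∧ ‖x‖ < δ ∧ M < u x) :
    (∀ x y : EuclideanSpace ℝ (Fin n), ‖x‖ = ‖y‖ → u x = u y)
    ∧ (∀ ω : EuclideanSpace ℝ (Fin n), ‖ω‖ = 1 →
        (∀ t : ℝ, 0 < Real.exp (-(((n:ℝ)-6)/2)*t) * u (Real.exp (-t) • ω))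
        ∧ (∃ C : ℝ, ∀ t : ℝ, Real.exp (-(((n:ℝ)-6)/2)*t) * u (Real.exp (-t) • ω) ≤ C)
        ∧ (∃ p : ℝ, 0 < p ∧ ∀ t : ℝ,
            Real.exp (-(((n:ℝ)-6)/2)*(t+p)) * u (Real.exp (-(t+p)) • ω)
              = Real.exp (-(((n:ℝ)-6)/2)*t) * u (Real.exp (-t) • ω))
        ∧ (∀ t : ℝ,
            -(iteratedDeriv 6 (fun s => Real.exp (-(((n:ℝ)-6)/2)*s) * u (Real.exp (-s) • ω)) t)
              + K4 n * iteratedDeriv 4 (fun s => Real.exp (-(((n:ℝ)-6)/2)*s) * u (Real.exp (-s) • ω)) t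
              - K2 n * iteratedDeriv 2 (fun s => Real.exp (-(((n:ℝ)-6)/2)*s) * u (Real.exp (-s) • ω)) t
              + K0 n * (Real.exp (-(((n:ℝ)-6)/2)*t) * u (Real.exp (-t) • ω))
              = cst n * (Real.exp (-(((n:ℝ)-6)/2)*t) * u (Real.exp (-t) • ω))
                  ^ (((n:ℝ)+6)/((n:ℝ)-6)))) := by
  have hn7 : (7:ℝ) ≤ n := by exact_mod_cast hn
  have h6 : (n:ℝ) - 6 ≠ 0 := by linarith
  have S : SolU n (((n:ℝ)-6)/2) (((n:ℝ)+6)/((n:ℝ)-6)) (cst n) u := 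
    { na := by ring
      ha := by linarith
      hp := by field_simp; ring
      hc := cst_pos hn
      hu := hu
      upos := hupos
      sol := fun x hx => by rw [← hsol x hx, neg_neg] }
  obtain ⟨κ, hκ, hrep⟩ := S.repr
  have hmov : ∀ (x : EuclideanSpace ℝ (Fin n)) (R : ℝ), 0 < R → R < ‖x‖ → Sg (((n:ℝ)-6)/2) x R u = ∅ :=
    fun x R h1 h2 => S.mov hκ hrep hsing h1 h2
  refine final_assembly n hn u hu hupos hsol hsing 
    (fun x y h => le_antisymm (S.rad_le hmov h) (S.rad_le hmov h.symm)) ?_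
  obtain ⟨C, hC⟩ := S.bdd hmov
  refine ⟨C, fun x hx => ?_⟩
  have := hC x hx
  rwa [Real.rpow_def_of_pos (norm_pos_iff.2 hx), mul_comm (Real.log _)] at this
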